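/- arXiv:1709.06037 — 3 statements merged into one kernel-verified Lean document; each statement's English description precedes it below -/
import Mathlib

section
/- Let ψ : [0,∞) → ℝ be bounded from below. Then ψ is negative definite on the additive semigroup ([0,∞),+) if and only if for every dimension d ≥ 1 the function γ : ℝ^d → ℝ defined by γ(h) = ψ(‖h‖²) is negative definite in the variogram sense. -/
/-- `ψ : [0,∞) → ℝ` is negative definite on the additive semigroup `([0,∞), +)`:
for all `n`, all `s₁,…,sₙ ≥ 0` and `a₁,…,aₙ ∈ ℝ` with `∑ aᵢ = 0`,
`∑ᵢ∑ⱼ aᵢ aⱼ ψ(sᵢ + sⱼ) ≤ 0`. -/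
def NegDefHalfLine (ψ : ℝ → ℝ) : Prop :=
  ∀ (n : ℕ) (s : Fin n → ℝ), (∀ i, 0 ≤ s i) → ∀ a : Fin n → ℝ,
    ∑ i, a i = 0 → ∑ i, ∑ j, a i * a j * ψ (s i + s j) ≤ 0

/-- `γ : ℝ^d → ℝ` is negative definite in the variogram sense: `γ(−x) = γ(x)` and
`∑ᵢ∑ⱼ aᵢ aⱼ γ(xᵢ − xⱼ) ≤ 0` whenever `∑ aᵢ = 0`. -/
def VariogramND (d : ℕ) (γ : EuclideanSpace ℝ (Fin d) → ℝ) : Prop :=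
  (∀ x, γ (-x) = γ x) ∧
  ∀ (n : ℕ) (x : Fin n → EuclideanSpace ℝ (Fin d)) (a : Fin n → ℝ),
    ∑ i, a i = 0 → ∑ i, ∑ j, a i * a j * γ (x i - x j) ≤ 0

open Polynomial Filter Topology Set MeasureTheory ProbabilityTheory

/-- A linear functional on real polynomials that is nonnegative on the products of a square with
`1`, `X`, `1 - X` and `X * (1 - X)`. -/
structure IsUnitIntervalPositive (M : ℝ[X] →ₗ[ℝ] ℝ) : Prop where
  sq : ∀ r : ℝ[X], 0 ≤ M (r ^ 2)
  X_mul_sq : ∀ r : ℝ[X], 0 ≤ M (X * r ^ 2)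
  one_sub_mul_sq : ∀ r : ℝ[X], 0 ≤ M ((1 - X) * r ^ 2)
  X_mul_one_sub_mul_sq : ∀ r : ℝ[X], 0 ≤ M (X * (1 - X) * r ^ 2)

theorem Icc_subset_closure_Ioo_diff_singleton (c : ℝ) :
    Icc (0 : ℝ) 1 ⊆ closure (Ioo 0 1 ∩ {c}ᶜ) := by
  rw [← closure_Ioo (zero_ne_one' ℝ)]
  exact closure_minimal ((dense_compl_singleton c).open_subset_closure_inter isOpen_Ioo)
    isClosed_closure

theorem Polynomial.eval_nonneg_on_Icc_of_Ioo_diff_singleton {q : ℝ[X]} (c : ℝ)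
    (h : ∀ x ∈ Ioo (0 : ℝ) 1, x ≠ c → 0 ≤ q.eval x) : ∀ x ∈ Icc (0 : ℝ) 1, 0 ≤ q.eval x := by
  intro x hx
  have hclosed : IsClosed {x : ℝ | 0 ≤ q.eval x} := isClosed_le continuous_const q.continuous
  exact closure_minimal (fun y hy => h y hy.1 hy.2) hclosed
    (Icc_subset_closure_Ioo_diff_singleton c hx)

theorem IsUnitIntervalPositive.X_mul {M : ℝ[X] →ₗ[ℝ] ℝ} (hM : IsUnitIntervalPositive M) :
    IsUnitIntervalPositive (M ∘ₗ LinearMap.mulLeft ℝ X) where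
  sq r := by simpa using hM.X_mul_sq r
  X_mul_sq r := by
    have := hM.sq (X * r)
    simp only [LinearMap.comp_apply, LinearMap.mulLeft_apply]
    convert this using 2; ring
  one_sub_mul_sq r := by
    have := hM.X_mul_one_sub_mul_sq r
    simp only [LinearMap.comp_apply, LinearMap.mulLeft_apply]
    convert this using 2; ring
  X_mul_one_sub_mul_sq r := by
    have := hM.one_sub_mul_sq (X * r)
    simp only [LinearMap.comp_apply, LinearMap.mulLeft_apply]
    convert this using 2; ring

theorem IsUnitIntervalPositive.one_sub_mul {M : ℝ[X] →ₗ[ℝ] ℝ} (hM : IsUnitIntervalPositive M) :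
    IsUnitIntervalPositive (M ∘ₗ LinearMap.mulLeft ℝ (1 - X)) where
  sq r := by simpa using hM.one_sub_mul_sq r
  X_mul_sq r := by
    have := hM.X_mul_one_sub_mul_sq r
    simp only [LinearMap.comp_apply, LinearMap.mulLeft_apply]
    convert this using 2; ring
  one_sub_mul_sq r := by
    have := hM.sq ((1 - X) * r)
    simp only [LinearMap.comp_apply, LinearMap.mulLeft_apply]
    convert this using 2; ring
  X_mul_one_sub_mul_sq r := by
    have := hM.X_mul_sq ((1 - X) * r)
    simp only [LinearMap.comp_apply, LinearMap.mulLeft_apply]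
    convert this using 2; ring

theorem IsUnitIntervalPositive.sq_mul {M : ℝ[X] →ₗ[ℝ] ℝ} (hM : IsUnitIntervalPositive M)
    (q : ℝ[X]) : IsUnitIntervalPositive (M ∘ₗ LinearMap.mulLeft ℝ (q ^ 2)) where
  sq r := by
    have := hM.sq (q * r)
    simp only [LinearMap.comp_apply, LinearMap.mulLeft_apply]
    convert this using 2; ring
  X_mul_sq r := by
    have := hM.X_mul_sq (q * r)
    simp only [LinearMap.comp_apply, LinearMap.mulLeft_apply]
    convert this using 2; ring
  one_sub_mul_sq r := by
    have := hM.one_sub_mul_sq (q * r)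
    simp only [LinearMap.comp_apply, LinearMap.mulLeft_apply]
    convert this using 2; ring
  X_mul_one_sub_mul_sq r := by
    have := hM.X_mul_one_sub_mul_sq (q * r)
    simp only [LinearMap.comp_apply, LinearMap.mulLeft_apply]
    convert this using 2; ring

/-- A functional that is nonnegative on the four basic families is nonnegative on every polynomial
that is nonnegative on `[0, 1]`: subtract the minimum and divide by the resulting factor. -/
theorem IsUnitIntervalPositive.nonneg {M : ℝ[X] →ₗ[ℝ] ℝ} (hM : IsUnitIntervalPositive M)
    {p : ℝ[X]} (hp : ∀ x ∈ Icc (0 : ℝ) 1, 0 ≤ p.eval x) : 0 ≤ M p := by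
  induction hn : p.natDegree using Nat.strong_induction_on generalizing M p with
  | _ n ih =>
  subst hn
  obtain ⟨c, hc, hmin⟩ := isCompact_Icc.exists_isMinOn (nonempty_Icc.2 zero_le_one)
    (p.continuous.continuousOn (s := Icc (0 : ℝ) 1))
  have hmin' : ∀ x ∈ Icc (0 : ℝ) 1, p.eval c ≤ p.eval x := fun x hx => hmin hx
  have hconst : 0 ≤ M (C (p.eval c)) := by
    have h1 : C (p.eval c) = p.eval c • (1 : ℝ[X]) ^ 2 := by simp [smul_eq_C_mul]
    rw [h1, map_smul, smul_eq_mul]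
    exact mul_nonneg (hp c hc) (hM.sq 1)
  obtain ⟨q, hq⟩ : X - C c ∣ p - C (p.eval c) := dvd_iff_isRoot.2 (by simp)
  have hpq : p = C (p.eval c) + (X - C c) * q := by rw [← hq]; ring
  have hMp : M p = M (C (p.eval c)) + M ((X - C c) * q) := by
    rw [← map_add, ← hpq]
  rw [hMp]
  refine add_nonneg hconst ?_
  have hev : ∀ x ∈ Icc (0 : ℝ) 1, 0 ≤ (x - c) * q.eval x := by
    intro x hx
    have h1 := hmin' x hx
    have h2 := congrArg (eval x) hq
    simp only [eval_sub, eval_C, eval_mul, eval_X] at h2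
    linarith
  by_cases hq0 : q = 0
  · simp [hq0]
  have hdeg : p.natDegree = q.natDegree + 1 := by
    have h1 : (p - C (p.eval c)).natDegree = p.natDegree := natDegree_sub_C
    rw [← h1, hq, natDegree_mul (X_sub_C_ne_zero c) hq0, natDegree_X_sub_C, add_comm]
  rcases hc.1.eq_or_lt with h0 | h0
  · subst h0
    have := ih q.natDegree (by omega) hM.X_mul (p := q)
      (eval_nonneg_on_Icc_of_Ioo_diff_singleton 0 fun x hx _ =>
        nonneg_of_mul_nonneg_right (by simpa using hev x (Ioo_subset_Icc_self hx)) hx.1) rfl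
    simpa using this
  rcases hc.2.eq_or_lt with h1 | h1
  · subst h1
    have := ih (-q).natDegree (by rw [natDegree_neg]; omega) hM.one_sub_mul (p := -q)
      (eval_nonneg_on_Icc_of_Ioo_diff_singleton 0 fun x hx _ => by
        have h2 := hev x (Ioo_subset_Icc_self hx)
        rw [eval_neg]
        refine nonneg_of_mul_nonneg_right (a := 1 - x) ?_ (by linarith [hx.2])
        linarith) rfl
    rw [LinearMap.comp_apply, LinearMap.mulLeft_apply] at this
    rwa [C_1, show (X - 1) * q = (1 - X) * -q by ring]
  · have hloc : IsLocalMin (fun x => p.eval x) c :=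
      hmin.isLocalMin (Icc_mem_nhds h0 h1)
    have hder : p.derivative.eval c = 0 := by
      rw [← Polynomial.deriv]; exact hloc.deriv_eq_zero
    have hqc : q.eval c = 0 := by
      rw [hpq] at hder
      simpa using hder
    obtain ⟨r, rfl⟩ : X - C c ∣ q := dvd_iff_isRoot.2 hqc
    have hr0 : r ≠ 0 := right_ne_zero_of_mul hq0
    have hdeg' : ((X - C c) * r).natDegree = r.natDegree + 1 := by
      rw [natDegree_mul (X_sub_C_ne_zero c) hr0, natDegree_X_sub_C, add_comm]
    have := ih r.natDegree (by omega) (hM.sq_mul (X - C c)) (p := r)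
      (eval_nonneg_on_Icc_of_Ioo_diff_singleton c fun x hx hxc => by
        have h2 := hev x (Ioo_subset_Icc_self hx)
        simp only [eval_mul, eval_sub, eval_X, eval_C] at h2
        refine nonneg_of_mul_nonneg_right (a := (x - c) ^ 2) ?_
          (by have := sub_ne_zero.2 hxc; positivity)
        linarith) rfl
    rwa [LinearMap.comp_apply, LinearMap.mulLeft_apply, pow_two, mul_assoc] at this

section HalfLine

variable {ψ : ℝ → ℝ}

theorem NegDefHalfLine.second_difference_nonpos (hψ : NegDefHalfLine ψ) {u h : ℝ} (hu : 0 ≤ u)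
    (hh : 0 ≤ h) : ψ (u + 2 * h) - ψ (u + h) ≤ ψ (u + h) - ψ u := by
  have := hψ 2 ![u / 2, u / 2 + h] (by intro i; fin_cases i <;> simp <;> positivity) ![1, -1]
    (by simp)
  simp only [Fin.sum_univ_two, Matrix.cons_val_zero, Matrix.cons_val_one] at this
  rw [show u / 2 + u / 2 = u by ring, show u / 2 + (u / 2 + h) = u + h by ring,
    show u / 2 + h + u / 2 = u + h by ring, show u / 2 + h + (u / 2 + h) = u + 2 * h by ring]
    at this
  linarith

theorem NegDefHalfLine.antitone_increments (hψ : NegDefHalfLine ψ) {u h : ℝ} (hu : 0 ≤ u)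
    (hh : 0 ≤ h) : Antitone fun k : ℕ => ψ (u + (k + 1) * h) - ψ (u + k * h) := by
  refine antitone_nat_of_succ_le fun k => ?_
  have := hψ.second_difference_nonpos (u := u + k * h) (by positivity) hh
  rw [show u + k * h + 2 * h = u + (k + 1 + 1) * h by ring,
    show u + k * h + h = u + (k + 1) * h by ring] at this
  push_cast
  exact this

theorem NegDefHalfLine.monotoneOn (hψ : NegDefHalfLine ψ)
    (hbdd : ∃ m : ℝ, ∀ x : ℝ, 0 ≤ x → m ≤ ψ x) : MonotoneOn ψ (Ici 0) := by
  intro u hu t _ hut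
  have hu : 0 ≤ u := hu
  obtain ⟨m, hm⟩ := hbdd
  have hh : 0 ≤ t - u := sub_nonneg.2 hut
  have hanti := hψ.antitone_increments hu hh
  by_contra! hlt
  have hub : ∀ k : ℕ, ψ (u + k * (t - u)) ≤ ψ u + k * (ψ t - ψ u) := by
    intro k
    induction k with
    | zero => simp
    | succ k ih =>
      have := hanti (Nat.zero_le k)
      simp only [Nat.cast_zero, zero_add, one_mul, zero_mul, add_zero, add_sub_cancel] at this
      push_cast
      linarith
  obtain ⟨k, hk⟩ := exists_nat_gt ((ψ u - m) / (ψ u - ψ t))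
  rw [div_lt_iff₀ (by linarith)] at hk
  have h1 := hub k
  have h2 := hm (u + k * (t - u)) (by positivity)
  linarith

theorem NegDefHalfLine.nsmul_increment_le (hψ : NegDefHalfLine ψ)
    (hmono : MonotoneOn ψ (Ici 0)) {u δ : ℝ} {n : ℕ} (hδ : 0 ≤ δ) (hn : n * δ ≤ u) :
    n * (ψ (u + δ) - ψ u) ≤ ψ u - ψ 0 := by
  have hv : 0 ≤ u - n * δ := sub_nonneg.2 hn
  have hanti := hψ.antitone_increments hv hδ
  have h0 : ψ 0 ≤ ψ (u - n * δ) := hmono self_mem_Ici hv hv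
  have hub : ∀ k ≤ n, k * (ψ (u + δ) - ψ u) ≤ ψ (u - n * δ + k * δ) - ψ (u - n * δ) := by
    intro k hk
    induction k with
    | zero => simp
    | succ k ih =>
      have h1 := ih (by omega)
      have h2 := hanti (show k ≤ n by omega)
      simp only at h2
      rw [show u - n * δ + (n + 1) * δ = u + δ by ring, sub_add_cancel] at h2
      push_cast
      linarith
  have := hub n le_rfl
  rw [sub_add_cancel] at this
  linarith

theorem NegDefHalfLine.continuousAt (hψ : NegDefHalfLine ψ)
    (hbdd : ∃ m : ℝ, ∀ x : ℝ, 0 ≤ x → m ≤ ψ x) {t : ℝ} (ht : 0 < t) : ContinuousAt ψ t := by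
  have hmono := hψ.monotoneOn hbdd
  rw [Metric.continuousAt_iff]
  intro ε hε
  obtain ⟨n, hn⟩ := exists_nat_gt ((ψ t - ψ 0) / ε)
  rw [div_lt_iff₀ hε] at hn
  have h0t : ψ 0 ≤ ψ t := hmono self_mem_Ici ht.le ht.le
  have hnpos : (0 : ℝ) < n := by
    by_contra! h
    nlinarith
  set δ := t / (n + 1) with hδ
  have hδ0 : 0 < δ := by positivity
  have hδt : n * δ + δ = t := by rw [hδ]; field_simp
  have hnδ : 0 ≤ n * δ := by positivity
  have hright := hψ.nsmul_increment_le hmono (u := t) (n := n) hδ0.le (by linarith)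
  have hleft := hψ.nsmul_increment_le hmono (u := t - δ) (n := n) hδ0.le (by linarith)
  have hlt : ψ (t - δ) ≤ ψ t := hmono (by simp; linarith) ht.le (by linarith)
  rw [sub_add_cancel] at hleft
  refine ⟨δ, hδ0, fun {y} hy => ?_⟩
  rw [Real.dist_eq, abs_lt] at hy
  have h1 : ψ (t - δ) ≤ ψ y := hmono (by simp; linarith) (by simp; linarith) (by linarith)
  have h2 : ψ y ≤ ψ (t + δ) := hmono (by simp; linarith) (by simp; linarith) (by linarith)
  have h3 : ψ (t + δ) - ψ t < ε := lt_of_mul_lt_mul_left (by linarith) hnpos.le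
  have h4 : ψ t - ψ (t - δ) < ε := lt_of_mul_lt_mul_left (by linarith) hnpos.le
  rw [Real.dist_eq, abs_lt]
  constructor <;> linarith

/-- The linear functional on polynomials sending `X ^ k` to `ψ (k * h)`. -/
noncomputable def sampleFunctional (ψ : ℝ → ℝ) (h : ℝ) : ℝ[X] →ₗ[ℝ] ℝ :=
  Polynomial.lsum fun k => ψ (k * h) • LinearMap.id

theorem sampleFunctional_C_mul_X_pow (ψ : ℝ → ℝ) (h c : ℝ) (k : ℕ) :
    sampleFunctional ψ h (C c * X ^ k) = c * ψ (k * h) := by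
  rw [sampleFunctional, Polynomial.lsum_apply, C_mul_X_pow_eq_monomial,
    sum_monomial_index c _ (by simp), LinearMap.smul_apply, LinearMap.id_apply, smul_eq_mul,
    mul_comm]

theorem sampleFunctional_X_pow (ψ : ℝ → ℝ) (h : ℝ) (k : ℕ) :
    sampleFunctional ψ h (X ^ k) = ψ (k * h) := by
  simpa using sampleFunctional_C_mul_X_pow ψ h 1 k

theorem NegDefHalfLine.sampleFunctional_X_pow_mul_sq_nonpos (hψ : NegDefHalfLine ψ) {h : ℝ}
    (hh : 0 ≤ h) (m : ℕ) {q : ℝ[X]} (hq : q.eval 1 = 0) :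
    sampleFunctional ψ h (X ^ m * q ^ 2) ≤ 0 := by
  have hsum : q = ∑ i : Fin (q.natDegree + 1), C (q.coeff i) * X ^ (i : ℕ) := by
    rw [Fin.sum_univ_eq_sum_range (fun i => C (q.coeff i) * X ^ i)]
    exact q.as_sum_range_C_mul_X_pow
  have hzero : ∑ i : Fin (q.natDegree + 1), q.coeff i = 0 := by
    rw [Fin.sum_univ_eq_sum_range (fun i => q.coeff i), ← hq, eval_eq_sum_range]
    simp
  have := hψ _ (fun i : Fin (q.natDegree + 1) => (i + m / 2) * h)
    (fun i => by positivity) (fun i => q.coeff i) hzero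
  refine le_of_eq_of_le ?_ this
  have hexp : X ^ m * q ^ 2 = ∑ i : Fin (q.natDegree + 1), ∑ j : Fin (q.natDegree + 1),
      C (q.coeff i * q.coeff j) * X ^ (i + j + m : ℕ) := by
    conv_lhs => rw [hsum]
    rw [sq, Finset.sum_mul_sum, Finset.mul_sum]
    refine Finset.sum_congr rfl fun i _ => ?_
    rw [Finset.mul_sum]
    refine Finset.sum_congr rfl fun j _ => ?_
    rw [C_mul]; ring
  rw [hexp]
  simp only [map_sum, sampleFunctional_C_mul_X_pow]
  refine Finset.sum_congr rfl fun i _ => Finset.sum_congr rfl fun j _ => ?_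
  congr 2
  push_cast; ring

/-- The functional `p ↦ -L ((1 - X) * p)`, with `L` the sampling functional; it sends `X ^ k` to
the increment `ψ ((k + 1) * h) - ψ (k * h)`. -/
noncomputable def incrementFunctional (ψ : ℝ → ℝ) (h : ℝ) : ℝ[X] →ₗ[ℝ] ℝ :=
  -(sampleFunctional ψ h ∘ₗ LinearMap.mulLeft ℝ (1 - X))

theorem incrementFunctional_apply (ψ : ℝ → ℝ) (h : ℝ) (p : ℝ[X]) :
    incrementFunctional ψ h p = -sampleFunctional ψ h ((1 - X) * p) := rfl

theorem NegDefHalfLine.tendsto_incrementFunctional (hψ : NegDefHalfLine ψ)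
    (hbdd : ∃ m : ℝ, ∀ x : ℝ, 0 ≤ x → m ≤ ψ x) {h : ℝ} (hh : 0 ≤ h) :
    ∃ E : ℝ, 0 ≤ E ∧ ∀ p : ℝ[X],
      Tendsto (fun m : ℕ => incrementFunctional ψ h (X ^ m * p)) atTop (𝓝 (E * p.eval 1)) := by
  have hmono := hψ.monotoneOn hbdd
  set e : ℕ → ℝ := fun k => ψ ((k + 1) * h) - ψ (k * h) with he
  have he0 : ∀ k, 0 ≤ e k := fun k => sub_nonneg.2 <| hmono
    (show (0 : ℝ) ≤ k * h by positivity) (show (0 : ℝ) ≤ (k + 1) * h by positivity)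
    (by nlinarith)
  have hanti : Antitone e := by simpa using hψ.antitone_increments le_rfl hh
  have hinc : ∀ k, incrementFunctional ψ h (X ^ k) = e k := by
    intro k
    have h1 : (1 - X) * X ^ k = X ^ k - (X : ℝ[X]) ^ (k + 1) := by ring
    rw [incrementFunctional_apply, h1, map_sub, sampleFunctional_X_pow, sampleFunctional_X_pow]
    simp [he]
  have hlim := tendsto_atTop_ciInf hanti ⟨0, by rintro _ ⟨k, rfl⟩; exact he0 k⟩
  refine ⟨⨅ k, e k, le_ciInf he0, fun p => ?_⟩
  induction p using Polynomial.induction_on' with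
  | add p q hp hq => simpa [mul_add] using hp.add hq
  | monomial k c =>
    have h1 : ∀ m : ℕ, incrementFunctional ψ h (X ^ m * monomial k c) = c * e (m + k) := by
      intro m
      have h2 : X ^ m * monomial k c = c • (X : ℝ[X]) ^ (m + k) := by
        rw [← C_mul_X_pow_eq_monomial, smul_eq_C_mul]; ring
      rw [h2, map_smul, hinc, smul_eq_mul]
    simp only [h1, eval_monomial, one_pow, mul_one]
    rw [mul_comm]
    exact ((tendsto_add_atTop_iff_nat k).2 hlim).const_mul c

theorem NegDefHalfLine.isUnitIntervalPositive_incrementFunctional (hψ : NegDefHalfLine ψ)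
    (hbdd : ∃ m : ℝ, ∀ x : ℝ, 0 ≤ x → m ≤ ψ x) {h : ℝ} (hh : 0 ≤ h) :
    IsUnitIntervalPositive (incrementFunctional ψ h) := by
  have hone : ∀ (m : ℕ) (r : ℝ[X]), 0 ≤ incrementFunctional ψ h (X ^ m * (1 - X) * r ^ 2) := by
    intro m r
    have := hψ.sampleFunctional_X_pow_mul_sq_nonpos hh m (q := (1 - X) * r) (by simp)
    rw [incrementFunctional_apply,
      show (1 - X) * (X ^ m * (1 - X) * r ^ 2) = X ^ m * ((1 - X) * r) ^ 2 by ring]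
    linarith
  have hpow : ∀ (m : ℕ) (r : ℝ[X]), 0 ≤ incrementFunctional ψ h (X ^ m * r ^ 2) := by
    intro m r
    obtain ⟨E, hE, hlim⟩ := hψ.tendsto_incrementFunctional hbdd hh
    have hanti : Antitone fun m : ℕ => incrementFunctional ψ h (X ^ m * r ^ 2) := by
      refine antitone_nat_of_succ_le fun m => ?_
      have := hone m r
      rw [show X ^ m * (1 - X) * r ^ 2 = X ^ m * r ^ 2 - X ^ (m + 1) * r ^ 2 by ring,
        map_sub] at this
      linarith
    refine le_trans ?_ (hanti.le_of_tendsto (hlim (r ^ 2)) m)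
    rw [eval_pow]
    positivity
  exact
    { sq := fun r => by simpa using hpow 0 r
      X_mul_sq := fun r => by simpa using hpow 1 r
      one_sub_mul_sq := fun r => by simpa using hone 0 r
      X_mul_one_sub_mul_sq := fun r => by simpa using hone 1 r }

theorem NegDefHalfLine.sum_nonpos_of_pow_kernel (hψ : NegDefHalfLine ψ)
    (hbdd : ∃ m : ℝ, ∀ x : ℝ, 0 ≤ x → m ≤ ψ x) {h : ℝ} (hh : 0 ≤ h) {n : ℕ}
    (K : Fin n → Fin n → ℕ) {a : Fin n → ℝ} (ha : ∑ i, a i = 0)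
    (hK : ∀ x ∈ Ioo (0 : ℝ) 1, 0 ≤ ∑ i, ∑ j, a i * a j * x ^ K i j) :
    ∑ i, ∑ j, a i * a j * ψ (K i j * h) ≤ 0 := by
  set p : ℝ[X] := ∑ i, ∑ j, C (a i * a j) * X ^ K i j with hp
  have hL : sampleFunctional ψ h p = ∑ i, ∑ j, a i * a j * ψ (K i j * h) := by
    simp only [hp, map_sum, sampleFunctional_C_mul_X_pow]
  have hev : ∀ x, p.eval x = ∑ i, ∑ j, a i * a j * x ^ K i j := by
    intro x
    simp [hp, eval_finsetSum]
  have hroot : p.eval 1 = 0 := by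
    rw [hev]
    simp [← Finset.mul_sum, ha]
  obtain ⟨q, hq⟩ : X - C 1 ∣ p := dvd_iff_isRoot.2 hroot
  have hpq : p = (1 - X) * -q := by rw [hq, C_1]; ring
  have := (hψ.isUnitIntervalPositive_incrementFunctional hbdd hh).nonneg (p := -q)
    (eval_nonneg_on_Icc_of_Ioo_diff_singleton 0 fun x hx _ => by
      have h1 := hK x hx
      rw [← hev, hpq, eval_mul] at h1
      refine nonneg_of_mul_nonneg_right h1 ?_
      simpa using hx.2)
  rw [incrementFunctional_apply, ← hpq, hL] at this
  linarith

end HalfLine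

theorem exp_neg_norm_sq_half_eq_integral_cos {E : Type*} [NormedAddCommGroup E]
    [InnerProductSpace ℝ E] [FiniteDimensional ℝ E] [MeasurableSpace E] [BorelSpace E] (t : E) :
    Real.exp (-‖t‖ ^ 2 / 2) = ∫ x, Real.cos (inner ℝ x t) ∂stdGaussian E := by
  have h := congrArg Complex.re (charFun_stdGaussian t)
  rw [charFun_apply] at h
  have hre : (Complex.exp (-‖t‖ ^ 2 / 2)).re = Real.exp (-‖t‖ ^ 2 / 2) := by
    rw [← Complex.exp_ofReal_re]; push_cast; rfl
  rw [hre] at h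
  rw [← h, ← RCLike.re_eq_complex_re, ← integral_re]
  · simp [Complex.exp_ofReal_mul_I_re]
  · refine Integrable.of_bound (C := 1) (by fun_prop) (ae_of_all _ fun x => ?_)
    rw [Complex.norm_exp_ofReal_mul_I]

theorem sum_exp_neg_norm_sub_sq_half_nonneg {E : Type*} [NormedAddCommGroup E]
    [InnerProductSpace ℝ E] [FiniteDimensional ℝ E] {n : ℕ} (x : Fin n → E) (a : Fin n → ℝ) :
    0 ≤ ∑ i, ∑ j, a i * a j * Real.exp (-‖x i - x j‖ ^ 2 / 2) := by
  borelize E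
  have hint : ∀ t : E, Integrable (fun y => Real.cos (inner ℝ y t)) (stdGaussian E) := fun t =>
    Integrable.of_bound (C := 1) (by fun_prop) (ae_of_all _ fun y => Real.abs_cos_le_one _)
  simp_rw [exp_neg_norm_sq_half_eq_integral_cos, ← integral_const_mul]
  simp_rw [← integral_finsetSum Finset.univ fun j _ => (hint _).const_mul _]
  rw [← integral_finsetSum]
  · refine integral_nonneg fun y => ?_
    have : ∑ i, ∑ j, a i * a j * Real.cos (inner ℝ y (x i - x j)) =
        (∑ i, a i * Real.cos (inner ℝ y (x i))) ^ 2 +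
          (∑ i, a i * Real.sin (inner ℝ y (x i))) ^ 2 := by
      rw [sq, sq, Finset.sum_mul_sum, Finset.sum_mul_sum, ← Finset.sum_add_distrib]
      refine Finset.sum_congr rfl fun i _ => ?_
      rw [← Finset.sum_add_distrib]
      refine Finset.sum_congr rfl fun j _ => ?_
      rw [inner_sub_right, Real.cos_sub]
      ring
    simp only [Pi.zero_apply]
    rw [this]
    positivity
  · exact fun i _ => integrable_finsetSum _ fun j _ => (hint _).const_mul _

theorem sum_pow_nonneg_of_eq_norm_sub_sq {E : Type*} [NormedAddCommGroup E]
    [InnerProductSpace ℝ E] [FiniteDimensional ℝ E] {n : ℕ} {z : Fin n → E}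
    {K : Fin n → Fin n → ℕ} (hK : ∀ i j, (K i j : ℝ) = ‖z i - z j‖ ^ 2) (a : Fin n → ℝ)
    {t : ℝ} (ht : t ∈ Ioo (0 : ℝ) 1) : 0 ≤ ∑ i, ∑ j, a i * a j * t ^ K i j := by
  have hlog : 0 ≤ -(2 * Real.log t) := by linarith [Real.log_neg ht.1 ht.2]
  convert sum_exp_neg_norm_sub_sq_half_nonneg (fun i => √(-(2 * Real.log t)) • z i) a using 6
    with i _ j _
  rw [← smul_sub, norm_smul, mul_pow, Real.norm_eq_abs, sq_abs, Real.sq_sqrt hlog, ← hK,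
    ← Real.rpow_natCast, Real.rpow_def_of_pos ht.1]
  congr 1; ring

theorem NegDefHalfLine.variogramND {ψ : ℝ → ℝ} (hψ : NegDefHalfLine ψ)
    (hbdd : ∃ m : ℝ, ∀ x : ℝ, 0 ≤ x → m ≤ ψ x) (d : ℕ) :
    VariogramND d (fun h : EuclideanSpace ℝ (Fin d) => ψ (‖h‖ ^ 2)) := by
  refine ⟨fun x => by simp, fun n x a ha => ?_⟩
  let K : ℝ → Fin n → Fin n → ℕ := fun R i j =>
    ∑ l, (⌊x i l * R⌋ - ⌊x j l * R⌋).natAbs ^ 2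
  have hKcast : ∀ R i j, (K R i j : ℝ) = ∑ l, ((⌊x i l * R⌋ : ℝ) - ⌊x j l * R⌋) ^ 2 := by
    intro R i j
    simp only [K, Nat.cast_sum, Nat.cast_pow, Nat.cast_natAbs]
    refine Finset.sum_congr rfl fun l _ => ?_
    push_cast
    rw [sq_abs]
  have hfloor : ∀ c : ℝ, Tendsto (fun R : ℝ => (⌊c * R⌋ : ℝ) / R) atTop (𝓝 c) := by
    intro c
    have hlow : Tendsto (fun R : ℝ => c - R⁻¹) atTop (𝓝 c) := by
      simpa using tendsto_const_nhds.sub (tendsto_inv_atTop_zero (𝕜 := ℝ))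
    refine tendsto_of_tendsto_of_tendsto_of_le_of_le' hlow tendsto_const_nhds ?_ ?_ <;>
      filter_upwards [eventually_gt_atTop 0] with R hR
    · rw [le_div_iff₀ hR, sub_mul, inv_mul_cancel₀ hR.ne']
      exact (Int.sub_one_lt_floor _).le
    · rw [div_le_iff₀ hR]
      exact Int.floor_le _
  have hKlim : ∀ i j, Tendsto (fun R : ℝ => K R i j * (1 / R) ^ 2) atTop
      (𝓝 (‖x i - x j‖ ^ 2)) := by
    intro i j
    rw [EuclideanSpace.real_norm_sq_eq]
    have : Tendsto (fun R : ℝ => ∑ l, ((⌊x i l * R⌋ : ℝ) / R - (⌊x j l * R⌋ : ℝ) / R) ^ 2) atTop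
        (𝓝 (∑ l, (x i l - x j l) ^ 2)) :=
      tendsto_finsetSum _ fun l _ => ((hfloor _).sub (hfloor _)).pow 2
    refine this.congr fun R => ?_
    rw [hKcast, Finset.sum_mul]
    exact Finset.sum_congr rfl fun l _ => by ring
  have hψlim : ∀ i j, Tendsto (fun R : ℝ => ψ (K R i j * (1 / R) ^ 2)) atTop
      (𝓝 (ψ (‖x i - x j‖ ^ 2))) := by
    intro i j
    by_cases hij : x i = x j
    · have h0 : ∀ R, K R i j = 0 := fun R => by simp [K, hij]
      simp [h0, hij]
    · have hpos : 0 < ‖x i - x j‖ := norm_pos_iff.2 (sub_ne_zero.2 hij)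
      exact (hψ.continuousAt hbdd (by positivity)).tendsto.comp (hKlim i j)
  refine le_of_tendsto (tendsto_finsetSum Finset.univ fun i _ =>
    tendsto_finsetSum Finset.univ fun j _ => (hψlim i j).const_mul (a i * a j))
    (Eventually.of_forall fun R => ?_)
  refine hψ.sum_nonpos_of_pow_kernel hbdd (by positivity) (K R) ha fun t ht => ?_
  refine sum_pow_nonneg_of_eq_norm_sub_sq
    (z := fun i => WithLp.toLp 2 fun l => (⌊x i l * R⌋ : ℝ)) (fun i j => ?_) a ht
  rw [hKcast, EuclideanSpace.real_norm_sq_eq]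
  simp

/-- With `N` orthogonal copies of each point `√(s i)`, carrying weight `a i`, all squared distances
are of the form `s i + s j` except on the diagonal. -/
theorem sum_add_diagonal_le_zero_of_variogramND {ψ : ℝ → ℝ}
    (hψ : ∀ d : ℕ, 1 ≤ d → VariogramND d (fun h : EuclideanSpace ℝ (Fin d) => ψ (‖h‖ ^ 2)))
    {n : ℕ} {s : Fin n → ℝ} (hs : ∀ i, 0 ≤ s i) {a : Fin n → ℝ} (ha : ∑ i, a i = 0)
    {N : ℕ} (hN : 0 < N) :
    N * ∑ i, ∑ j, a i * a j * ψ (s i + s j) + ∑ i, a i ^ 2 * (ψ 0 - ψ (s i + s i)) ≤ 0 := by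
  rcases Nat.eq_zero_or_pos n with rfl | hn
  · simp
  let e : Fin n × Fin N ≃ Fin (n * N) := finProdFinEquiv
  have hvar := (hψ (n * N) (Nat.mul_pos hn hN)).2 (n * N)
    (fun k => EuclideanSpace.single k √(s (e.symm k).1)) (fun k => a (e.symm k).1) (by
      rw [← e.sum_comp]
      simp [Fintype.sum_prod_type, ← Finset.mul_sum, ha])
  have hdist : ∀ k l : Fin (n * N), ψ (‖(EuclideanSpace.single k √(s (e.symm k).1) -
      EuclideanSpace.single l √(s (e.symm l).1) : EuclideanSpace ℝ (Fin (n * N)))‖ ^ 2) =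
      ψ (s (e.symm k).1 + s (e.symm l).1) +
        if k = l then ψ 0 - ψ (s (e.symm k).1 + s (e.symm k).1) else 0 := by
    intro k l
    by_cases hkl : k = l
    · subst hkl; simp
    · rw [if_neg hkl, add_zero, norm_sub_sq_real]
      simp [EuclideanSpace.inner_single_left, hkl, Real.sq_sqrt (hs _)]
  simp only [hdist] at hvar
  rw [← e.sum_comp] at hvar
  simp_rw [← e.sum_comp (fun l => _ * _ * _)] at hvar
  simp only [Equiv.symm_apply_apply, mul_add, Finset.sum_add_distrib, mul_ite, mul_zero,
    EmbeddingLike.apply_eq_iff_eq, Finset.sum_ite_eq, Finset.mem_univ, if_true] at hvar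
  simp only [Fintype.sum_prod_type, Finset.sum_const, Finset.card_univ, Fintype.card_fin,
    nsmul_eq_mul, ← Finset.mul_sum] at hvar
  have hNpos : (0 : ℝ) < N := by exact_mod_cast hN
  refine le_of_mul_le_mul_left (a := (N : ℝ)) ?_ hNpos
  simpa only [mul_add, mul_zero, sq] using hvar

theorem negDefHalfLine_of_variogramND {ψ : ℝ → ℝ}
    (hψ : ∀ d : ℕ, 1 ≤ d → VariogramND d (fun h : EuclideanSpace ℝ (Fin d) => ψ (‖h‖ ^ 2))) :
    NegDefHalfLine ψ := by
  intro n s hs a ha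
  by_contra! hpos
  obtain ⟨N, hN⟩ := exists_nat_gt (-(∑ i, a i ^ 2 * (ψ 0 - ψ (s i + s i))) /
    ∑ i, ∑ j, a i * a j * ψ (s i + s j))
  rw [div_lt_iff₀ hpos] at hN
  have := sum_add_diagonal_le_zero_of_variogramND hψ hs ha N.succ_pos
  push_cast at this
  linarith

theorem stmt_3 (ψ : ℝ → ℝ) (hbdd : ∃ m : ℝ, ∀ x : ℝ, 0 ≤ x → m ≤ ψ x) :
    NegDefHalfLine ψ ↔
      ∀ d : ℕ, 1 ≤ d →
        VariogramND d (fun h : EuclideanSpace ℝ (Fin d) => ψ (‖h‖ ^ 2)) :=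
  ⟨fun hψ d _ => hψ.variogramND hbdd d, negDefHalfLine_of_variogramND⟩
end

section
/- Let d ≥ 1, α ∈ (0,2), s > 0 and R > 0, and let B_R(0) = {x ∈ ℝ^d : ‖x‖ ≤ R} be the closed Euclidean ball. For a ∈ ℝ define C(x,y) = a − (1/2) ‖(x − y)/s‖^α for x, y ∈ B_R(0). Then C is a positive semidefinite kernel on B_R(0) if and only if a ≥ (A_{α,d}/2) (R/s)^α, where A_{α,d} = Γ((2−α)/2) Γ((d+α)/2) / Γ(d/2). -/
namespace RieszEnergy

open MeasureTheory Set Filter Topology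
open ProbabilityTheory (beta beta_pos beta_eq_betaIntegralReal)

/-- The interaction energy `∬ ‖x - y‖ ^ α f(x) f(y) dx dy` of a density `f`. -/
noncomputable def rieszEnergy {X : Type*} [NormedAddCommGroup X] [MeasureSpace X]
    (α : ℝ) (f : X → ℝ) : ℝ :=
  ∫ z : X × X, ‖z.1 - z.2‖ ^ α * (f z.1 * f z.2)

section Integrability

variable {X : Type*} [TopologicalSpace X] [MeasurableSpace X] [BorelSpace X]
  {μ : Measure X} {S : Set X} {f g : X → ℝ}

theorem integrable_continuous_mul_of_support_subset (hS : IsCompact S) {k : X → ℝ}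
    (hk : Continuous k) (hf : Integrable f μ) (hfS : ∀ x ∉ S, f x = 0) :
    Integrable (fun x => k x * f x) μ := by
  obtain ⟨C, hC⟩ := hS.exists_bound_of_continuousOn hk.continuousOn
  refine (hf.norm.const_mul C).mono' (hk.aestronglyMeasurable.mul hf.1) (ae_of_all _ fun x => ?_)
  by_cases hx : x ∈ S
  · rw [norm_mul]
    exact mul_le_mul_of_nonneg_right (hC x hx) (norm_nonneg _)
  · simp [hfS x hx]

theorem integrable_continuous_mul_prod_of_support_subset [SecondCountableTopology X] [SFinite μ]
    (hS : IsCompact S)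
    {K : X × X → ℝ} (hK : Continuous K) (hf : Integrable f μ) (hfS : ∀ x ∉ S, f x = 0)
    (hg : Integrable g μ) (hgS : ∀ x ∉ S, g x = 0) :
    Integrable (fun z : X × X => K z * (f z.1 * g z.2)) (μ.prod μ) := by
  refine integrable_continuous_mul_of_support_subset (hS.prod hS) hK (hf.mul_prod hg) ?_
  rintro ⟨x, y⟩ hxy
  rcases not_and_or.1 (fun h : x ∈ S ∧ y ∈ S => hxy h) with h | h
  · simp [hfS x h]
  · simp [hgS y h]

end Integrability

theorem integral_prod_nonneg_of_posSemidef {X : Type*} [PseudoMetricSpace X] [MeasurableSpace X]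
    [BorelSpace X] [SecondCountableTopology X] {μ : Measure X} [SFinite μ] {S : Set X}
    (hS : IsCompact S) {f : X → ℝ} (hf : Integrable f μ) (hfS : ∀ x ∉ S, f x = 0)
    {K : X × X → ℝ} (hK : Continuous K)
    (hpos : ∀ (n : ℕ) (x : Fin n → X), (∀ i, x i ∈ S) → ∀ c : Fin n → ℝ,
      0 ≤ ∑ i, ∑ j, c i * c j * K (x i, x j)) :
    0 ≤ ∫ z : X × X, K z * (f z.1 * f z.2) ∂(μ.prod μ) := by
  rcases S.eq_empty_or_nonempty with rfl | ⟨y₀, hy₀⟩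
  · simp [hfS]
  obtain ⟨C, hC⟩ := (hS.prod hS).exists_bound_of_continuousOn hK.continuousOn
  set p : ℕ → SimpleFunc X X := SimpleFunc.approxOn id measurable_id S y₀ hy₀ with hp
  have hpS : ∀ n x, p n x ∈ S := fun n x => SimpleFunc.approxOn_mem measurable_id hy₀ n x
  have hlim : ∀ x ∈ S, Tendsto (fun n => p n x) atTop (𝓝 x) := fun x hx =>
    SimpleFunc.tendsto_approxOn measurable_id hy₀ (subset_closure hx)
  have hT : Tendsto (fun n => ∫ z : X × X, K (p n z.1, p n z.2) * (f z.1 * f z.2) ∂(μ.prod μ))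
      atTop (𝓝 (∫ z : X × X, K z * (f z.1 * f z.2) ∂(μ.prod μ))) := by
    refine tendsto_integral_of_dominated_convergence
      (fun z => C * ‖f z.1 * f z.2‖) (fun n => ?_) ((hf.mul_prod hf).norm.const_mul C)
      (fun n => ae_of_all _ fun z => ?_) (ae_of_all _ fun z => ?_)
    · refine AEStronglyMeasurable.mul ?_ (hf.mul_prod hf).1
      exact (hK.measurable.comp (((p n).measurable.comp measurable_fst).prodMk
        ((p n).measurable.comp measurable_snd))).aestronglyMeasurable
    · rw [norm_mul]
      exact mul_le_mul_of_nonneg_right (hC _ ⟨hpS n _, hpS n _⟩) (norm_nonneg _)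
    · by_cases h1 : z.1 ∈ S
      · by_cases h2 : z.2 ∈ S
        · refine Tendsto.mul_const _ ?_
          exact (hK.tendsto z).comp ((hlim _ h1).prodMk_nhds (hlim _ h2))
        · simp [hfS _ h2]
      · simp [hfS _ h1]
  refine ge_of_tendsto' hT fun n => ?_
  set w : X → ℝ := fun q => ∫ x in p n ⁻¹' {q}, f x ∂μ with hw
  have hms : ∀ q, MeasurableSet (p n ⁻¹' {q}) := fun q => (p n).measurableSet_fiber q
  have key : ∫ z : X × X, K (p n z.1, p n z.2) * (f z.1 * f z.2) ∂(μ.prod μ)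
      = ∑ q ∈ (p n).range, ∑ r ∈ (p n).range, w q * w r * K (q, r) := by
    have hpt : ∀ z : X × X, K (p n z.1, p n z.2) * (f z.1 * f z.2)
        = ∑ q ∈ (p n).range, ∑ r ∈ (p n).range,
          K (q, r) * ((p n ⁻¹' {q}).indicator f z.1 * (p n ⁻¹' {r}).indicator f z.2) := by
      intro z
      rw [Finset.sum_eq_single (p n z.1), Finset.sum_eq_single (p n z.2)]
      · simp
      · intro r _ hr
        rw [indicator_of_notMem (s := p n ⁻¹' {r}) (by simpa using hr.symm)]
        simp
      · intro h
        exact absurd (SimpleFunc.mem_range_self _ _) h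
      · intro q _ hq
        refine Finset.sum_eq_zero fun r _ => ?_
        rw [indicator_of_notMem (s := p n ⁻¹' {q}) (by simpa using hq.symm)]
        simp
      · intro h
        exact absurd (SimpleFunc.mem_range_self _ _) h
    simp_rw [hpt]
    have hi : ∀ q r, Integrable (fun z : X × X =>
        K (q, r) * ((p n ⁻¹' {q}).indicator f z.1 * (p n ⁻¹' {r}).indicator f z.2))
        (μ.prod μ) := fun q r =>
      ((hf.indicator (hms q)).mul_prod (hf.indicator (hms r))).const_mul _
    rw [integral_finsetSum _ fun q _ => integrable_finsetSum _ fun r _ => hi q r]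
    refine Finset.sum_congr rfl fun q _ => ?_
    rw [integral_finsetSum _ fun r _ => hi q r]
    refine Finset.sum_congr rfl fun r _ => ?_
    rw [integral_const_mul, integral_prod_mul, integral_indicator (hms q),
      integral_indicator (hms r)]
    ring
  rw [key]
  set e := (p n).range.equivFin.symm
  have h := hpos _ (fun i => (e i : X)) (fun i => by
    obtain ⟨x, hx⟩ := SimpleFunc.mem_range.1 (e i).2
    exact hx ▸ hpS n x) (fun i => w (e i))
  rw [← Finset.sum_coe_sort (p n).range]
  simp_rw [← Finset.sum_coe_sort (p n).range (fun r => w _ * w r * K (_, r))]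
  rw [← e.sum_comp]
  simp_rw [← e.sum_comp (fun r => w _ * w r * K (_, _))]
  exact h

section ConditionallyNegative

variable {α : ℝ}

theorem integrableOn_one_sub_cos_mul_rpow (hα : 0 < α) (hα2 : α < 2) :
    IntegrableOn (fun k : ℝ => (1 - Real.cos k) * k ^ (-1 - α)) (Ioi 0) := by
  have hm : ∀ s : Set ℝ, AEStronglyMeasurable (fun k : ℝ => (1 - Real.cos k) * k ^ (-1 - α))
      (volume.restrict s) := fun s => by
    exact (by fun_prop : Measurable fun k : ℝ => (1 - Real.cos k) * k ^ (-1 - α)).aestronglyMeasurable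
  rw [← Ioc_union_Ioi_eq_Ioi zero_le_one]
  refine IntegrableOn.union ?_ ?_
  · have h : IntegrableOn (fun k : ℝ => k ^ (1 - α)) (Ioc 0 1) :=
      (intervalIntegrable_iff_integrableOn_Ioc_of_le zero_le_one).1
        (intervalIntegral.intervalIntegrable_rpow' (by linarith))
    refine Integrable.mono' h (hm _) ((ae_restrict_iff' measurableSet_Ioc).2 (ae_of_all _ ?_))
    intro k hk
    have hc := Real.one_sub_sq_div_two_le_cos (x := k)
    have hc' := Real.cos_le_one k
    have hp : 0 ≤ k ^ (-1 - α) := Real.rpow_nonneg hk.1.le _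
    rw [Real.norm_of_nonneg (mul_nonneg (by linarith) hp),
      show (1 - α) = 2 + (-1 - α) by ring, Real.rpow_add hk.1, Real.rpow_two]
    exact mul_le_mul_of_nonneg_right (by nlinarith) hp
  · have h : IntegrableOn (fun k : ℝ => 2 * k ^ (-1 - α)) (Ioi 1) :=
      (integrableOn_Ioi_rpow_of_lt (by linarith) one_pos).const_mul 2
    refine Integrable.mono' h (hm _) ((ae_restrict_iff' measurableSet_Ioi).2 (ae_of_all _ ?_))
    intro k hk
    have hk0 : (0 : ℝ) < k := one_pos.trans hk
    have hc := Real.neg_one_le_cos k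
    have hc' := Real.cos_le_one k
    have hp : 0 ≤ k ^ (-1 - α) := Real.rpow_nonneg hk0.le _
    rw [Real.norm_of_nonneg (mul_nonneg (by linarith) hp)]
    exact mul_le_mul_of_nonneg_right (by linarith) hp

theorem integral_one_sub_cos_mul_rpow_pos (hα : 0 < α) (hα2 : α < 2) :
    0 < ∫ k in Ioi (0 : ℝ), (1 - Real.cos k) * k ^ (-1 - α) := by
  have hnn : ∀ k ∈ Ioi (0 : ℝ), 0 ≤ (1 - Real.cos k) * k ^ (-1 - α) := fun k hk =>
    mul_nonneg (by linarith [Real.cos_le_one k]) (Real.rpow_nonneg (le_of_lt hk) _)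
  rw [setIntegral_pos_iff_support_of_nonneg_ae
    ((ae_restrict_iff' measurableSet_Ioi).2 (ae_of_all _ hnn))
    (integrableOn_one_sub_cos_mul_rpow hα hα2)]
  have hsub : Ioo (0 : ℝ) 1 ⊆
      Function.support (fun k : ℝ => (1 - Real.cos k) * k ^ (-1 - α)) ∩ Ioi 0 := by
    intro k hk
    refine ⟨mul_ne_zero ?_ (Real.rpow_pos_of_pos hk.1 _).ne', hk.1⟩
    have := Real.cos_lt_cos_of_nonneg_of_le_pi le_rfl
      (show k ≤ Real.pi by linarith [Real.pi_gt_three, hk.2]) hk.1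
    rw [Real.cos_zero] at this
    linarith
  exact lt_of_lt_of_le (by simp) (measure_mono hsub)

theorem integrableOn_one_sub_cos_mul_mul_rpow (hα : 0 < α) (hα2 : α < 2) (h : ℝ) :
    IntegrableOn (fun k : ℝ => (1 - Real.cos (h * k)) * k ^ (-1 - α)) (Ioi 0) ∧
    ∫ k in Ioi (0 : ℝ), (1 - Real.cos (h * k)) * k ^ (-1 - α)
      = |h| ^ α * ∫ k in Ioi (0 : ℝ), (1 - Real.cos k) * k ^ (-1 - α) := by
  rcases eq_or_ne h 0 with rfl | hh
  · simp [Real.zero_rpow hα.ne']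
  have hb : 0 < |h| := abs_pos.2 hh
  have hcong : ∀ k ∈ Ioi (0 : ℝ), (1 - Real.cos (h * k)) * k ^ (-1 - α)
      = |h| ^ (1 + α) * ((1 - Real.cos (|h| * k)) * (|h| * k) ^ (-1 - α)) := by
    intro k hk
    have hk : 0 < k := hk
    have h1 : Real.cos (h * k) = Real.cos (|h| * k) := by
      rw [← Real.cos_abs (h * k), abs_mul, abs_of_pos hk]
    rw [Real.mul_rpow hb.le hk.le, h1]
    have : |h| ^ (1 + α) * |h| ^ (-1 - α) = 1 := by
      rw [← Real.rpow_add hb]; simp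
    linear_combination (-(1 - Real.cos (|h| * k)) * k ^ (-1 - α)) * this
  constructor
  · refine IntegrableOn.congr_fun ?_ (fun k hk => (hcong k hk).symm) measurableSet_Ioi
    refine Integrable.const_mul ?_ _
    have := (integrableOn_Ioi_comp_mul_left_iff
      (fun k : ℝ => (1 - Real.cos k) * k ^ (-1 - α)) 0 hb).2
      (by simpa using integrableOn_one_sub_cos_mul_rpow hα hα2)
    exact this
  · rw [setIntegral_congr_fun measurableSet_Ioi hcong, integral_const_mul,
      integral_comp_mul_left_Ioi (fun k : ℝ => (1 - Real.cos k) * k ^ (-1 - α)) 0 hb]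
    rw [mul_zero, smul_eq_mul, ← mul_assoc, Real.rpow_add hb, Real.rpow_one]
    field_simp

theorem sum_mul_rpow_abs_sub_nonpos (hα : 0 < α) (hα2 : α < 2) {ι : Type*} [Fintype ι]
    (x c : ι → ℝ) (hc : ∑ i, c i = 0) :
    ∑ i, ∑ j, c i * c j * |x i - x j| ^ α ≤ 0 := by
  set κ := ∫ k in Ioi (0 : ℝ), (1 - Real.cos k) * k ^ (-1 - α)
  have hκ : 0 < κ := integral_one_sub_cos_mul_rpow_pos hα hα2
  refine le_of_mul_le_mul_right ?_ hκ
  have hI : (∑ i, ∑ j, c i * c j * |x i - x j| ^ α) * κ = ∫ k in Ioi (0 : ℝ),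
      ∑ i, ∑ j, c i * c j * ((1 - Real.cos ((x i - x j) * k)) * k ^ (-1 - α)) := by
    have hint : ∀ i j, IntegrableOn
        (fun k : ℝ => c i * c j * ((1 - Real.cos ((x i - x j) * k)) * k ^ (-1 - α))) (Ioi 0) :=
      fun i j => ((integrableOn_one_sub_cos_mul_mul_rpow hα hα2 (x i - x j)).1).const_mul _
    rw [integral_finsetSum _ fun i _ => integrable_finsetSum _ fun j _ => hint i j,
      Finset.sum_mul]
    refine Finset.sum_congr rfl fun i _ => ?_
    rw [integral_finsetSum _ fun j _ => hint i j, Finset.sum_mul]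
    refine Finset.sum_congr rfl fun j _ => ?_
    rw [integral_const_mul, (integrableOn_one_sub_cos_mul_mul_rpow hα hα2 (x i - x j)).2]
    ring
  rw [hI, zero_mul]
  refine setIntegral_nonpos measurableSet_Ioi fun k hk => ?_
  have hk0 : 0 ≤ k ^ (-1 - α) := Real.rpow_nonneg (le_of_lt hk) _
  have hexp : ∑ i, ∑ j, c i * c j * ((1 - Real.cos ((x i - x j) * k)) * k ^ (-1 - α))
      = ((∑ i, c i) ^ 2 - (∑ i, c i * Real.cos (x i * k)) ^ 2
        - (∑ i, c i * Real.sin (x i * k)) ^ 2) * k ^ (-1 - α) := by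
    simp_rw [sq, Finset.sum_mul_sum, ← Finset.sum_sub_distrib, Finset.sum_mul]
    refine Finset.sum_congr rfl fun i _ => Finset.sum_congr rfl fun j _ => ?_
    rw [sub_mul (x i), Real.cos_sub]
    ring
  rw [hexp, hc]
  refine mul_nonpos_of_nonpos_of_nonneg ?_ hk0
  nlinarith [sq_nonneg (∑ i, c i * Real.cos (x i * k)), sq_nonneg (∑ i, c i * Real.sin (x i * k))]

end ConditionallyNegative

section Beta

theorem integral_Ioo_rpow_mul_one_sub_rpow {p q : ℝ} (hp : 0 < p) (hq : 0 < q) :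
    ∫ x in Ioo (0 : ℝ) 1, x ^ (p - 1) * (1 - x) ^ (q - 1) = beta p q := by
  rw [beta_eq_betaIntegralReal p q hp hq, Complex.betaIntegral,
    intervalIntegral.integral_of_le zero_le_one, ← integral_Ioc_eq_integral_Ioo,
    ← RCLike.re_to_complex, ← integral_re]
  · refine setIntegral_congr_fun measurableSet_Ioc fun x ⟨hx1, hx₂⟩ => ?_
    norm_cast
    rw [← Complex.ofReal_cpow hx1.le, ← Complex.ofReal_cpow (by linarith), RCLike.re_to_complex,
      Complex.re_mul_ofReal, Complex.ofReal_re]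
  · have := Complex.betaIntegral_convergent (u := p) (v := q) (by simpa) (by simpa)
    rwa [intervalIntegrable_iff_integrableOn_Ioc_of_le zero_le_one] at this

theorem integrableOn_Ioo_rpow_mul_one_sub_rpow {p q : ℝ} (hp : 0 < p) (hq : 0 < q) :
    IntegrableOn (fun x : ℝ => x ^ (p - 1) * (1 - x) ^ (q - 1)) (Ioo 0 1) := by
  refine Integrable.of_integral_ne_zero ?_
  rw [integral_Ioo_rpow_mul_one_sub_rpow hp hq]
  exact (beta_pos hp hq).ne'

theorem beta_add_one_left {p q : ℝ} (hp : 0 < p) (hq : 0 < q) :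
    beta (p + 1) q = p / (p + q) * beta p q := by
  have := (Real.Gamma_pos_of_pos (add_pos hp hq)).ne'
  have := (add_pos hp hq).ne'
  rw [beta, beta, Real.Gamma_add_one hp.ne', add_right_comm, Real.Gamma_add_one this]
  field_simp

theorem integral_comp_sq (f : ℝ → ℝ) :
    ∫ x, f (x ^ 2) = ∫ v in Ioi (0 : ℝ), v ^ (-(1 / 2) : ℝ) * f v := by
  have h := integral_comp_abs (f := fun x : ℝ => f (x ^ 2))
  simp only [sq_abs] at h
  rw [h, ← integral_comp_rpow_Ioi_of_pos (g := fun x : ℝ => f (x ^ 2)) (p := 1 / 2) (by norm_num),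
    ← integral_const_mul]
  refine setIntegral_congr_fun measurableSet_Ioi fun v hv => ?_
  have hv : 0 < v := hv
  have : (v ^ (1 / 2 : ℝ)) ^ 2 = v := by
    rw [← Real.rpow_natCast, ← Real.rpow_mul hv.le]; norm_num
  simp only [smul_eq_mul, this]
  norm_num
  ring

end Beta

/-- The profile `(s - u ^ 2)₊ ^ β`, vanishing for `s ≤ u ^ 2` whatever the sign of `β`. -/
noncomputable def bump (β s u : ℝ) : ℝ := if u ^ 2 < s then (s - u ^ 2) ^ β else 0

section Bump

variable {α β b s t u : ℝ}

theorem bump_nonneg : 0 ≤ bump β s u := by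
  unfold bump
  split_ifs with h
  · exact Real.rpow_nonneg (by linarith) _
  · exact le_rfl

theorem bump_of_lt (h : u ^ 2 < s) : bump β s u = (s - u ^ 2) ^ β := if_pos h

theorem bump_of_le (h : s ≤ u ^ 2) : bump β s u = 0 := if_neg h.not_gt

theorem bump_of_notMem_Icc (hs : s ≤ t ^ 2) (ht : 0 ≤ t) (hu : u ∉ Icc (-t) t) :
    bump β s u = 0 :=
  bump_of_le (hs.trans (by
    by_contra! h
    exact hu (abs_le.1 (abs_le_of_sq_le_sq h.le ht))))

@[fun_prop]
theorem measurable_bump : Measurable (bump β s) := by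
  unfold bump
  exact Measurable.ite (measurableSet_lt (by fun_prop) (by fun_prop)) (by fun_prop) (by fun_prop)

theorem bump_sqrt_mul (hs : 0 < s) (u : ℝ) : bump β s (√s * u) = s ^ β * bump β 1 u := by
  have h : (√s * u) ^ 2 = s * u ^ 2 := by rw [mul_pow, Real.sq_sqrt hs.le]
  rcases lt_or_ge (u ^ 2) 1 with hu | hu
  · rw [bump_of_lt hu, bump_of_lt (by rw [h]; nlinarith), h, ← Real.mul_rpow hs.le (by linarith)]
    ring_nf
  · rw [bump_of_le hu, bump_of_le (by rw [h]; nlinarith), mul_zero]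

theorem integral_mul_bump (hs : 0 < s) (F : ℝ → ℝ) :
    ∫ u, F u * bump β s u = s ^ (β + 1 / 2) * ∫ u, F (√s * u) * bump β 1 u := by
  have h := Measure.integral_comp_mul_left (fun u => F u * bump β s u) (√s)
  have h0 : 0 < √s := Real.sqrt_pos.2 hs
  rw [abs_of_pos (inv_pos.2 h0), smul_eq_mul, eq_inv_mul_iff_mul_eq₀ h0.ne'] at h
  rw [← h, Real.rpow_add hs, ← Real.sqrt_eq_rpow]
  simp_rw [bump_sqrt_mul hs]
  rw [mul_comm (s ^ β), mul_assoc, ← integral_const_mul (s ^ β)]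
  congr 2
  ext u
  ring

theorem integral_rpow_abs_mul_bump_one {c : ℝ} (hc : -1 < c) (hβ : -1 < β) :
    ∫ u, |u| ^ c * bump β 1 u = beta ((c + 1) / 2) (β + 1) := by
  have h1 : ∀ u : ℝ, |u| ^ c * bump β 1 u
      = (fun v : ℝ => v ^ (c / 2) * (if v < 1 then (1 - v) ^ β else 0)) (u ^ 2) := by
    intro u
    simp only [bump]
    rw [← sq_abs u, ← Real.rpow_natCast, ← Real.rpow_mul (abs_nonneg u)]
    congr 2
    push_cast
    ring
  refine (integral_congr_ae (ae_of_all _ h1)).trans ((integral_comp_sq fun v : ℝ =>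
    v ^ (c / 2) * (if v < 1 then (1 - v) ^ β else 0)).trans ?_)
  rw [← integral_Ioo_rpow_mul_one_sub_rpow (by linarith) (by linarith),
    ← integral_indicator measurableSet_Ioo, ← integral_indicator measurableSet_Ioi]
  congr 1
  ext v
  by_cases hv : 0 < v
  · by_cases hv1 : v < 1
    · rw [indicator_of_mem (show v ∈ Ioi 0 from hv), indicator_of_mem (show v ∈ Ioo 0 1 from ⟨hv, hv1⟩),
        if_pos hv1, ← mul_assoc, ← Real.rpow_add hv]
      ring_nf
    · rw [indicator_of_mem (show v ∈ Ioi 0 from hv), if_neg hv1,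
        indicator_of_notMem fun h => hv1 h.2]
      simp
  · rw [indicator_of_notMem (show v ∉ Ioi (0 : ℝ) from hv),
      indicator_of_notMem (show v ∉ Ioo (0 : ℝ) 1 from fun h => hv h.1)]

theorem integral_rpow_abs_mul_bump {c : ℝ} (hc : -1 < c) (hβ : -1 < β) (hs : 0 < s) :
    ∫ u, |u| ^ c * bump β s u = s ^ (β + (c + 1) / 2) * beta ((c + 1) / 2) (β + 1) := by
  have h : ∀ u, |√s * u| ^ c * bump β 1 u = s ^ (c / 2) * (|u| ^ c * bump β 1 u) := by
    intro u
    rw [abs_mul, Real.mul_rpow (abs_nonneg _) (abs_nonneg _), abs_of_nonneg (Real.sqrt_nonneg s),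
      Real.sqrt_eq_rpow, ← Real.rpow_mul hs.le]
    ring_nf
  rw [integral_mul_bump hs]
  simp_rw [h]
  rw [integral_const_mul, integral_rpow_abs_mul_bump_one hc hβ, ← mul_assoc, ← Real.rpow_add hs]
  ring_nf

theorem integral_bump (hβ : -1 < β) (hs : 0 < s) :
    ∫ u, bump β s u = s ^ (β + 1 / 2) * beta (1 / 2) (β + 1) := by
  simpa using integral_rpow_abs_mul_bump (c := 0) (by norm_num) hβ hs

theorem integrable_bump (hβ : -1 < β) (s : ℝ) : Integrable (bump β s) := by
  rcases le_or_gt s 0 with hs | hs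
  · have : bump β s = 0 := funext fun u => bump_of_le (hs.trans (sq_nonneg u))
    rw [this]
    exact integrable_zero _ _ _
  · refine Integrable.of_integral_ne_zero ?_
    rw [integral_bump hβ hs]
    exact (mul_pos (Real.rpow_pos_of_pos hs _) (beta_pos (by norm_num) (by linarith))).ne'

theorem integral_sq_mul_bump (hβ : -1 < β) (hs : 0 < s) :
    ∫ u, u ^ 2 * bump β s u
      = s ^ (β + 3 / 2) * (beta (1 / 2) (β + 1) / (2 * β + 3)) := by
  have h := integral_rpow_abs_mul_bump (c := 2) (by norm_num) hβ hs
  simp only [Real.rpow_two, sq_abs] at h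
  rw [h, show ((2 : ℝ) + 1) / 2 = 1 / 2 + 1 by norm_num,
    beta_add_one_left (by norm_num) (by linarith), show (1 / 2 : ℝ) + 1 = 3 / 2 by norm_num]
  have : 2 * β + 3 ≠ 0 := by linarith
  have : (1 / 2 + (β + 1)) ≠ 0 := by linarith
  field_simp
  ring

end Bump

section Potential

variable {α x : ℝ}

theorem integrable_rpow_abs_sub_mul_bump {β : ℝ} (hα : 0 < α) (hβ : -1 < β) (x s : ℝ) :
    Integrable (fun y => |x - y| ^ α * bump β s y) := by
  refine integrable_continuous_mul_of_support_subset (isCompact_Icc (a := -√s) (b := √s)) ?_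
    (integrable_bump hβ s) fun y hy => ?_
  · exact (by fun_prop : Continuous fun y : ℝ => |x - y|).rpow_const fun _ => Or.inr hα.le
  · rcases le_or_gt s 0 with hs | hs
    · exact bump_of_le (hs.trans (sq_nonneg y))
    · exact bump_of_notMem_Icc (Real.sq_sqrt hs.le).ge (Real.sqrt_nonneg s) hy

theorem one_add_mul_pos_of_abs_lt_one {u : ℝ} (hx : |x| < 1) (hu : |u| < 1) : 0 < 1 + x * u := by
  have h : |x * u| < 1 := by
    rw [abs_mul]
    nlinarith [abs_nonneg x, abs_nonneg u]
  linarith [(abs_lt.1 h).1]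

theorem image_moebius_Ioo (hx : |x| < 1) :
    (fun u : ℝ => (x + u) / (1 + x * u)) '' Ioo (-1) 1 = Ioo (-1) 1 := by
  have hx' := abs_lt.1 hx
  refine Subset.antisymm ?_ fun y hy => ?_
  · rintro _ ⟨u, hu, rfl⟩
    have h := one_add_mul_pos_of_abs_lt_one hx (abs_lt.2 hu)
    constructor
    · rw [lt_div_iff₀ h]
      nlinarith [mul_pos (show 0 < 1 + x by linarith) (show 0 < 1 + u by linarith [hu.1])]
    · rw [div_lt_iff₀ h]
      nlinarith [mul_pos (show 0 < 1 - x by linarith) (show 0 < 1 - u by linarith [hu.2])]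
  · have h : 0 < 1 + (-x) * y := one_add_mul_pos_of_abs_lt_one (by simpa) (abs_lt.2 hy)
    have h0 : 1 - x * y ≠ 0 := by linarith
    have h1 : 1 - x ^ 2 ≠ 0 := by nlinarith
    refine ⟨(y - x) / (1 - x * y), ⟨?_, ?_⟩, ?_⟩
    · rw [lt_div_iff₀ (by linarith)]
      nlinarith [mul_pos (show 0 < 1 - x by linarith) (show 0 < 1 + y by linarith [hy.1])]
    · rw [div_lt_iff₀ (by linarith)]
      nlinarith [mul_pos (show 0 < 1 + x by linarith) (show 0 < 1 - y by linarith [hy.2])]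
    · have e1 : x + (y - x) / (1 - x * y) = y * (1 - x ^ 2) / (1 - x * y) := by
        field_simp; ring
      have e2 : 1 + x * ((y - x) / (1 - x * y)) = (1 - x ^ 2) / (1 - x * y) := by
        field_simp; ring
      simp only [e1, e2]
      rw [div_div_div_cancel_right₀ h0, mul_div_cancel_right₀ _ h1]

theorem hasDerivAt_moebius {u : ℝ} (h : 1 + x * u ≠ 0) :
    HasDerivAt (fun u : ℝ => (x + u) / (1 + x * u)) ((1 - x ^ 2) / (1 + x * u) ^ 2) u := by
  have h1 : HasDerivAt (fun u : ℝ => x + u) 1 u := (hasDerivAt_id u).const_add x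
  have h2 : HasDerivAt (fun u : ℝ => 1 + x * u) (x * 1) u :=
    ((hasDerivAt_id u).const_mul x).const_add 1
  refine (h1.div h2 h).congr_deriv ?_
  field_simp
  ring

theorem injOn_moebius (hx : |x| < 1) :
    InjOn (fun u : ℝ => (x + u) / (1 + x * u)) (Ioo (-1) 1) := by
  intro u hu v hv huv
  have hu' := (one_add_mul_pos_of_abs_lt_one hx (abs_lt.2 hu)).ne'
  have hv' := (one_add_mul_pos_of_abs_lt_one hx (abs_lt.2 hv)).ne'
  simp only at huv
  rw [div_eq_div_iff hu' hv'] at huv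
  have h1 : 1 - x ^ 2 ≠ 0 := by nlinarith [abs_lt.1 hx]
  have : (1 - x ^ 2) * (u - v) = 0 := by linear_combination huv
  rcases mul_eq_zero.1 this with h | h
  · exact absurd h h1
  · linarith

/-- The pullback of the potential integrand along `u ↦ (x + u) / (1 + x u)`. -/
theorem abs_deriv_mul_comp_moebius (hx : |x| < 1) {u : ℝ} (hu : |u| < 1) :
    |(1 - x ^ 2) / (1 + x * u) ^ 2| * (|x - (x + u) / (1 + x * u)| ^ α *
        (1 - ((x + u) / (1 + x * u)) ^ 2) ^ ((1 - α) / 2))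
      = (1 - x ^ 2) ^ ((3 + α) / 2) * (|u| ^ α * (1 - u ^ 2) ^ ((1 - α) / 2))
        / (1 + x * u) ^ 3 := by
  have hD : 0 < 1 + x * u := one_add_mul_pos_of_abs_lt_one hx hu
  have hx1 : 0 < 1 - x ^ 2 := by nlinarith [abs_lt.1 hx]
  have hu1 : 0 < 1 - u ^ 2 := by nlinarith [abs_lt.1 hu]
  have e1 : x - (x + u) / (1 + x * u) = -(u * (1 - x ^ 2) / (1 + x * u)) := by
    field_simp; ring
  have e2 : 1 - ((x + u) / (1 + x * u)) ^ 2
      = (1 - x ^ 2) * (1 - u ^ 2) / (1 + x * u) ^ 2 := by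
    field_simp; ring
  rw [abs_of_pos (by positivity), e1, abs_neg, e2, abs_div, abs_mul, abs_of_pos hx1, abs_of_pos hD,
    Real.div_rpow (by positivity) hD.le, Real.mul_rpow (abs_nonneg u) hx1.le,
    Real.div_rpow (by positivity) (by positivity), Real.mul_rpow hx1.le hu1.le]
  have e3 : (1 - x ^ 2) ^ ((3 + α) / 2)
      = (1 - x ^ 2) * (1 - x ^ 2) ^ α * (1 - x ^ 2) ^ ((1 - α) / 2) := by
    nth_rewrite 2 [← Real.rpow_one (1 - x ^ 2)]
    rw [← Real.rpow_add hx1, ← Real.rpow_add hx1]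
    ring_nf
  have e4 : (1 + x * u) ^ α * ((1 + x * u) ^ 2) ^ ((1 - α) / 2) = 1 + x * u := by
    rw [← Real.rpow_natCast, ← Real.rpow_mul hD.le, ← Real.rpow_add hD]
    ring_nf
    simp
  rw [e3]
  have h4 : (1 + x * u) ^ α ≠ 0 := (Real.rpow_pos_of_pos hD _).ne'
  have h5 : ((1 + x * u) ^ 2) ^ ((1 - α) / 2) ≠ 0 := (Real.rpow_pos_of_pos (by positivity) _).ne'
  have h6 : (1 + x * u) ^ 3 = (1 + x * u) ^ 2 * ((1 + x * u) ^ α * ((1 + x * u) ^ 2) ^ ((1 - α) / 2)) := by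
    rw [e4]; ring
  rw [h6]
  field_simp

/-- The substitution `v = w / (1 - z + z w)` of the unit interval. -/
theorem setIntegral_Ioo_comp_div {z : ℝ} (hz0 : 0 ≤ z) (hz : z < 1) (g : ℝ → ℝ) :
    ∫ v in Ioo (0 : ℝ) 1, g v
      = ∫ w in Ioo (0 : ℝ) 1, (1 - z) / (1 - z + z * w) ^ 2 * g (w / (1 - z + z * w)) := by
  have hz' : 0 < 1 - z := by linarith
  have hD : ∀ w ∈ Ioo (0 : ℝ) 1, 0 < 1 - z + z * w := fun w hw => by
    nlinarith [mul_nonneg hz0 hw.1.le]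
  have himg : (fun w : ℝ => w / (1 - z + z * w)) '' Ioo 0 1 = Ioo 0 1 := by
    refine Subset.antisymm ?_ fun v hv => ?_
    · rintro _ ⟨w, hw, rfl⟩
      have h := hD w hw
      refine ⟨div_pos hw.1 h, ?_⟩
      rw [div_lt_one h]
      nlinarith [hw.2]
    · have h : 0 < 1 - z * v := by nlinarith [hv.1, hv.2]
      refine ⟨(1 - z) * v / (1 - z * v), ⟨div_pos (mul_pos hz' hv.1) h, ?_⟩, ?_⟩
      · rw [div_lt_one h]
        nlinarith [hv.2]
      · have e : 1 - z + z * ((1 - z) * v / (1 - z * v)) = (1 - z) / (1 - z * v) := by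
          field_simp; ring
        simp only [e]
        field_simp
  have hder : ∀ w ∈ Ioo (0 : ℝ) 1, HasDerivWithinAt (fun w : ℝ => w / (1 - z + z * w))
      ((1 - z) / (1 - z + z * w) ^ 2) (Ioo 0 1) w := fun w hw => by
    have h2 : HasDerivAt (fun w : ℝ => 1 - z + z * w) (z * 1) w :=
      ((hasDerivAt_id w).const_mul z).const_add (1 - z)
    refine HasDerivAt.hasDerivWithinAt ?_
    refine ((hasDerivAt_id w).div h2 (hD w hw).ne').congr_deriv ?_
    simp only [id]
    ring
  have hinj : InjOn (fun w : ℝ => w / (1 - z + z * w)) (Ioo 0 1) := fun w hw w' hw' h => by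
    simp only at h
    rw [div_eq_div_iff (hD w hw).ne' (hD w' hw').ne'] at h
    have : (1 - z) * (w - w') = 0 := by linear_combination h
    rcases mul_eq_zero.1 this with h | h <;> linarith
  have h := integral_image_eq_integral_abs_deriv_smul measurableSet_Ioo hder hinj g
  rw [himg] at h
  rw [h]
  refine setIntegral_congr_fun measurableSet_Ioo fun w hw => ?_
  have := hD w hw
  simp only [smul_eq_mul]
  rw [abs_of_pos (by positivity)]

theorem integral_rpow_abs_sub_mul_bump_one (hα : 0 < α) (hα2 : α < 2) (hx : |x| < 1) :
    ∫ y, |x - y| ^ α * bump ((1 - α) / 2) 1 y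
      = beta ((α + 1) / 2) ((3 - α) / 2) * (1 + α * x ^ 2) := by
  set e := (1 - α) / 2 with he
  set z := x ^ 2 with hz
  have hz0 : 0 ≤ z := sq_nonneg x
  have hz1 : z < 1 := by rw [hz, ← sq_abs]; nlinarith [abs_nonneg x]
  have hz1' : 0 < 1 - z := by linarith
  have hoff : ∀ y ∉ Ioo (-1 : ℝ) 1, bump e 1 y = 0 := fun y hy => bump_of_le (by
    by_contra! h
    exact hy (abs_lt.1 (by rw [← sq_abs] at h; nlinarith [abs_nonneg y])))
  have hint := integrable_rpow_abs_sub_mul_bump hα (by linarith : -1 < e) x 1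
  let H : ℝ → ℝ := fun u => (1 - z) ^ ((3 + α) / 2) * (|u| ^ α * bump e 1 u) / (1 + x * u) ^ 3
  have hHoff : ∀ u ∉ Ioo (-1 : ℝ) 1, H u = 0 := fun u hu => by simp [H, hoff u hu]
  have hH : ∀ u ∈ Ioo (-1 : ℝ) 1, |(1 - x ^ 2) / (1 + x * u) ^ 2| • (|x - (x + u) / (1 + x * u)| ^ α *
        bump e 1 ((x + u) / (1 + x * u))) = H u := fun u hu => by
    have h1 : (x + u) / (1 + x * u) ∈ Ioo (-1 : ℝ) 1 := by
      rw [← image_moebius_Ioo hx]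
      exact mem_image_of_mem _ hu
    rw [bump_of_lt (by rw [← sq_abs]; nlinarith [abs_lt.2 h1, abs_nonneg ((x + u) / (1 + x * u))]),
      smul_eq_mul, abs_deriv_mul_comp_moebius hx (abs_lt.2 hu)]
    simp only [H]
    rw [bump_of_lt (by rw [← sq_abs]; nlinarith [abs_lt.2 hu, abs_nonneg u])]
  have hder : ∀ u ∈ Ioo (-1 : ℝ) 1, HasDerivWithinAt (fun u : ℝ => (x + u) / (1 + x * u))
      ((1 - x ^ 2) / (1 + x * u) ^ 2) (Ioo (-1) 1) u := fun u hu =>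
    (hasDerivAt_moebius (one_add_mul_pos_of_abs_lt_one hx (abs_lt.2 hu)).ne').hasDerivWithinAt
  have h1 : ∫ y, |x - y| ^ α * bump e 1 y = ∫ u, H u := by
    have h := integral_image_eq_integral_abs_deriv_smul measurableSet_Ioo hder (injOn_moebius hx)
      (fun y => |x - y| ^ α * bump e 1 y)
    rw [image_moebius_Ioo hx, setIntegral_congr_fun measurableSet_Ioo hH,
      setIntegral_eq_integral_of_forall_compl_eq_zero fun y hy => by rw [hoff y hy, mul_zero],
      setIntegral_eq_integral_of_forall_compl_eq_zero hHoff] at h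
    exact h
  have hHint : Integrable H := by
    have h := (integrableOn_image_iff_integrableOn_abs_deriv_smul measurableSet_Ioo hder
      (injOn_moebius hx) (fun y => |x - y| ^ α * bump e 1 y)).1 hint.integrableOn
    rw [integrableOn_congr_fun hH measurableSet_Ioo] at h
    exact (integrableOn_iff_integrable_of_support_subset fun u hu => by
      by_contra h'
      exact hu (hHoff u h')).1 h
  let G : ℝ → ℝ := fun v => (1 - z) ^ ((3 + α) / 2) * (v ^ (α / 2) * (if v < 1 then (1 - v) ^ e else 0))
    * ((2 + 6 * z * v) / (1 - z * v) ^ 3)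
  have hG : ∀ u, H u + H (-u) = G (u ^ 2) := fun u => by
    by_cases hu : u ^ 2 < 1
    · have hu' : |u| < 1 := by rw [← sq_abs] at hu; nlinarith [abs_nonneg u]
      have p1 := (one_add_mul_pos_of_abs_lt_one hx hu').ne'
      have p2 : 1 - x * u ≠ 0 := by
        have := one_add_mul_pos_of_abs_lt_one hx (u := -u) (by simpa)
        linarith
      have p3 : 1 - x ^ 2 * u ^ 2 ≠ 0 := by
        rw [show 1 - x ^ 2 * u ^ 2 = (1 + x * u) * (1 - x * u) by ring]
        exact mul_ne_zero p1 p2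
      have p4 : (u ^ 2) ^ (α / 2) = |u| ^ α := by
        rw [← sq_abs, ← Real.rpow_natCast, ← Real.rpow_mul (abs_nonneg u)]
        congr 1
        push_cast
        ring
      have p5 : 1 / (1 + x * u) ^ 3 + 1 / (1 - x * u) ^ 3
          = (2 + 6 * x ^ 2 * u ^ 2) / (1 - x ^ 2 * u ^ 2) ^ 3 := by
        rw [show 1 - x ^ 2 * u ^ 2 = (1 + x * u) * (1 - x * u) by ring]
        field_simp
        ring
      simp only [H, G, abs_neg, mul_neg, ← sub_eq_add_neg, p4, if_pos hu, hz]
      rw [bump_of_lt hu, bump_of_lt (by simpa using hu), ← p5]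
      ring_nf
    · have hu' : 1 ≤ (-u) ^ 2 := by rw [neg_sq]; exact not_lt.1 hu
      simp only [H, G, bump_of_le (not_lt.1 hu), bump_of_le hu', if_neg hu]
      ring
  have h2 : ∫ u, H u = 1 / 2 * ∫ v in Ioi (0 : ℝ), v ^ (-(1 / 2) : ℝ) * G v := by
    rw [← integral_comp_sq, ← integral_congr_ae (ae_of_all _ hG),
      integral_add hHint hHint.comp_neg, integral_neg_eq_self]
    ring
  have h3 : ∫ v in Ioi (0 : ℝ), v ^ (-(1 / 2) : ℝ) * G v
      = ∫ v in Ioo (0 : ℝ) 1, v ^ (-(1 / 2) : ℝ) * G v := by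
    refine (setIntegral_eq_of_subset_of_forall_sdiff_eq_zero measurableSet_Ioi Ioo_subset_Ioi_self
      fun v hv => ?_)
    have : ¬ v < 1 := fun h => hv.2 ⟨hv.1, h⟩
    simp [G, this]
  have h4 : ∀ w ∈ Ioo (0 : ℝ) 1, (1 - z) / (1 - z + z * w) ^ 2 *
      ((w / (1 - z + z * w)) ^ (-(1 / 2) : ℝ) * G (w / (1 - z + z * w)))
      = 2 * (1 - z) * (w ^ ((α + 1) / 2 - 1) * (1 - w) ^ ((3 - α) / 2 - 1))
        + 8 * z * (w ^ ((α + 1) / 2 + 1 - 1) * (1 - w) ^ ((3 - α) / 2 - 1)) := fun w hw => by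
    have hD : 0 < 1 - z + z * w := by nlinarith [mul_nonneg hz0 hw.1.le]
    have hw0 := hw.1
    have hw1 : 0 < 1 - w := by linarith [hw.2]
    set D := 1 - z + z * w with hDdef
    have q1 : 1 - w / D = (1 - z) * (1 - w) / D := by
      rw [eq_div_iff hD.ne', sub_mul, div_mul_cancel₀ _ hD.ne', hDdef]; ring
    have q2 : 1 - z * (w / D) = (1 - z) / D := by
      rw [eq_div_iff hD.ne', sub_mul, mul_assoc, div_mul_cancel₀ _ hD.ne', hDdef]; ring
    have q3 : 2 + 6 * z * (w / D) = (2 * (1 - z) + 8 * z * w) / D := by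
      rw [eq_div_iff hD.ne', add_mul, mul_assoc (6 * z), div_mul_cancel₀ _ hD.ne', hDdef]; ring
    have q4 : w / D < 1 := by
      rw [div_lt_one hD, hDdef]; nlinarith
    have q5 : (w / D) ^ (-(1 / 2) : ℝ) * (w / D) ^ (α / 2) = w ^ ((α + 1) / 2 - 1) / D ^ ((α + 1) / 2 - 1) := by
      rw [← Real.rpow_add (by positivity), Real.div_rpow hw0.le hD.le]
      ring_nf
    have q6 : ((1 - z) * (1 - w) / D) ^ e
        = (1 - z) ^ e * (1 - w) ^ ((3 - α) / 2 - 1) / D ^ ((3 - α) / 2 - 1) := by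
      rw [Real.div_rpow (by positivity) hD.le, Real.mul_rpow hz1'.le hw1.le, he,
        show (3 - α) / 2 - 1 = (1 - α) / 2 by ring]
    have q7 : D ^ ((α + 1) / 2 - 1) * D ^ ((3 - α) / 2 - 1) = 1 := by
      rw [← Real.rpow_add hD]
      ring_nf
      simp
    have q8 : (1 - z) ^ ((3 + α) / 2) * (1 - z) ^ e = (1 - z) ^ 2 := by
      rw [← Real.rpow_add hz1', ← Real.rpow_natCast, he]
      ring_nf
    have q9 : w ^ ((α + 1) / 2 + 1 - 1) = w ^ ((α + 1) / 2 - 1) * w := by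
      nth_rewrite 3 [← Real.rpow_one w]
      rw [← Real.rpow_add hw0]
      ring_nf
    have r1 : D ^ ((α + 1) / 2 - 1) ≠ 0 := (Real.rpow_pos_of_pos hD _).ne'
    have r2 : D ^ ((3 - α) / 2 - 1) = (D ^ ((α + 1) / 2 - 1))⁻¹ := by
      rw [← eq_inv_of_mul_eq_one_right q7]
    simp only [G, if_pos q4, q1, q2, q3, q6, q9]
    calc _ = (1 - z) / D ^ 2 * (((w / D) ^ (-(1 / 2) : ℝ) * (w / D) ^ (α / 2))
          * ((1 - z) ^ ((3 + α) / 2) * (1 - z) ^ e) * ((1 - w) ^ ((3 - α) / 2 - 1) / D ^ ((3 - α) / 2 - 1))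
          * ((2 * (1 - z) + 8 * z * w) / D / ((1 - z) / D) ^ 3)) := by ring
      _ = _ := by
        rw [q5, q8, r2]
        field_simp
  have hp : 0 < (α + 1) / 2 := by linarith
  have hp' : 0 < (α + 1) / 2 + 1 := by linarith
  have hq : 0 < (3 - α) / 2 := by linarith
  rw [h1, h2, h3, setIntegral_Ioo_comp_div hz0 hz1, setIntegral_congr_fun measurableSet_Ioo h4,
    integral_add ((integrableOn_Ioo_rpow_mul_one_sub_rpow hp hq).const_mul _)
      ((integrableOn_Ioo_rpow_mul_one_sub_rpow hp' hq).const_mul _), integral_const_mul,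
    integral_const_mul, integral_Ioo_rpow_mul_one_sub_rpow hp hq,
    integral_Ioo_rpow_mul_one_sub_rpow hp' hq, beta_add_one_left hp hq,
    show (α + 1) / 2 + (3 - α) / 2 = 2 by ring]
  ring

theorem integral_rpow_abs_sub_mul_bump (hα : 0 < α) (hα2 : α < 2) {s : ℝ} (hx : x ^ 2 < s) :
    ∫ y, |x - y| ^ α * bump ((1 - α) / 2) s y
      = beta ((α + 1) / 2) ((3 - α) / 2) * (s + α * x ^ 2) := by
  have hs : 0 < s := (sq_nonneg x).trans_lt hx
  have hs' : 0 < √s := Real.sqrt_pos.2 hs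
  have h : ∀ u, |x - √s * u| ^ α * bump ((1 - α) / 2) 1 u
      = s ^ (α / 2) * (|x / √s - u| ^ α * bump ((1 - α) / 2) 1 u) := by
    intro u
    rw [show x - √s * u = √s * (x / √s - u) by field_simp, abs_mul,
      Real.mul_rpow (abs_nonneg _) (abs_nonneg _), abs_of_pos hs', Real.sqrt_eq_rpow,
      ← Real.rpow_mul hs.le]
    ring_nf
  rw [integral_mul_bump hs]
  simp_rw [h]
  rw [integral_const_mul, integral_rpow_abs_sub_mul_bump_one hα hα2 (by
      rw [abs_div, abs_of_pos hs', div_lt_one hs']; exact Real.lt_sqrt_of_sq_lt (by rwa [sq_abs])),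
    ← mul_assoc, ← Real.rpow_add hs, show (1 - α) / 2 + 1 / 2 + α / 2 = 1 by ring, Real.rpow_one,
    div_pow, Real.sq_sqrt hs.le]
  field_simp

end Potential

section Power

variable {p t₀ t₁ : ℝ}

theorem mul_rpow_sub_one_mul_sub_le (hp : 0 < p) (hp1 : p < 1) (h0 : 0 ≤ t₀) (h1 : 0 < t₁) :
    p * t₁ ^ (p - 1) * (t₁ - t₀) ≤ t₁ ^ p - t₀ ^ p := by
  have h := rpow_one_add_le_one_add_mul_self (s := t₀ / t₁ - 1)
    (by linarith [div_nonneg h0 h1.le]) hp.le hp1.le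
  rw [add_sub_cancel, Real.div_rpow h0 h1.le, div_le_iff₀ (Real.rpow_pos_of_pos h1 _)] at h
  have e : t₁ ^ p = t₁ ^ (p - 1) * t₁ := by
    rw [← Real.rpow_add_one h1.ne']; ring_nf
  have e2 : (1 + p * (t₀ / t₁ - 1)) * t₁ ^ p = t₁ ^ p - p * t₁ ^ (p - 1) * (t₁ - t₀) := by
    rw [e]; field_simp; ring
  linarith

theorem sub_mul_rpow_add_rpow_le (hp : 0 < p) (hp1 : p < 1) (h0 : 0 < t₀) (h : t₀ ≤ t₁) :
    (t₁ - t₀) * (t₁ ^ p + t₀ ^ p) ≤ 2 * (t₁ ^ (p + 1) - t₀ ^ (p + 1)) / (p + 1) := by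
  let φ : ℝ → ℝ := fun t => 2 * (t ^ (p + 1) - t₀ ^ (p + 1)) / (p + 1) - (t - t₀) * (t ^ p + t₀ ^ p)
  have hd : ∀ t, t₀ ≤ t → HasDerivAt φ (t ^ p - t₀ ^ p - p * t ^ (p - 1) * (t - t₀)) t := by
    intro t ht
    have ht' : t ≠ 0 := (h0.trans_le ht).ne'
    have d1 := (((Real.hasDerivAt_rpow_const (p := p + 1) (Or.inl ht')).sub_const
      (t₀ ^ (p + 1))).const_mul 2).div_const (p + 1)
    have d2 := ((hasDerivAt_id t).sub_const t₀).mul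
      ((Real.hasDerivAt_rpow_const (p := p) (Or.inl ht')).add_const (t₀ ^ p))
    refine (d1.sub d2).congr_deriv ?_
    have : p + 1 ≠ 0 := by linarith
    simp only [id, add_sub_cancel_right]
    field_simp
    ring
  have hm : MonotoneOn φ (Ici t₀) := by
    refine monotoneOn_of_deriv_nonneg (convex_Ici _)
      (fun t ht => (hd t ht).continuousAt.continuousWithinAt)
      (fun t ht => (hd t (interior_subset ht)).differentiableAt.differentiableWithinAt) fun t ht => ?_
    have ht : t₀ ≤ t := interior_subset ht
    rw [(hd t ht).deriv]
    linarith [mul_rpow_sub_one_mul_sub_le hp hp1 h0.le (h0.trans_le ht)]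
  have := hm self_mem_Ici h h
  simp only [φ] at this
  rw [sub_self, sub_self] at this
  simp only [mul_zero, zero_div, zero_mul, sub_zero] at this
  linarith

end Power

section LineEnergy

variable {α s t t₀ t₁ : ℝ}

theorem continuous_rpow_norm_sub {X : Type*} [SeminormedAddCommGroup X] (hα : 0 < α) :
    Continuous fun z : X × X => ‖z.1 - z.2‖ ^ α :=
  (by fun_prop : Continuous fun z : X × X => ‖z.1 - z.2‖).rpow_const fun _ => Or.inr hα.le

theorem integrable_rpow_abs_sub_mul_bump_prod {β : ℝ} (hα : 0 < α) (hβ : -1 < β) (t s : ℝ) :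
    Integrable (fun z : ℝ × ℝ => |z.1 - z.2| ^ α * (bump β t z.1 * bump β s z.2)) := by
  refine integrable_continuous_mul_prod_of_support_subset
    (isCompact_Icc (a := -√(max 0 (max t s))) (b := √(max 0 (max t s))))
    (continuous_rpow_norm_sub hα) (integrable_bump hβ t) (fun u hu => ?_)
    (integrable_bump hβ s) (fun u hu => ?_) <;>
  refine bump_of_notMem_Icc ?_ (Real.sqrt_nonneg _) hu <;>
  simp [Real.sq_sqrt (le_max_left _ _)]

theorem integral_prod_rpow_abs_sub_mul_bump (hα : 0 < α) (hα2 : α < 2) (ht : 0 < t) (hts : t ≤ s) :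
    ∫ z : ℝ × ℝ, |z.1 - z.2| ^ α * (bump ((1 - α) / 2) t z.1 * bump ((1 - α) / 2) s z.2)
      = beta ((α + 1) / 2) ((3 - α) / 2) * beta (1 / 2) ((3 - α) / 2)
        * (s * t ^ (1 - α / 2) + α / (4 - α) * t ^ (1 - α / 2 + 1)) := by
  have he : -1 < (1 - α) / 2 := by linarith
  have h1 : ∀ x, ∫ y, |x - y| ^ α * (bump ((1 - α) / 2) t x * bump ((1 - α) / 2) s y)
      = beta ((α + 1) / 2) ((3 - α) / 2) * s * bump ((1 - α) / 2) t x
        + beta ((α + 1) / 2) ((3 - α) / 2) * α * (x ^ 2 * bump ((1 - α) / 2) t x) := by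
    intro x
    have : ∀ y, |x - y| ^ α * (bump ((1 - α) / 2) t x * bump ((1 - α) / 2) s y)
        = bump ((1 - α) / 2) t x * (|x - y| ^ α * bump ((1 - α) / 2) s y) :=
      fun y => mul_left_comm _ _ _
    rw [integral_congr_ae (ae_of_all _ this), integral_const_mul]
    rcases lt_or_ge (x ^ 2) t with hx | hx
    · rw [integral_rpow_abs_sub_mul_bump hα hα2 (hx.trans_le hts)]
      ring
    · simp [bump_of_le hx]
  have hsq : Integrable fun x => x ^ 2 * bump ((1 - α) / 2) t x :=
    integrable_continuous_mul_of_support_subset isCompact_Icc (by fun_prop) (integrable_bump he t)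
      fun u hu => bump_of_notMem_Icc (Real.sq_sqrt ht.le).ge (Real.sqrt_nonneg t) hu
  rw [Measure.volume_eq_prod, integral_prod _ (integrable_rpow_abs_sub_mul_bump_prod hα he t s),
    integral_congr_ae (ae_of_all _ h1),
    integral_add ((integrable_bump he t).const_mul _) (hsq.const_mul _), integral_const_mul,
    integral_const_mul, integral_bump he ht, integral_sq_mul_bump he ht,
    show (1 - α) / 2 + 1 / 2 = 1 - α / 2 by ring, show (1 - α) / 2 + 1 = (3 - α) / 2 by ring,
    show (1 - α) / 2 + 3 / 2 = 1 - α / 2 + 1 by ring, show 2 * ((1 - α) / 2) + 3 = 4 - α by ring]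
  ring

theorem integral_bump_sub_bump (hα2 : α < 2) (h0 : 0 < t₀) (h : 0 < t₁) :
    ∫ u, (bump ((1 - α) / 2) t₁ u - bump ((1 - α) / 2) t₀ u)
      = beta (1 / 2) ((3 - α) / 2) * (t₁ ^ (1 - α / 2) - t₀ ^ (1 - α / 2)) := by
  have he : -1 < (1 - α) / 2 := by linarith
  rw [integral_sub (integrable_bump he _) (integrable_bump he _), integral_bump he h,
    integral_bump he h0, show (1 - α) / 2 + 1 / 2 = 1 - α / 2 by ring,
    show (1 - α) / 2 + 1 = (3 - α) / 2 by ring]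
  ring

theorem le_rieszEnergy_bump_sub_bump (hα : 0 < α) (hα2 : α < 2) (h0 : 0 < t₀) (h : t₀ ≤ t₁) :
    beta ((α + 1) / 2) ((3 - α) / 2) * (t₁ - t₀)
        * (beta (1 / 2) ((3 - α) / 2) * (t₁ ^ (1 - α / 2) - t₀ ^ (1 - α / 2)))
      ≤ rieszEnergy α fun u => bump ((1 - α) / 2) t₁ u - bump ((1 - α) / 2) t₀ u := by
  have he : -1 < (1 - α) / 2 := by linarith
  have h1 := h0.trans_le h
  have hI := fun t s => integrable_rpow_abs_sub_mul_bump_prod hα he t s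
  have hI2 : ∀ a b c d, Integrable fun z : ℝ × ℝ =>
      |z.1 - z.2| ^ α * (bump ((1 - α) / 2) a z.1 * bump ((1 - α) / 2) b z.2)
      - |z.1 - z.2| ^ α * (bump ((1 - α) / 2) c z.1 * bump ((1 - α) / 2) d z.2) :=
    fun a b c d => (hI a b).sub (hI c d)
  have hswap : ∫ z : ℝ × ℝ, |z.1 - z.2| ^ α * (bump ((1 - α) / 2) t₁ z.1 * bump ((1 - α) / 2) t₀ z.2)
      = ∫ z : ℝ × ℝ, |z.1 - z.2| ^ α * (bump ((1 - α) / 2) t₀ z.1 * bump ((1 - α) / 2) t₁ z.2) := by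
    rw [Measure.volume_eq_prod, ← integral_prod_swap]
    refine integral_congr_ae (ae_of_all _ fun z => ?_)
    simp only [Prod.fst_swap, Prod.snd_swap]
    rw [abs_sub_comm, mul_comm (bump _ t₁ _)]
  have key : rieszEnergy α (fun u => bump ((1 - α) / 2) t₁ u - bump ((1 - α) / 2) t₀ u)
      = (∫ z : ℝ × ℝ, |z.1 - z.2| ^ α * (bump ((1 - α) / 2) t₁ z.1 * bump ((1 - α) / 2) t₁ z.2))
        - (∫ z : ℝ × ℝ, |z.1 - z.2| ^ α * (bump ((1 - α) / 2) t₁ z.1 * bump ((1 - α) / 2) t₀ z.2))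
        - ((∫ z : ℝ × ℝ, |z.1 - z.2| ^ α * (bump ((1 - α) / 2) t₀ z.1 * bump ((1 - α) / 2) t₁ z.2))
        - ∫ z : ℝ × ℝ, |z.1 - z.2| ^ α * (bump ((1 - α) / 2) t₀ z.1 * bump ((1 - α) / 2) t₀ z.2)) := by
    rw [← integral_sub (hI _ _) (hI _ _), ← integral_sub (hI _ _) (hI _ _),
      ← integral_sub (hI2 _ _ _ _) (hI2 _ _ _ _), rieszEnergy]
    refine integral_congr_ae (ae_of_all _ fun z => ?_)
    simp only [Real.norm_eq_abs]
    ring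
  rw [key, hswap, integral_prod_rpow_abs_sub_mul_bump hα hα2 h1 le_rfl,
    integral_prod_rpow_abs_sub_mul_bump hα hα2 h0 h,
    integral_prod_rpow_abs_sub_mul_bump hα hα2 h0 le_rfl]
  have hB : 0 < beta ((α + 1) / 2) ((3 - α) / 2) := beta_pos (by linarith) (by linarith)
  have hM : 0 < beta (1 / 2) ((3 - α) / 2) := beta_pos (by norm_num) (by linarith)
  have hP := sub_mul_rpow_add_rpow_le (p := 1 - α / 2) (by linarith) (by linarith) h0 h
  rw [Real.rpow_add_one h0.ne', Real.rpow_add_one h1.ne'] at *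
  set a := t₁ ^ (1 - α / 2)
  set b := t₀ ^ (1 - α / 2)
  have h4 : 4 - α ≠ 0 := by linarith
  have e : 2 * (a * t₁ - b * t₀) / (1 - α / 2 + 1) = 4 * (a * t₁ - b * t₀) / (4 - α) := by
    rw [div_eq_div_iff (by linarith) h4]; ring
  rw [e] at hP
  have hmul := mul_le_mul_of_nonneg_left hP (mul_pos hB hM).le
  refine le_trans (le_of_eq ?_) ((sub_le_sub_right hmul
    (beta ((α + 1) / 2) ((3 - α) / 2) * beta (1 / 2) ((3 - α) / 2) * (2 * b * (t₁ - t₀)))).trans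
    (le_of_eq ?_))
  · ring
  · field_simp
    ring

/-- Positive definite kernel obtained from `-|x - y| ^ α` by balancing with the weights `c`. -/
theorem sum_mul_balanced_kernel_nonneg (hα : 0 < α) (hα2 : α < 2) {n m : ℕ} (x c : Fin n → ℝ)
    (hc : ∑ i, c i ≠ 0) (y η : Fin m → ℝ) :
    0 ≤ ∑ k, ∑ l, η k * η l * (-|y k - y l| ^ α + (∑ i, c i * |y k - x i| ^ α) / (∑ i, c i)
      + (∑ i, c i * |y l - x i| ^ α) / (∑ i, c i)
      - (∑ i, ∑ j, c i * c j * |x i - x j| ^ α) / (∑ i, c i) ^ 2) := by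
  set σ := ∑ i, c i with hσ
  set M := ∑ k, η k with hM
  have h := sum_mul_rpow_abs_sub_nonpos hα hα2 (Sum.elim y x)
    (Sum.elim η fun i => -(M / σ) * c i) (by
      simp only [Fintype.sum_sum_type, Sum.elim_inl, Sum.elim_inr]
      rw [← Finset.mul_sum, ← hσ, ← hM]
      field_simp
      ring)
  simp only [Fintype.sum_sum_type, Sum.elim_inl, Sum.elim_inr, Finset.sum_add_distrib] at h
  have e1 : ∑ k, ∑ i, η k * (-(M / σ) * c i) * |y k - x i| ^ α
      = -(M / σ) * ∑ k, η k * ∑ i, c i * |y k - x i| ^ α := by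
    simp only [Finset.mul_sum]
    exact Finset.sum_congr rfl fun k _ => Finset.sum_congr rfl fun i _ => by ring
  have e2 : ∑ i, ∑ k, -(M / σ) * c i * η k * |x i - y k| ^ α
      = -(M / σ) * ∑ k, η k * ∑ i, c i * |y k - x i| ^ α := by
    rw [← e1, Finset.sum_comm]
    refine Finset.sum_congr rfl fun k _ => Finset.sum_congr rfl fun i _ => ?_
    rw [abs_sub_comm]
    ring
  have e3 : ∑ i, ∑ j, -(M / σ) * c i * (-(M / σ) * c j) * |x i - x j| ^ α
      = (M / σ) ^ 2 * ∑ i, ∑ j, c i * c j * |x i - x j| ^ α := by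
    simp only [Finset.mul_sum]
    exact Finset.sum_congr rfl fun k _ => Finset.sum_congr rfl fun i _ => by ring
  rw [e1, e2, e3] at h
  have e4 : ∀ (u : Fin m → ℝ), ∑ k, ∑ l, η k * η l * (u k / σ) = M / σ * ∑ k, η k * u k := by
    intro u
    have : ∀ k, ∑ l, η k * η l * (u k / σ) = M / σ * (η k * u k) := by
      intro k
      rw [hM, Finset.sum_div, Finset.sum_mul]
      exact Finset.sum_congr rfl fun l _ => by ring
    rw [Finset.sum_congr rfl fun k _ => this k, ← Finset.mul_sum]
  have e5 : ∀ I : ℝ, ∑ k, ∑ l, η k * η l * (I / σ ^ 2) = (M / σ) ^ 2 * I := by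
    intro I
    simp_rw [← Finset.sum_mul, ← Finset.mul_sum, ← Finset.sum_mul, ← hM]
    ring
  have e6 : ∀ (u : Fin m → ℝ), ∑ k, ∑ l, η k * η l * (u l / σ) = M / σ * ∑ k, η k * u k := by
    intro u
    rw [Finset.sum_comm, ← e4]
    exact Finset.sum_congr rfl fun k _ => Finset.sum_congr rfl fun l _ => by ring
  simp only [mul_sub, mul_add, Finset.sum_add_distrib, Finset.sum_sub_distrib, e5]
  rw [e4 fun k => ∑ i, c i * |y k - x i| ^ α, e6 fun k => ∑ i, c i * |y k - x i| ^ α]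
  simp only [mul_neg, Finset.sum_neg_distrib]
  linarith

end LineEnergy

section LineBound

variable {α : ℝ}

theorem beta_div_mul_beta (hα : 0 < α) (hα2 : α < 2) :
    beta ((α + 1) / 2) ((3 - α) / 2) / (beta (1 / 2) ((3 - α) / 2) * (1 - α / 2))
      = Real.Gamma ((2 - α) / 2) * (Real.Gamma ((1 + α) / 2) / Real.Gamma (1 / 2)) := by
  have hp : 0 < (2 - α) / 2 := by linarith
  have h1 := (Real.Gamma_pos_of_pos hp).ne'
  have h2 := (Real.Gamma_pos_of_pos (show 0 < (3 - α) / 2 by linarith)).ne'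
  have h3 := (Real.Gamma_pos_of_pos (show (0 : ℝ) < 1 / 2 by norm_num)).ne'
  have h4 : 2 - α ≠ 0 := by linarith
  rw [beta, beta, show (α + 1) / 2 + (3 - α) / 2 = 2 by ring,
    show 1 / 2 + (3 - α) / 2 = (2 - α) / 2 + 1 by ring, Real.Gamma_add_one hp.ne', Real.Gamma_two,
    show 1 - α / 2 = (2 - α) / 2 by ring, add_comm α 1]
  field_simp

theorem sum_mul_rpow_abs_sub_mul_le (hα : 0 < α) (hα2 : α < 2) {n : ℕ} (x c : Fin n → ℝ)
    (hc : ∑ i, c i ≠ 0) {t₀ t₁ : ℝ} (h0 : 0 < t₀) (h : t₀ < t₁) (hx : ∀ i, x i ^ 2 < t₀) :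
    (∑ i, ∑ j, c i * c j * |x i - x j| ^ α)
        * (beta (1 / 2) ((3 - α) / 2) * (t₁ ^ (1 - α / 2) - t₀ ^ (1 - α / 2)))
      ≤ (∑ i, c i) ^ 2 * (beta ((α + 1) / 2) ((3 - α) / 2) * (t₁ - t₀)) := by
  have he : -1 < (1 - α) / 2 := by linarith
  have h1 := h0.trans h
  set e := (1 - α) / 2 with hedef
  set σ := ∑ i, c i with hσ
  set I := ∑ i, ∑ j, c i * c j * |x i - x j| ^ α with hI
  set f : ℝ → ℝ := fun u => bump e t₁ u - bump e t₀ u with hfdef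
  set U : ℝ → ℝ := fun y => ∑ i, c i * |y - x i| ^ α with hU
  set M := beta (1 / 2) ((3 - α) / 2) * (t₁ ^ (1 - α / 2) - t₀ ^ (1 - α / 2)) with hM
  have hMf : ∫ u, f u = M := integral_bump_sub_bump hα2 h0 h1
  have hMpos : 0 < M := mul_pos (beta_pos (by norm_num) (by linarith))
    (sub_pos.2 (Real.rpow_lt_rpow h0.le h (by linarith)))
  have hf : Integrable f := (integrable_bump he _).sub (integrable_bump he _)
  have hS : IsCompact (Icc (-√t₁) √t₁) := isCompact_Icc
  have hfS : ∀ u ∉ Icc (-√t₁) √t₁, f u = 0 := fun u hu => by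
    have hs := Real.sq_sqrt h1.le
    simp only [hfdef]
    rw [bump_of_notMem_Icc hs.ge (Real.sqrt_nonneg _) hu,
      bump_of_notMem_Icc (h.le.trans hs.ge) (Real.sqrt_nonneg _) hu, sub_zero]
  have hUc : Continuous U := continuous_finsetSum _ fun i _ => continuous_const.mul
    ((by fun_prop : Continuous fun y : ℝ => |y - x i|).rpow_const fun _ => Or.inr hα.le)
  have hUf : ∫ u, U u * f u = σ * (beta ((α + 1) / 2) ((3 - α) / 2) * (t₁ - t₀)) := by
    have e1 : ∀ u, U u * f u = ∑ i, c i * (|x i - u| ^ α * bump e t₁ u - |x i - u| ^ α * bump e t₀ u) := by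
      intro u
      simp only [hU, hfdef, Finset.sum_mul]
      refine Finset.sum_congr rfl fun i _ => ?_
      rw [abs_sub_comm]
      ring
    have e2 : ∀ i, Integrable fun u => |x i - u| ^ α * bump e t₁ u - |x i - u| ^ α * bump e t₀ u :=
      fun i => (integrable_rpow_abs_sub_mul_bump hα he _ _).sub
        (integrable_rpow_abs_sub_mul_bump hα he _ _)
    rw [integral_congr_ae (ae_of_all _ e1), integral_finsetSum _ fun i _ => (e2 i).const_mul _, hσ,
      Finset.sum_mul]
    refine Finset.sum_congr rfl fun i _ => ?_
    rw [integral_const_mul, integral_sub (integrable_rpow_abs_sub_mul_bump hα he _ _)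
        (integrable_rpow_abs_sub_mul_bump hα he _ _),
      integral_rpow_abs_sub_mul_bump hα hα2 ((hx i).trans h),
      integral_rpow_abs_sub_mul_bump hα hα2 (hx i)]
    ring
  have hE : beta ((α + 1) / 2) ((3 - α) / 2) * (t₁ - t₀) * M ≤ rieszEnergy α f :=
    le_rieszEnergy_bump_sub_bump hα hα2 h0 h.le
  have hK : Continuous fun z : ℝ × ℝ =>
      -‖z.1 - z.2‖ ^ α + U z.1 / σ + U z.2 / σ - I / σ ^ 2 := by
    have := continuous_rpow_norm_sub (X := ℝ) hα
    fun_prop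
  have hpos := integral_prod_nonneg_of_posSemidef (μ := volume) hS hf hfS hK
    fun m y _ η => sum_mul_balanced_kernel_nonneg hα hα2 x c hc y η
  have i1 := integrable_continuous_mul_prod_of_support_subset (μ := volume) hS
    (continuous_rpow_norm_sub (X := ℝ) hα) hf hfS hf hfS
  have hUi : Integrable fun u => U u * f u := integrable_continuous_mul_of_support_subset hS hUc hf hfS
  have i2 : Integrable (fun z : ℝ × ℝ => (U z.1 * f z.1) * f z.2) (volume.prod volume) := hUi.mul_prod hf
  have i3 : Integrable (fun z : ℝ × ℝ => f z.1 * (U z.2 * f z.2)) (volume.prod volume) := hf.mul_prod hUi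
  have i4 : Integrable (fun z : ℝ × ℝ => f z.1 * f z.2) (volume.prod volume) := hf.mul_prod hf
  have j1 : Integrable (fun z : ℝ × ℝ => -(‖z.1 - z.2‖ ^ α * (f z.1 * f z.2)))
      (volume.prod volume) := i1.neg
  have j2 : Integrable (fun z : ℝ × ℝ => -(‖z.1 - z.2‖ ^ α * (f z.1 * f z.2))
      + 1 / σ * (U z.1 * f z.1 * f z.2)) (volume.prod volume) := j1.add (i2.const_mul _)
  have j3 : Integrable (fun z : ℝ × ℝ => -(‖z.1 - z.2‖ ^ α * (f z.1 * f z.2))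
      + 1 / σ * (U z.1 * f z.1 * f z.2) + 1 / σ * (f z.1 * (U z.2 * f z.2)))
      (volume.prod volume) := j2.add (i3.const_mul _)
  have key : ∫ z : ℝ × ℝ, (-‖z.1 - z.2‖ ^ α + U z.1 / σ + U z.2 / σ - I / σ ^ 2)
        * (f z.1 * f z.2) ∂(volume.prod volume)
      = -rieszEnergy α f + 1 / σ * ((∫ u, U u * f u) * ∫ u, f u) + 1 / σ * ((∫ u, f u) * ∫ u, U u * f u)
        - I / σ ^ 2 * ((∫ u, f u) * ∫ u, f u) := by
    rw [← integral_prod_mul (fun u => U u * f u) f, ← integral_prod_mul f (fun u => U u * f u),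
      ← integral_prod_mul f f, ← integral_const_mul, ← integral_const_mul, ← integral_const_mul,
      rieszEnergy, Measure.volume_eq_prod, ← integral_neg, ← integral_add j1 (i2.const_mul _),
      ← integral_add j2 (i3.const_mul _), ← integral_sub j3 (i4.const_mul _)]
    refine integral_congr_ae (ae_of_all _ fun z => ?_)
    simp only
    ring
  rw [key, hUf, hMf] at hpos
  have hσ2 : 0 < σ ^ 2 := by positivity
  set P := beta ((α + 1) / 2) ((3 - α) / 2) * (t₁ - t₀)
  have e3 : 1 / σ * (σ * P * M) = P * M := by field_simp
  have e4 : 1 / σ * (M * (σ * P)) = P * M := by field_simp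
  rw [e3, e4] at hpos
  have h5 : I / σ ^ 2 * M ≤ P := by
    refine le_of_mul_le_mul_right ?_ hMpos
    linarith
  rw [div_mul_eq_mul_div, div_le_iff₀ hσ2] at h5
  linarith

theorem sum_mul_rpow_abs_sub_le (hα : 0 < α) (hα2 : α < 2) {n : ℕ} (x c : Fin n → ℝ) {r : ℝ}
    (hr : 0 ≤ r) (hx : ∀ i, |x i| ≤ r) :
    ∑ i, ∑ j, c i * c j * |x i - x j| ^ α
      ≤ Real.Gamma ((2 - α) / 2) * (Real.Gamma ((1 + α) / 2) / Real.Gamma (1 / 2)) * r ^ α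
        * (∑ i, c i) ^ 2 := by
  by_cases hc : ∑ i, c i = 0
  · simpa [hc] using sum_mul_rpow_abs_sub_nonpos hα hα2 x c hc
  rw [← beta_div_mul_beta hα hα2]
  set B := beta ((α + 1) / 2) ((3 - α) / 2)
  set M := beta (1 / 2) ((3 - α) / 2)
  have hB : 0 < B := beta_pos (by linarith) (by linarith)
  have hM : 0 < M := beta_pos (by norm_num) (by linarith)
  have hp : 0 < 1 - α / 2 := by linarith
  have hp2 : 2 - α ≠ 0 := by linarith
  have hbound : ∀ t ∈ Ioi (r ^ 2), ∑ i, ∑ j, c i * c j * |x i - x j| ^ α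
      ≤ B / (M * (1 - α / 2)) * t ^ (α / 2) * (∑ i, c i) ^ 2 := by
    intro t ht
    have ht : r ^ 2 < t := ht
    have ht0 : 0 < t := (sq_nonneg r).trans_lt ht
    have h : (∑ i, ∑ j, c i * c j * |x i - x j| ^ α) *
        (M * (t ^ (1 - α / 2) - ((r ^ 2 + t) / 2) ^ (1 - α / 2)))
        ≤ (∑ i, c i) ^ 2 * (B * (t - (r ^ 2 + t) / 2)) :=
      sum_mul_rpow_abs_sub_mul_le hα hα2 x c hc (t₀ := (r ^ 2 + t) / 2) (t₁ := t)
      (by positivity) (by linarith) fun i => by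
        have := pow_le_pow_left₀ (abs_nonneg (x i)) (hx i) 2
        rw [sq_abs] at this
        linarith
    have h2 := mul_rpow_sub_one_mul_sub_le (t₀ := (r ^ 2 + t) / 2) hp (by linarith) (by positivity) ht0
    have hd : 0 < t - (r ^ 2 + t) / 2 := by linarith
    set δ := t ^ (1 - α / 2) - ((r ^ 2 + t) / 2) ^ (1 - α / 2)
    have hpw : 0 < t ^ (1 - α / 2 - 1) := Real.rpow_pos_of_pos ht0 _
    have hδ : 0 < δ := (by positivity : (0 : ℝ) < _).trans_le h2
    have e : t ^ (α / 2) * t ^ (1 - α / 2 - 1) = 1 := by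
      rw [← Real.rpow_add ht0]; ring_nf; simp
    rw [← le_div_iff₀ (by positivity)] at h
    refine h.trans ?_
    rw [div_le_iff₀ (by positivity)]
    calc _ = (∑ i, c i) ^ 2 * B / (1 - α / 2) * t ^ (α / 2) *
          ((1 - α / 2) * t ^ (1 - α / 2 - 1) * (t - (r ^ 2 + t) / 2)) := by
          have : (∑ i, c i) ^ 2 * B / (1 - α / 2) * t ^ (α / 2) *
            ((1 - α / 2) * t ^ (1 - α / 2 - 1) * (t - (r ^ 2 + t) / 2))
            = (∑ i, c i) ^ 2 * (B * (t - (r ^ 2 + t) / 2)) * (t ^ (α / 2) * t ^ (1 - α / 2 - 1)) := by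
              field_simp
          rw [this, e, mul_one]
      _ ≤ (∑ i, c i) ^ 2 * B / (1 - α / 2) * t ^ (α / 2) * δ := by gcongr
      _ = _ := by field_simp
  have e : (r ^ 2) ^ (α / 2) = r ^ α := by
    rw [← Real.rpow_natCast, ← Real.rpow_mul hr]
    congr 1
    push_cast
    ring
  rw [← e]
  have hcont : ContinuousAt (fun t : ℝ => B / (M * (1 - α / 2)) * t ^ (α / 2) * (∑ i, c i) ^ 2) (r ^ 2) :=
    ((Real.continuousAt_rpow_const _ _ (Or.inr (by linarith))).const_mul _).mul_const _
  exact ge_of_tendsto (hcont.tendsto.mono_left nhdsWithin_le_nhds)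
    (eventually_nhdsWithin_of_forall hbound)

end LineBound

section Slicing

variable {n : ℕ}

theorem exists_measurableEquiv_inner_prod (v : EuclideanSpace ℝ (Fin (n + 1))) (hv : ‖v‖ = 1) :
    ∃ Φ : EuclideanSpace ℝ (Fin (n + 1)) ≃ᵐ ℝ × (Fin n → ℝ), MeasurePreserving Φ volume volume ∧
      (∀ x, (Φ x).1 = inner ℝ v x) ∧ ∀ x, ‖x‖ ^ 2 = (Φ x).1 ^ 2 + ∑ i, (Φ x).2 i ^ 2 := by
  have hon : Orthonormal ℝ (({0} : Set (Fin (n + 1))).domRestrict fun _ => v) := by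
    refine ⟨fun _ => hv, fun i j hij => ?_⟩
    exact absurd (Subsingleton.elim i j) hij
  obtain ⟨b, hb⟩ := hon.exists_orthonormalBasis_extension_of_card_eq (by simp)
  have hb0 : b 0 = v := hb 0 rfl
  have m1 := b.measurePreserving_repr
  have m2 := PiLp.volume_preserving_ofLp (Fin (n + 1))
  have m3 := volume_preserving_piFinSuccAbove (fun _ : Fin (n + 1) => ℝ) 0
  let Φ := (b.measurableEquiv.trans (MeasurableEquiv.toLp 2 (Fin (n + 1) → ℝ)).symm).trans
    (MeasurableEquiv.piFinSuccAbove (fun _ : Fin (n + 1) => ℝ) 0)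
  have h1 : ∀ x, (Φ x).1 = b.repr x 0 := fun x => rfl
  have h2 : ∀ x i, (Φ x).2 i = b.repr x i.succ := fun x i => rfl
  refine ⟨Φ, (m3.comp m2).comp m1, fun x => ?_, fun x => ?_⟩
  · rw [h1, b.repr_apply_apply, hb0]
  · rw [← b.repr.norm_map x, EuclideanSpace.norm_sq_eq, Fin.sum_univ_succ, h1]
    simp [h2]

theorem integral_rpow_norm_mul_exp_neg_sq {q : ℝ} (hq : -1 < q) :
    ∫ θ : EuclideanSpace ℝ (Fin (n + 1)), ‖θ‖ ^ q * Real.exp (-‖θ‖ ^ 2)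
      = (n + 1) * volume.real (Metric.ball (0 : EuclideanSpace ℝ (Fin (n + 1))) 1)
        * (1 / 2 * Real.Gamma ((n + 1 + q) / 2)) := by
  have h := integral_fun_norm_addHaar (volume : Measure (EuclideanSpace ℝ (Fin (n + 1))))
    (fun y => y ^ q * Real.exp (-y ^ 2))
  have h2 : ∫ y in Ioi (0 : ℝ), y ^ (Module.finrank ℝ (EuclideanSpace ℝ (Fin (n + 1))) - 1)
      • (y ^ q * Real.exp (-y ^ 2)) = 1 / 2 * Real.Gamma ((n + 1 + q) / 2) := by
    have h3 := integral_rpow_mul_exp_neg_rpow (p := 2) (q := n + q) (by norm_num)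
      (by have : (0 : ℝ) ≤ n := n.cast_nonneg
          linarith)
    rw [show (n : ℝ) + 1 + q = n + q + 1 by ring, ← h3]
    refine setIntegral_congr_fun measurableSet_Ioi fun y hy => ?_
    have hy : 0 < y := hy
    simp [Real.rpow_add hy, mul_assoc]
  rw [h, h2]
  simp
  ring

theorem real_volume_ball_pos :
    0 < volume.real (Metric.ball (0 : EuclideanSpace ℝ (Fin (n + 1))) 1) :=
  ENNReal.toReal_pos (Metric.measure_ball_pos volume _ one_pos).ne' measure_ball_lt_top.ne

theorem integrable_rpow_norm_mul_exp_neg_sq {q : ℝ} (hq : -1 < q) :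
    Integrable fun θ : EuclideanSpace ℝ (Fin (n + 1)) => ‖θ‖ ^ q * Real.exp (-‖θ‖ ^ 2) := by
  refine Integrable.of_integral_ne_zero ?_
  rw [integral_rpow_norm_mul_exp_neg_sq hq]
  have := real_volume_ball_pos (n := n)
  have := Real.Gamma_pos_of_pos (show 0 < (n + 1 + q) / 2 by
    have : (0 : ℝ) ≤ n := n.cast_nonneg
    linarith)
  positivity

theorem integral_exp_neg_norm_sq_pos :
    0 < ∫ θ : EuclideanSpace ℝ (Fin (n + 1)), Real.exp (-‖θ‖ ^ 2) := by
  have h := integral_rpow_norm_mul_exp_neg_sq (n := n) (q := 0) (by norm_num)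
  simp only [Real.rpow_zero, one_mul, add_zero] at h
  rw [h]
  have := real_volume_ball_pos (n := n)
  have := Real.Gamma_pos_of_pos (show (0 : ℝ) < (n + 1) / 2 by positivity)
  positivity

theorem integral_rpow_norm_mul_exp_neg_sq_eq {α : ℝ} (hα : 0 < α) :
    ∫ θ : EuclideanSpace ℝ (Fin (n + 1)), ‖θ‖ ^ α * Real.exp (-‖θ‖ ^ 2)
      = Real.Gamma ((n + 1 + α) / 2) / Real.Gamma ((n + 1) / 2)
        * ∫ θ : EuclideanSpace ℝ (Fin (n + 1)), Real.exp (-‖θ‖ ^ 2) := by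
  have h := integral_rpow_norm_mul_exp_neg_sq (n := n) (q := 0) (by norm_num)
  simp only [Real.rpow_zero, one_mul, add_zero] at h
  rw [h, integral_rpow_norm_mul_exp_neg_sq (by linarith)]
  have := (Real.Gamma_pos_of_pos (show (0 : ℝ) < (n + 1) / 2 by positivity)).ne'
  field_simp

theorem integral_rpow_abs_mul_exp_neg_sq {q : ℝ} (hq : -1 < q) :
    ∫ u : ℝ, |u| ^ q * Real.exp (-u ^ 2) = Real.Gamma ((1 + q) / 2) := by
  have h := integral_comp_abs (f := fun u : ℝ => u ^ q * Real.exp (-u ^ 2))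
  simp only [sq_abs] at h
  rw [h, add_comm 1 q]
  have h3 := integral_rpow_mul_exp_neg_rpow (p := 2) (q := q) (by norm_num) hq
  simp only [Real.rpow_two] at h3
  rw [h3]
  ring

theorem integral_rpow_abs_inner_mul_exp_neg_sq {α : ℝ} (hα : 0 < α)
    (v : EuclideanSpace ℝ (Fin (n + 1))) :
    ∫ θ : EuclideanSpace ℝ (Fin (n + 1)), |inner ℝ v θ| ^ α * Real.exp (-‖θ‖ ^ 2)
      = Real.Gamma ((1 + α) / 2) / Real.Gamma (1 / 2) * ‖v‖ ^ α
        * ∫ θ : EuclideanSpace ℝ (Fin (n + 1)), Real.exp (-‖θ‖ ^ 2) := by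
  rcases eq_or_ne v 0 with rfl | hv
  · simp [Real.zero_rpow hα.ne']
  have hv0 : 0 < ‖v‖ := norm_pos_iff.2 hv
  obtain ⟨Φ, hΦ, h1, h2⟩ := exists_measurableEquiv_inner_prod (‖v‖⁻¹ • v) (by
    rw [norm_smul, norm_inv, norm_norm, inv_mul_cancel₀ hv0.ne'])
  have key : ∀ q : ℝ, ∫ θ, |(Φ θ).1| ^ q * Real.exp (-‖θ‖ ^ 2)
      = (∫ u : ℝ, |u| ^ q * Real.exp (-u ^ 2)) * ∫ y : Fin n → ℝ, Real.exp (-∑ i, y i ^ 2) := by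
    intro q
    rw [← integral_prod_mul (μ := volume) (ν := volume), ← Measure.volume_eq_prod,
      ← hΦ.integral_comp']
    refine integral_congr_ae (ae_of_all _ fun θ => ?_)
    simp only
    rw [h2, neg_add, Real.exp_add, mul_assoc]
  have k0 := key 0
  have kα := key α
  simp only [Real.rpow_zero, one_mul] at k0
  have g0 := integral_rpow_abs_mul_exp_neg_sq (q := 0) (by norm_num)
  simp only [Real.rpow_zero, one_mul, add_zero] at g0
  rw [k0, g0]
  rw [integral_rpow_abs_mul_exp_neg_sq (by linarith)] at kα
  have e : ∀ θ, |inner ℝ v θ| ^ α * Real.exp (-‖θ‖ ^ 2)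
      = ‖v‖ ^ α * (|(Φ θ).1| ^ α * Real.exp (-‖θ‖ ^ 2)) := by
    intro θ
    rw [h1, real_inner_smul_left, abs_mul, abs_of_pos (inv_pos.2 hv0),
      Real.mul_rpow (inv_pos.2 hv0).le (abs_nonneg _), Real.inv_rpow hv0.le]
    have := (Real.rpow_pos_of_pos hv0 α).ne'
    field_simp
  rw [integral_congr_ae (ae_of_all _ e), integral_const_mul, kα]
  have := (Real.Gamma_pos_of_pos (show (0 : ℝ) < 1 / 2 by norm_num)).ne'
  field_simp

theorem integrable_rpow_abs_inner_mul_exp_neg_sq {α : ℝ} (hα : 0 < α)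
    (v : EuclideanSpace ℝ (Fin (n + 1))) :
    Integrable fun θ : EuclideanSpace ℝ (Fin (n + 1)) =>
      |inner ℝ v θ| ^ α * Real.exp (-‖θ‖ ^ 2) := by
  refine ((integrable_rpow_norm_mul_exp_neg_sq (q := α) (by linarith)).const_mul (‖v‖ ^ α)).mono'
    ?_ (ae_of_all _ fun θ => ?_)
  · exact Continuous.aestronglyMeasurable (((by fun_prop : Continuous fun θ => |inner ℝ v θ|).rpow_const
      fun _ => Or.inr hα.le).mul (by fun_prop))
  · rw [Real.norm_of_nonneg (by positivity), ← mul_assoc, ← Real.mul_rpow (norm_nonneg _) (norm_nonneg _)]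
    gcongr
    exact abs_real_inner_le_norm v θ

end Slicing

theorem sum_mul_rpow_norm_sub_le {n : ℕ} {α R : ℝ} (hα : 0 < α) (hα2 : α < 2) (hR : 0 ≤ R) {m : ℕ}
    (x : Fin m → EuclideanSpace ℝ (Fin (n + 1))) (hx : ∀ i, ‖x i‖ ≤ R) (c : Fin m → ℝ) :
    ∑ i, ∑ j, c i * c j * ‖x i - x j‖ ^ α
      ≤ Real.Gamma ((2 - α) / 2) * (Real.Gamma ((n + 1 + α) / 2) / Real.Gamma ((n + 1) / 2)) * R ^ α
        * (∑ i, c i) ^ 2 := by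
  set J := ∫ θ : EuclideanSpace ℝ (Fin (n + 1)), Real.exp (-‖θ‖ ^ 2) with hJ
  have hJ0 : 0 < J := integral_exp_neg_norm_sq_pos
  set ρ := Real.Gamma ((1 + α) / 2) / Real.Gamma (1 / 2) with hρ
  have hρ0 : 0 < ρ := div_pos (Real.Gamma_pos_of_pos (by linarith)) (Real.Gamma_pos_of_pos (by norm_num))
  have hint := fun i j => (integrable_rpow_abs_inner_mul_exp_neg_sq hα (x i - x j)).const_mul (c i * c j)
  have e1 : (∑ i, ∑ j, c i * c j * ‖x i - x j‖ ^ α) * (ρ * J)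
      = ∫ θ, ∑ i, ∑ j, c i * c j * (|inner ℝ (x i - x j) θ| ^ α * Real.exp (-‖θ‖ ^ 2)) := by
    rw [integral_finsetSum _ fun i _ => integrable_finsetSum _ fun j _ => hint i j, Finset.sum_mul]
    refine Finset.sum_congr rfl fun i _ => ?_
    rw [integral_finsetSum _ fun j _ => hint i j, Finset.sum_mul]
    refine Finset.sum_congr rfl fun j _ => ?_
    rw [integral_const_mul, integral_rpow_abs_inner_mul_exp_neg_sq hα]
    ring
  have e2 : ∫ θ, ∑ i, ∑ j, c i * c j * (|inner ℝ (x i - x j) θ| ^ α * Real.exp (-‖θ‖ ^ 2))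
      ≤ ∫ θ : EuclideanSpace ℝ (Fin (n + 1)), (Real.Gamma ((2 - α) / 2) * ρ * R ^ α * (∑ i, c i) ^ 2)
        * (‖θ‖ ^ α * Real.exp (-‖θ‖ ^ 2)) := by
    refine integral_mono (integrable_finsetSum _ fun i _ => integrable_finsetSum _ fun j _ => hint i j)
      ((integrable_rpow_norm_mul_exp_neg_sq (by linarith)).const_mul _) fun θ => ?_
    have h := sum_mul_rpow_abs_sub_le hα hα2 (fun i => inner ℝ (x i) θ) c
      (r := R * ‖θ‖) (by positivity) fun i =>
        (abs_real_inner_le_norm _ _).trans (mul_le_mul_of_nonneg_right (hx i) (norm_nonneg _))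
    rw [Real.mul_rpow hR (norm_nonneg _)] at h
    calc _ = (∑ i, ∑ j, c i * c j * |inner ℝ (x i) θ - inner ℝ (x j) θ| ^ α) * Real.exp (-‖θ‖ ^ 2) := by
          simp_rw [Finset.sum_mul, inner_sub_left, mul_assoc]
      _ ≤ _ := mul_le_mul_of_nonneg_right h (Real.exp_pos _).le
      _ = _ := by ring
  rw [integral_const_mul, integral_rpow_norm_mul_exp_neg_sq_eq hα, ← e1, ← hJ] at e2
  refine le_of_mul_le_mul_right (e2.trans (le_of_eq ?_)) (mul_pos hρ0 hJ0)
  ring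

section Projection

variable {α β b s : ℝ} {n : ℕ}

theorem continuous_bump (hb : 0 < b) : Continuous (bump b s) := by
  have : bump b s = fun u => (max (s - u ^ 2) 0) ^ b := by
    ext u
    rcases lt_or_ge (u ^ 2) s with h | h
    · rw [bump_of_lt h, max_eq_left (by linarith)]
    · rw [bump_of_le h, max_eq_right (by linarith), Real.zero_rpow hb.ne']
  rw [this]
  exact (by fun_prop : Continuous fun u : ℝ => max (s - u ^ 2) 0).rpow_const fun _ => Or.inr hb.le

/-- A linear combination of the profiles `bump β (t j)`. -/
noncomputable def bumpSum {ι : Type} [Fintype ι] (β : ℝ) (w t : ι → ℝ) (u : ℝ) : ℝ :=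
  ∑ j, w j * bump β (t j) u

section BumpSum

variable {ι : Type} [Fintype ι] {w t : ι → ℝ} {R : ℝ}

theorem continuous_bumpSum (hb : 0 < b) : Continuous (bumpSum b w t) :=
  continuous_finsetSum _ fun _ _ => (continuous_bump hb).const_mul _

theorem integrable_bumpSum (hβ : -1 < β) : Integrable (bumpSum β w t) :=
  integrable_finsetSum _ fun j _ => (integrable_bump hβ (t j)).const_mul _

theorem bumpSum_of_lt (hR : 0 ≤ R) (ht : ∀ j, t j ≤ R ^ 2) {u : ℝ} (hu : R < |u|) :
    bumpSum β w t u = 0 :=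
  Finset.sum_eq_zero fun j _ => by
    rw [bump_of_notMem_Icc (ht j) hR fun h => (abs_le.2 h).not_gt hu, mul_zero]

theorem bumpSum_of_notMem_Icc (hR : 0 ≤ R) (ht : ∀ j, t j ≤ R ^ 2) :
    ∀ u ∉ Icc (-R) R, bumpSum β w t u = 0 := fun _ hu =>
  bumpSum_of_lt hR ht (not_le.1 fun h => hu (abs_le.1 h))

theorem bumpSum_norm_of_notMem_closedBall {X : Type*} [SeminormedAddCommGroup X] (hR : 0 ≤ R)
    (ht : ∀ j, t j ≤ R ^ 2) : ∀ x ∉ Metric.closedBall (0 : X) R, bumpSum β w t ‖x‖ = 0 :=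
  fun x hx => bumpSum_of_lt hR ht (by simpa using hx)

theorem integrable_bumpSum_norm (hb : 0 < b) (hR : 0 ≤ R) (ht : ∀ j, t j ≤ R ^ 2) :
    Integrable fun x : EuclideanSpace ℝ (Fin n) => bumpSum b w t ‖x‖ :=
  ((continuous_bumpSum hb).comp continuous_norm).integrable_of_hasCompactSupport
    (HasCompactSupport.intro (isCompact_closedBall 0 R) (bumpSum_norm_of_notMem_closedBall hR ht))

end BumpSum

/-- The mass of the profile `(1 - ‖y‖ ^ 2)₊ ^ b` on `ℝ ^ n`. -/
noncomputable def sliceMass (n : ℕ) (b : ℝ) : ℝ :=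
  ∫ y : Fin n → ℝ, bump b 1 √(∑ i, y i ^ 2)

theorem integral_bump_sqrt_sum_sq (n : ℕ) (b s u : ℝ) :
    ∫ y : Fin n → ℝ, bump b (s - u ^ 2) √(∑ i, y i ^ 2) = sliceMass n b * bump (b + n / 2) s u := by
  rcases lt_or_ge (u ^ 2) s with hu | hu
  · have hτ : 0 < s - u ^ 2 := by linarith
    have hτ' : 0 < √(s - u ^ 2) := Real.sqrt_pos.2 hτ
    have h := Measure.integral_comp_smul (volume : Measure (Fin n → ℝ))
      (fun y => bump b (s - u ^ 2) √(∑ i, y i ^ 2)) (√(s - u ^ 2))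
    have e : ∀ y : Fin n → ℝ, bump b (s - u ^ 2) √(∑ i, (√(s - u ^ 2) • y) i ^ 2)
        = (s - u ^ 2) ^ b * bump b 1 √(∑ i, y i ^ 2) := by
      intro y
      rw [← bump_sqrt_mul hτ]
      congr 1
      simp only [Pi.smul_apply, smul_eq_mul, mul_pow]
      rw [← Finset.mul_sum, Real.sqrt_mul (sq_nonneg _), Real.sqrt_sq hτ'.le]
    rw [integral_congr_ae (ae_of_all _ e), integral_const_mul, abs_of_pos (by positivity),
      smul_eq_mul, eq_inv_mul_iff_mul_eq₀ (by positivity)] at h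
    rw [← h, bump_of_lt hu, Real.rpow_add hτ, Real.sqrt_eq_rpow, ← Real.rpow_mul_natCast hτ.le,
      sliceMass]
    simp only [Module.finrank_fintype_fun_eq_card, Fintype.card_fin]
    rw [one_div_mul_eq_div]
    ring
  · rw [bump_of_le hu, mul_zero]
    refine integral_eq_zero_of_ae (ae_of_all _ fun y => bump_of_le ?_)
    linarith [sq_nonneg √(∑ i, y i ^ 2)]

theorem integral_inner_mul_bump_norm (hb : 0 < b) {φ : ℝ → ℝ} (hφ : Continuous φ)
    {v : EuclideanSpace ℝ (Fin (n + 1))} (hv : ‖v‖ = 1) (s : ℝ) :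
    ∫ x : EuclideanSpace ℝ (Fin (n + 1)), φ (inner ℝ v x) * bump b s ‖x‖
      = sliceMass n b * ∫ u, φ u * bump (b + n / 2) s u := by
  obtain ⟨Φ, hΦ, h1, h2⟩ := exists_measurableEquiv_inner_prod v hv
  let g : ℝ × (Fin n → ℝ) → ℝ := fun z => φ z.1 * bump b (s - z.1 ^ 2) √(∑ i, z.2 i ^ 2)
  have hg : ∀ x, g (Φ x) = φ (inner ℝ v x) * bump b s ‖x‖ := by
    intro x
    have hs : √(∑ i, (Φ x).2 i ^ 2) ^ 2 = ∑ i, (Φ x).2 i ^ 2 :=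
      Real.sq_sqrt (Finset.sum_nonneg fun i _ => sq_nonneg _)
    simp only [g, bump, hs, h2, h1, lt_sub_iff_add_lt', sub_sub]
  have hc : Continuous fun x : EuclideanSpace ℝ (Fin (n + 1)) => φ (inner ℝ v x) * bump b s ‖x‖ :=
    (by fun_prop : Continuous fun x => φ (inner ℝ v x)).mul ((continuous_bump hb).comp continuous_norm)
  have hi : Integrable fun x => φ (inner ℝ v x) * bump b s ‖x‖ := by
    refine hc.integrable_of_hasCompactSupport
      (HasCompactSupport.intro (isCompact_closedBall 0 √(max 0 s)) fun x hx => ?_)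
    rw [bump_of_le, mul_zero]
    have hx : √(max 0 s) < ‖x‖ := by simpa using hx
    exact (le_max_right 0 s).trans (Real.lt_sq_of_sqrt_lt hx).le
  have hgi : Integrable g := by
    rw [← hΦ.integrable_comp_emb Φ.measurableEmbedding]
    exact hi.congr (ae_of_all _ fun x => (hg x).symm)
  rw [← integral_congr_ae (ae_of_all _ hg), hΦ.integral_comp', Measure.volume_eq_prod,
    integral_prod _ hgi, ← integral_const_mul]
  refine integral_congr_ae (ae_of_all _ fun u => ?_)
  simp only [g]
  rw [integral_const_mul, integral_bump_sqrt_sum_sq]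
  ring

theorem integral_inner_mul_bumpSum_norm {ι : Type} [Fintype ι] {w t : ι → ℝ} {R : ℝ} (hR : 0 ≤ R)
    (ht : ∀ j, t j ≤ R ^ 2) (hb : 0 < b) {φ : ℝ → ℝ} (hφ : Continuous φ)
    {v : EuclideanSpace ℝ (Fin (n + 1))} (hv : ‖v‖ = 1) :
    ∫ x : EuclideanSpace ℝ (Fin (n + 1)), φ (inner ℝ v x) * bumpSum b w t ‖x‖
      = sliceMass n b * ∫ u, φ u * bumpSum (b + n / 2) w t u := by
  have hb' : 0 < b + n / 2 := by positivity
  have hbump : ∀ j, ∀ u : ℝ, R < |u| → ∀ β, bump β (t j) u = 0 := fun j u hu β =>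
    bump_of_notMem_Icc (ht j) hR fun h => (abs_le.2 h).not_gt hu
  have i1 : ∀ j, Integrable fun x : EuclideanSpace ℝ (Fin (n + 1)) =>
      w j * (φ (inner ℝ v x) * bump b (t j) ‖x‖) := fun j => by
    refine Integrable.const_mul (Continuous.integrable_of_hasCompactSupport
      ((by fun_prop : Continuous fun x => φ (inner ℝ v x)).mul
        ((continuous_bump hb).comp continuous_norm))
      (HasCompactSupport.intro (isCompact_closedBall 0 R) fun x hx => ?_)) _
    have hx : R < ‖x‖ := by simpa using hx
    change φ (inner ℝ v x) * bump b (t j) ‖x‖ = 0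
    rw [hbump j _ (by simpa using hx), mul_zero]
  have i2 : ∀ j, Integrable fun u => w j * (φ u * bump (b + n / 2) (t j) u) := fun j => by
    refine Integrable.const_mul (integrable_continuous_mul_of_support_subset
      (isCompact_Icc (a := -R) (b := R)) hφ (integrable_bump (by linarith) _) fun u hu =>
        hbump j u (not_le.1 fun h => hu (abs_le.1 h)) _) _
  have e1 : ∀ x : EuclideanSpace ℝ (Fin (n + 1)), φ (inner ℝ v x) * bumpSum b w t ‖x‖
      = ∑ j, w j * (φ (inner ℝ v x) * bump b (t j) ‖x‖) := fun x => by
    rw [bumpSum, Finset.mul_sum]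
    exact Finset.sum_congr rfl fun j _ => mul_left_comm _ _ _
  have e2 : ∀ u, φ u * bumpSum (b + n / 2) w t u
      = ∑ j, w j * (φ u * bump (b + n / 2) (t j) u) := fun u => by
    rw [bumpSum, Finset.mul_sum]
    exact Finset.sum_congr rfl fun j _ => mul_left_comm _ _ _
  rw [integral_congr_ae (ae_of_all _ e1), integral_congr_ae (ae_of_all _ e2),
    integral_finsetSum _ fun j _ => i1 j, integral_finsetSum _ fun j _ => i2 j, Finset.mul_sum]
  refine Finset.sum_congr rfl fun j _ => ?_
  rw [integral_const_mul, integral_const_mul, integral_inner_mul_bump_norm hb hφ hv]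
  ring

theorem sliceMass_pos (hb : 0 < b) : 0 < sliceMass n b := by
  have hc : Continuous fun y : Fin n → ℝ => bump b 1 √(∑ i, y i ^ 2) :=
    (continuous_bump hb).comp (by fun_prop)
  refine hc.integral_pos_of_hasCompactSupport_nonneg_nonzero
    (HasCompactSupport.intro (isCompact_closedBall 0 1) fun y hy => bump_of_le ?_)
    (fun y => bump_nonneg) (x := 0) ?_
  · rw [Real.sq_sqrt (Finset.sum_nonneg fun i _ => sq_nonneg _)]
    by_contra! h
    refine hy (mem_closedBall_zero_iff.2 ((pi_norm_le_iff_of_nonneg zero_le_one).2 fun i => ?_))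
    have := (Finset.single_le_sum (f := fun i => y i ^ 2) (fun i _ => sq_nonneg _)
      (Finset.mem_univ i)).trans h.le
    rw [Real.norm_eq_abs]
    exact (sq_le_one_iff_abs_le_one _).1 this
  · rw [bump_of_lt (by simp)]
    simp

end Projection

section EnergyTransfer

variable {α b R : ℝ} {n : ℕ} {ι : Type} [Fintype ι] {w t : ι → ℝ}

theorem integral_prod_rpow_abs_inner_sub_mul_bumpSum (hα : 0 < α) (hb : 0 < b) (hR : 0 ≤ R)
    (ht : ∀ j, t j ≤ R ^ 2) {v : EuclideanSpace ℝ (Fin (n + 1))} (hv : ‖v‖ = 1) :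
    ∫ z : EuclideanSpace ℝ (Fin (n + 1)) × EuclideanSpace ℝ (Fin (n + 1)),
        |inner ℝ (z.1 - z.2) v| ^ α * (bumpSum b w t ‖z.1‖ * bumpSum b w t ‖z.2‖)
      = sliceMass n b ^ 2 * rieszEnergy α (bumpSum (b + n / 2) w t) := by
  have hb' : 0 < b + n / 2 := by positivity
  set f := bumpSum (b + n / 2) w t with hf
  have hfc : Continuous f := continuous_bumpSum hb'
  have hfi : Integrable f := integrable_bumpSum (by linarith)
  have hfS : ∀ u ∉ Icc (-R) R, f u = 0 := bumpSum_of_notMem_Icc hR ht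
  have hFi := integrable_bumpSum_norm (n := n + 1) (w := w) hb hR ht
  have hFS : ∀ x ∉ Metric.closedBall (0 : EuclideanSpace ℝ (Fin (n + 1))) R,
    bumpSum b w t ‖x‖ = 0 := bumpSum_norm_of_notMem_closedBall hR ht
  have hφ : ∀ a : ℝ, Continuous fun u : ℝ => |a - u| ^ α := fun a =>
    (by fun_prop : Continuous fun u : ℝ => |a - u|).rpow_const fun _ => Or.inr hα.le
  let Ψ : ℝ → ℝ := fun a => ∫ u, |a - u| ^ α * f u
  have hΨ : Continuous Ψ := by
    have h : Continuous (Function.uncurry fun a u : ℝ => |a - u| ^ α * f u) :=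
      (continuous_rpow_norm_sub (X := ℝ) hα).mul (hfc.comp continuous_snd)
    have h2 := continuous_parametric_integral_of_continuous (μ := volume) h
      (isCompact_Icc (a := -R) (b := R))
    have e : Ψ = fun a => ∫ u in Icc (-R) R, |a - u| ^ α * f u := funext fun a =>
      (setIntegral_eq_integral_of_forall_compl_eq_zero fun u hu => by rw [hfS u hu, mul_zero]).symm
    rw [e]
    exact h2
  have hK : Continuous fun z : EuclideanSpace ℝ (Fin (n + 1)) × EuclideanSpace ℝ (Fin (n + 1)) =>
      |inner ℝ (z.1 - z.2) v| ^ α :=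
    (by fun_prop : Continuous fun z : EuclideanSpace ℝ (Fin (n + 1)) × EuclideanSpace ℝ (Fin (n + 1))
      => |inner ℝ (z.1 - z.2) v|).rpow_const fun _ => Or.inr hα.le
  have hi := integrable_continuous_mul_prod_of_support_subset (μ := volume)
    (isCompact_closedBall 0 R) hK hFi hFS hFi hFS
  have hi1 := integrable_continuous_mul_prod_of_support_subset (μ := volume)
    (isCompact_Icc (a := -R) (b := R)) (continuous_rpow_norm_sub (X := ℝ) hα) hfi hfS hfi hfS
  have e1 : rieszEnergy α f = ∫ u, Ψ u * f u := by
    rw [rieszEnergy, Measure.volume_eq_prod, integral_prod _ hi1]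
    refine integral_congr_ae (ae_of_all _ fun u => ?_)
    simp only [Ψ, Real.norm_eq_abs]
    rw [← integral_mul_const]
    exact integral_congr_ae (ae_of_all _ fun _ => by simp only; ring)
  rw [e1, Measure.volume_eq_prod, integral_prod _ hi, sq, mul_assoc,
    ← integral_inner_mul_bumpSum_norm hR ht hb hΨ hv, ← integral_const_mul]
  refine integral_congr_ae (ae_of_all _ fun x => ?_)
  simp only
  have e2 : ∀ y, |inner ℝ (x - y) v| ^ α * (bumpSum b w t ‖x‖ * bumpSum b w t ‖y‖)
      = bumpSum b w t ‖x‖ * ((fun u => |inner ℝ v x - u| ^ α) (inner ℝ v y) * bumpSum b w t ‖y‖) := by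
    intro y
    simp only
    rw [real_inner_comm, inner_sub_right]
    ring
  rw [integral_congr_ae (ae_of_all _ e2), integral_const_mul,
    integral_inner_mul_bumpSum_norm hR ht hb (hφ _) hv]
  simp only [Ψ, hf]
  ring

theorem rieszEnergy_bumpSum_norm (hα : 0 < α) (hb : 0 < b) (hR : 0 ≤ R) (ht : ∀ j, t j ≤ R ^ 2) :
    Real.Gamma ((1 + α) / 2) / Real.Gamma (1 / 2)
        * rieszEnergy α (fun x : EuclideanSpace ℝ (Fin (n + 1)) => bumpSum b w t ‖x‖)
      = Real.Gamma ((n + 1 + α) / 2) / Real.Gamma ((n + 1) / 2)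
        * (sliceMass n b ^ 2 * rieszEnergy α (bumpSum (b + n / 2) w t)) := by
  set J := ∫ θ : EuclideanSpace ℝ (Fin (n + 1)), Real.exp (-‖θ‖ ^ 2) with hJ
  have hJ0 : 0 < J := integral_exp_neg_norm_sq_pos
  set F : EuclideanSpace ℝ (Fin (n + 1)) → ℝ := fun x => bumpSum b w t ‖x‖ with hF
  have hFi : Integrable F := integrable_bumpSum_norm (n := n + 1) (w := w) hb hR ht
  have hFc : Continuous F := (continuous_bumpSum hb).comp continuous_norm
  have hFS : ∀ x ∉ Metric.closedBall (0 : EuclideanSpace ℝ (Fin (n + 1))) R,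
    F x = 0 := bumpSum_norm_of_notMem_closedBall hR ht
  have hdom : Integrable (fun p : (EuclideanSpace ℝ (Fin (n + 1)) × EuclideanSpace ℝ (Fin (n + 1)))
      × EuclideanSpace ℝ (Fin (n + 1)) => (‖p.1.1 - p.1.2‖ ^ α * (F p.1.1 * F p.1.2)) *
        (‖p.2‖ ^ α * Real.exp (-‖p.2‖ ^ 2))) (volume.prod volume) :=
    (integrable_continuous_mul_prod_of_support_subset (μ := volume) (isCompact_closedBall 0 R)
      (continuous_rpow_norm_sub hα) hFi hFS hFi hFS).mul_prod
      (integrable_rpow_norm_mul_exp_neg_sq (by linarith))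
  have hint : Integrable (Function.uncurry fun
      (z : EuclideanSpace ℝ (Fin (n + 1)) × EuclideanSpace ℝ (Fin (n + 1)))
      (θ : EuclideanSpace ℝ (Fin (n + 1))) =>
        (|inner ℝ (z.1 - z.2) θ| ^ α * Real.exp (-‖θ‖ ^ 2)) * (F z.1 * F z.2))
      (volume.prod volume) := by
    refine hdom.mono (Continuous.aestronglyMeasurable ?_) (ae_of_all _ fun p => ?_)
    · refine (((by fun_prop : Continuous fun p : (EuclideanSpace ℝ (Fin (n + 1)) ×
        EuclideanSpace ℝ (Fin (n + 1))) × EuclideanSpace ℝ (Fin (n + 1)) =>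
          |inner ℝ (p.1.1 - p.1.2) p.2|).rpow_const fun _ => Or.inr hα.le).mul ?_).mul ?_ <;> fun_prop
    · simp only [Function.uncurry, norm_mul]
      rw [Real.norm_of_nonneg (by positivity : 0 ≤ |inner ℝ (p.1.1 - p.1.2) p.2| ^ α),
        Real.norm_of_nonneg (by positivity : 0 ≤ ‖p.1.1 - p.1.2‖ ^ α),
        Real.norm_of_nonneg (by positivity : 0 ≤ ‖p.2‖ ^ α)]
      have h : |inner ℝ (p.1.1 - p.1.2) p.2| ^ α ≤ ‖p.1.1 - p.1.2‖ ^ α * ‖p.2‖ ^ α := by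
        rw [← Real.mul_rpow (norm_nonneg _) (norm_nonneg _)]
        exact Real.rpow_le_rpow (abs_nonneg _) (abs_real_inner_le_norm _ _) hα.le
      calc _ ≤ (‖p.1.1 - p.1.2‖ ^ α * ‖p.2‖ ^ α) * ‖Real.exp (-‖p.2‖ ^ 2)‖ * (‖F p.1.1‖ * ‖F p.1.2‖) := by
            gcongr
        _ = _ := by ring
  have hswap := integral_integral_swap hint
  have e1 : ∀ z : EuclideanSpace ℝ (Fin (n + 1)) × EuclideanSpace ℝ (Fin (n + 1)),
      ∫ θ, (|inner ℝ (z.1 - z.2) θ| ^ α * Real.exp (-‖θ‖ ^ 2)) * (F z.1 * F z.2)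
      = (Real.Gamma ((1 + α) / 2) / Real.Gamma (1 / 2) * J) * (‖z.1 - z.2‖ ^ α * (F z.1 * F z.2)) := by
    intro z
    rw [integral_mul_const, integral_rpow_abs_inner_mul_exp_neg_sq hα]
    ring
  have e2 : ∀ θ : EuclideanSpace ℝ (Fin (n + 1)),
      ∫ z : EuclideanSpace ℝ (Fin (n + 1)) × EuclideanSpace ℝ (Fin (n + 1)),
        (|inner ℝ (z.1 - z.2) θ| ^ α * Real.exp (-‖θ‖ ^ 2)) * (F z.1 * F z.2)
      = (sliceMass n b ^ 2 * rieszEnergy α (bumpSum (b + n / 2) w t))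
        * (‖θ‖ ^ α * Real.exp (-‖θ‖ ^ 2)) := by
    intro θ
    rcases eq_or_ne θ 0 with rfl | hθ
    · simp [Real.zero_rpow hα.ne']
    have hθ0 : 0 < ‖θ‖ := norm_pos_iff.2 hθ
    rw [← integral_prod_rpow_abs_inner_sub_mul_bumpSum hα hb hR ht (v := ‖θ‖⁻¹ • θ) (by
      rw [norm_smul, norm_inv, norm_norm, inv_mul_cancel₀ hθ0.ne']), ← integral_mul_const]
    refine integral_congr_ae (ae_of_all _ fun z => ?_)
    simp only
    rw [real_inner_smul_right, abs_mul, abs_of_pos (inv_pos.2 hθ0),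
      Real.mul_rpow (inv_pos.2 hθ0).le (abs_nonneg _), Real.inv_rpow hθ0.le]
    have := (Real.rpow_pos_of_pos hθ0 α).ne'
    field_simp
    simp only [hF]
  rw [integral_congr_ae (ae_of_all _ e1), integral_congr_ae (ae_of_all _ e2), integral_const_mul,
    integral_const_mul, integral_rpow_norm_mul_exp_neg_sq_eq hα, ← hJ] at hswap
  rw [rieszEnergy]
  refine mul_right_cancel₀ hJ0.ne' ?_
  linarith

/-- The energy bound implied by positive semidefiniteness, for radial densities of positive order. -/
theorem rieszEnergy_bumpSum_le_of_posSemidef (hα : 0 < α) (hb : 0 < b) (hR : 0 ≤ R) {A : ℝ}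
    (hpos : ∀ (m : ℕ) (x : Fin m → EuclideanSpace ℝ (Fin (n + 1))),
      (∀ i, x i ∈ Metric.closedBall (0 : EuclideanSpace ℝ (Fin (n + 1))) R) →
      ∀ c : Fin m → ℝ, 0 ≤ ∑ i, ∑ j, c i * c j * (A - ‖x i - x j‖ ^ α))
    (ht : ∀ j, t j ≤ R ^ 2) :
    Real.Gamma ((n + 1 + α) / 2) / Real.Gamma ((n + 1) / 2)
        * rieszEnergy α (bumpSum (b + n / 2) w t)
      ≤ A * (Real.Gamma ((1 + α) / 2) / Real.Gamma (1 / 2))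
        * (∫ u, bumpSum (b + n / 2) w t u) ^ 2 := by
  have hFi := integrable_bumpSum_norm (n := n + 1) (w := w) hb hR ht
  have hFS : ∀ x ∉ Metric.closedBall (0 : EuclideanSpace ℝ (Fin (n + 1))) R,
    bumpSum b w t ‖x‖ = 0 := bumpSum_norm_of_notMem_closedBall hR ht
  have hKc := continuous_rpow_norm_sub (X := EuclideanSpace ℝ (Fin (n + 1))) hα
  have h := integral_prod_nonneg_of_posSemidef (μ := volume) (isCompact_closedBall 0 R) hFi hFS
    (K := fun z => A - ‖z.1 - z.2‖ ^ α) (by fun_prop) hpos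
  have i1 : Integrable (fun z : EuclideanSpace ℝ (Fin (n + 1)) × EuclideanSpace ℝ (Fin (n + 1)) =>
    bumpSum b w t ‖z.1‖ * bumpSum b w t ‖z.2‖) (volume.prod volume) := hFi.mul_prod hFi
  have i2 := integrable_continuous_mul_prod_of_support_subset (μ := volume)
    (isCompact_closedBall 0 R) hKc hFi hFS hFi hFS
  simp only [sub_mul] at h
  rw [integral_sub (i1.const_mul _) i2, integral_const_mul,
    integral_prod_mul (fun x : EuclideanSpace ℝ (Fin (n + 1)) => bumpSum b w t ‖x‖)
      fun x : EuclideanSpace ℝ (Fin (n + 1)) => bumpSum b w t ‖x‖] at h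
  have hmass := integral_inner_mul_bumpSum_norm hR ht hb (w := w) (φ := fun _ => 1) continuous_const
    (v := EuclideanSpace.single (0 : Fin (n + 1)) (1 : ℝ)) (by simp)
  simp only [one_mul] at hmass
  have hE := rieszEnergy_bumpSum_norm (n := n) (w := w) hα hb hR ht
  rw [rieszEnergy, Measure.volume_eq_prod] at hE
  rw [hmass] at h
  have hc := sliceMass_pos (n := n) hb
  set ρ := Real.Gamma ((1 + α) / 2) / Real.Gamma (1 / 2) with hρ
  have hρ0 : 0 < ρ := div_pos (Real.Gamma_pos_of_pos (by linarith)) (Real.Gamma_pos_of_pos (by norm_num))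
  refine le_of_mul_le_mul_right ?_ (pow_pos hc 2)
  have h2 := mul_nonneg hρ0.le h
  rw [mul_sub, hE] at h2
  linarith

end EnergyTransfer

section Descent

variable {α β s h u R : ℝ}

theorem rpow_sub_rpow_sub_div_le {τ : ℝ} (hh : 0 < h) (hτ : h < τ) :
    (τ ^ β - (τ - h) ^ β) / h ≤ max 1 β * τ ^ (β - 1) := by
  have hτ0 : 0 < τ := hh.trans hτ
  have hx1 : h / τ < 1 := (div_lt_one hτ0).2 hτ
  have hx0 : 0 < h / τ := div_pos hh hτ0
  have key : 1 - max 1 β * (h / τ) ≤ (1 - h / τ) ^ β := by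
    rcases le_total 1 β with hb | hb
    · have := one_add_mul_self_le_rpow_one_add (s := -(h / τ)) (by linarith) hb
      rw [max_eq_right hb, sub_eq_add_neg 1 (h / τ)]
      linarith
    · rw [max_eq_left hb, one_mul]
      exact Real.self_le_rpow_of_le_one (by linarith) (by linarith) hb
  have e : τ - h = τ * (1 - h / τ) := by field_simp
  rw [e, Real.mul_rpow hτ0.le (by linarith), div_le_iff₀ hh, Real.rpow_sub_one hτ0.ne']
  have := mul_le_mul_of_nonneg_left key (Real.rpow_nonneg hτ0.le β)
  calc τ ^ β - τ ^ β * (1 - h / τ) ^ β ≤ τ ^ β - τ ^ β * (1 - max 1 β * (h / τ)) := by linarith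
    _ = _ := by ring

theorem abs_bump_sub_bump_div_le (hβ : 0 < β) (hh : 0 < h) :
    |(bump β s u - bump β (s - h) u) / h| ≤ max 1 β * bump (β - 1) s u := by
  rcases lt_or_ge (u ^ 2) s with hu | hu
  · have hτ : 0 < s - u ^ 2 := by linarith
    rcases lt_or_ge (u ^ 2) (s - h) with hu' | hu'
    · rw [bump_of_lt hu, bump_of_lt hu', bump_of_lt hu, abs_of_nonneg]
      · have := rpow_sub_rpow_sub_div_le (β := β) hh (τ := s - u ^ 2) (by linarith)
        rwa [sub_right_comm s (u ^ 2) h] at this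
      · exact div_nonneg (sub_nonneg.2 (Real.rpow_le_rpow (by linarith) (by linarith) hβ.le)) hh.le
    · rw [bump_of_lt hu, bump_of_le hu', bump_of_lt hu, sub_zero,
        abs_of_nonneg (by positivity), div_le_iff₀ hh, Real.rpow_sub_one hτ.ne']
      have h1 : (s - u ^ 2) ^ β = 1 * ((s - u ^ 2) ^ β / (s - u ^ 2)) * (s - u ^ 2) := by field_simp
      calc (s - u ^ 2) ^ β = 1 * ((s - u ^ 2) ^ β / (s - u ^ 2)) * (s - u ^ 2) := h1
        _ ≤ _ := by
          gcongr
          · exact le_max_left _ _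
          · linarith
  · rw [bump_of_le hu, bump_of_le (by linarith), bump_of_le hu]
    simp

theorem tendsto_bump_sub_bump_div :
    Tendsto (fun h => (bump β s u - bump β (s - h) u) / h) (𝓝[>] 0)
      (𝓝 (β * bump (β - 1) s u)) := by
  rcases lt_or_ge (u ^ 2) s with hu | hu
  · have hτ : 0 < s - u ^ 2 := by linarith
    have hd : HasDerivAt (fun h => -(s - u ^ 2 - h) ^ β) (β * (s - u ^ 2) ^ (β - 1)) 0 := by
      have := (((hasDerivAt_id (0 : ℝ)).const_sub (s - u ^ 2)).rpow_const (p := β)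
        (Or.inl (by simpa using hτ.ne'))).neg
      have e : -(-1 * β * (s - u ^ 2 - id 0) ^ (β - 1)) = β * (s - u ^ 2) ^ (β - 1) := by simp
      rw [e] at this
      exact this
    have ht := hd.tendsto_slope.mono_left
      (nhdsWithin_mono 0 fun h (hh : h ∈ Ioi (0 : ℝ)) => (ne_of_gt hh : h ≠ 0))
    rw [bump_of_lt hu (β := β - 1)]
    refine ht.congr' ?_
    filter_upwards [self_mem_nhdsWithin, nhdsWithin_le_nhds (Iio_mem_nhds hτ)] with h hh hh'
    have hh' : h < s - u ^ 2 := hh'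
    rw [bump_of_lt hu, bump_of_lt (by linarith), slope_def_field, sub_right_comm s h]
    simp only [sub_zero]
    ring
  · rw [bump_of_le hu (β := β - 1), mul_zero]
    refine tendsto_const_nhds.congr' ?_
    filter_upwards [self_mem_nhdsWithin] with h hh
    have hh : 0 < h := hh
    rw [bump_of_le hu, bump_of_le (by linarith)]
    simp

/-- Dominated convergence for the Riesz energy on an interval. -/
theorem tendsto_rieszEnergy {F : ℝ → ℝ → ℝ} {f g : ℝ → ℝ} {l : Filter ℝ}
    [l.IsCountablyGenerated] (hα : 0 < α) (hFm : ∀ h, AEStronglyMeasurable (F h))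
    (hg : Integrable g) (hgS : ∀ u ∉ Icc (-R) R, g u = 0)
    (hFg : ∀ᶠ h in l, ∀ u, |F h u| ≤ g u) (hF : ∀ u, Tendsto (F · u) l (𝓝 (f u))) :
    Tendsto (fun h => rieszEnergy α (F h)) l (𝓝 (rieszEnergy α f)) := by
  have hi := integrable_continuous_mul_prod_of_support_subset (μ := volume)
    (isCompact_Icc (a := -R) (b := R)) (continuous_rpow_norm_sub (X := ℝ) hα) hg hgS hg hgS
  refine tendsto_integral_filter_of_dominated_convergence _ (Eventually.of_forall fun h => ?_) ?_
    hi (ae_of_all _ fun z => ((hF z.1).mul (hF z.2)).const_mul _)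
  · exact (continuous_rpow_norm_sub (X := ℝ) hα).aestronglyMeasurable.mul
      ((hFm h).comp_fst.mul (hFm h).comp_snd)
  · filter_upwards [hFg] with h hh
    refine ae_of_all _ fun z => ?_
    have h0 : 0 ≤ g z.1 := (abs_nonneg _).trans (hh _)
    rw [norm_mul, norm_mul, Real.norm_of_nonneg (by positivity : 0 ≤ ‖z.1 - z.2‖ ^ α)]
    exact mul_le_mul_of_nonneg_left (mul_le_mul (hh _) (hh _) (abs_nonneg _) h0) (by positivity)

/-- The energy of every combination of profiles of order `β` supported in `[-R, R]` is at most
`A / κ` times the square of its mass. -/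
def BumpEnergyBound (α κ A R β : ℝ) : Prop :=
  ∀ (ι : Type) [Fintype ι] (w t : ι → ℝ), (∀ j, t j ≤ R ^ 2) →
    κ * rieszEnergy α (bumpSum β w t) ≤ A * (∫ u, bumpSum β w t u) ^ 2

theorem BumpEnergyBound.sub_one {κ A : ℝ} (hα : 0 < α) (hβ : 0 < β) (hR : 0 ≤ R)
    (H : BumpEnergyBound α κ A R β) : BumpEnergyBound α κ A R (β - 1) := by
  intro ι _ w t ht
  let W : ℝ → ι ⊕ ι → ℝ := fun h => Sum.elim (fun j => w j / h) fun j => -(w j / h)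
  let T : ℝ → ι ⊕ ι → ℝ := fun h => Sum.elim t fun j => t j - h
  let F : ℝ → ℝ → ℝ := fun h => bumpSum β (W h) (T h)
  let f : ℝ → ℝ := fun u => β * bumpSum (β - 1) w t u
  let g : ℝ → ℝ := bumpSum (β - 1) (fun j => |w j| * max 1 β) t
  have hFe : ∀ h u, F h u = ∑ j, w j * ((bump β (t j) u - bump β (t j - h) u) / h) := by
    intro h u
    simp only [F, W, T, bumpSum, Fintype.sum_sum_type, Sum.elim_inl, Sum.elim_inr]
    rw [← Finset.sum_add_distrib]
    exact Finset.sum_congr rfl fun j _ => by ring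
  have hF : ∀ u, Tendsto (F · u) (𝓝[>] 0) (𝓝 (f u)) := by
    intro u
    simp only [hFe, f, bumpSum, Finset.mul_sum]
    refine tendsto_finsetSum _ fun j _ => ?_
    rw [mul_left_comm]
    exact tendsto_bump_sub_bump_div.const_mul _
  have hFg : ∀ᶠ h in 𝓝[>] (0 : ℝ), ∀ u, |F h u| ≤ g u := by
    filter_upwards [self_mem_nhdsWithin] with h hh u
    rw [hFe]
    refine (Finset.abs_sum_le_sum_abs _ _).trans (Finset.sum_le_sum fun j _ => ?_)
    rw [abs_mul, mul_assoc]
    exact mul_le_mul_of_nonneg_left (abs_bump_sub_bump_div_le hβ hh) (abs_nonneg _)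
  have hg : Integrable g := integrable_bumpSum (by linarith)
  have hFm : ∀ h, AEStronglyMeasurable (F h) := fun h =>
    (continuous_bumpSum hβ).aestronglyMeasurable
  have hE := tendsto_rieszEnergy hα hFm hg (bumpSum_of_notMem_Icc hR ht) hFg hF
  have hM : Tendsto (fun h => ∫ u, F h u) (𝓝[>] 0) (𝓝 (∫ u, f u)) :=
    tendsto_integral_filter_of_dominated_convergence g (Eventually.of_forall hFm)
      (hFg.mono fun h hh => ae_of_all _ hh) hg (ae_of_all _ hF)
  have hle := le_of_tendsto_of_tendsto (hE.const_mul κ) ((hM.pow 2).const_mul A) (by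
    filter_upwards [self_mem_nhdsWithin] with h hh
    refine H _ (W h) (T h) ?_
    rintro (j | j)
    · exact ht j
    · have hh : 0 < h := hh
      exact (sub_le_self _ hh.le).trans (ht j))
  have e1 : rieszEnergy α f = β ^ 2 * rieszEnergy α (bumpSum (β - 1) w t) := by
    rw [rieszEnergy, rieszEnergy, ← integral_const_mul]
    exact integral_congr_ae (ae_of_all _ fun z => by simp only [f]; ring)
  have e2 : ∫ u, f u = β * ∫ u, bumpSum (β - 1) w t u := integral_const_mul _ _
  rw [e1, e2] at hle
  refine le_of_mul_le_mul_left ?_ (pow_pos hβ 2)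
  linarith

theorem BumpEnergyBound.of_add_natCast {κ A : ℝ} (hα : 0 < α) (hβ : -1 < β) (hR : 0 ≤ R) :
    ∀ k : ℕ, BumpEnergyBound α κ A R (β + k) → BumpEnergyBound α κ A R β
  | 0, H => by simpa using H
  | k + 1, H => by
    refine of_add_natCast hα hβ hR k ?_
    have hk : (0 : ℝ) ≤ k := k.cast_nonneg
    have := H.sub_one hα (by push_cast; linarith) hR
    rwa [Nat.cast_succ, ← add_assoc, add_sub_cancel_right] at this

end Descent

section Necessity

variable {α κ A R : ℝ}

theorem BumpEnergyBound.le_of_lt (hα : 0 < α) (hα2 : α < 2) (hκ : 0 < κ)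
    (H : BumpEnergyBound α κ A R ((1 - α) / 2)) {t₀ : ℝ} (h0 : 0 < t₀) (h : t₀ < R ^ 2) :
    κ * beta ((α + 1) / 2) ((3 - α) / 2)
      ≤ A * (beta (1 / 2) ((3 - α) / 2) * (1 - α / 2)) * t₀ ^ (-(α / 2)) := by
  have hB0 : 0 < beta ((α + 1) / 2) ((3 - α) / 2) := beta_pos (by linarith) (by linarith)
  have hM0 : 0 < beta (1 / 2) ((3 - α) / 2) := beta_pos (by norm_num) (by linarith)
  have hp : 0 < 1 - α / 2 := by linarith
  have h1 : 0 < R ^ 2 := h0.trans h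
  have hle := H (Fin 2) ![1, -1] ![R ^ 2, t₀] (by
    intro j
    fin_cases j
    · exact le_rfl
    · exact h.le)
  have e : bumpSum ((1 - α) / 2) ![1, -1] ![R ^ 2, t₀]
      = fun u => bump ((1 - α) / 2) (R ^ 2) u - bump ((1 - α) / 2) t₀ u := by
    ext u
    simp [bumpSum, Fin.sum_univ_two, sub_eq_add_neg]
  rw [e, integral_bump_sub_bump hα2 h0 h1] at hle
  have hE := mul_le_mul_of_nonneg_left (le_rieszEnergy_bump_sub_bump hα hα2 h0 h.le) hκ.le
  set Δ := (R ^ 2) ^ (1 - α / 2) - t₀ ^ (1 - α / 2) with hΔ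
  set B := beta ((α + 1) / 2) ((3 - α) / 2)
  set M := beta (1 / 2) ((3 - α) / 2)
  have hΔ0 : 0 < Δ := sub_pos.2 (Real.rpow_lt_rpow h0.le h hp)
  have hd : 0 < R ^ 2 - t₀ := by linarith
  have h3 : κ * B * (R ^ 2 - t₀) ≤ A * M * Δ := by
    refine le_of_mul_le_mul_right ?_ (mul_pos hM0 hΔ0)
    linarith [hE.trans hle]
  have hA : 0 < A * M := by
    refine pos_of_mul_pos_left (lt_of_lt_of_le ?_ h3) hΔ0.le
    positivity
  have h4 := mul_rpow_sub_one_mul_sub_le hp (by linarith) h1.le h0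
  have h5 : Δ ≤ (1 - α / 2) * t₀ ^ (-(α / 2)) * (R ^ 2 - t₀) := by
    rw [show 1 - α / 2 - 1 = -(α / 2) by ring] at h4
    linarith
  refine le_of_mul_le_mul_right ?_ hd
  calc κ * B * (R ^ 2 - t₀) ≤ A * M * Δ := h3
    _ ≤ A * M * ((1 - α / 2) * t₀ ^ (-(α / 2)) * (R ^ 2 - t₀)) := by gcongr
    _ = _ := by ring

theorem BumpEnergyBound.mul_rpow_le (hα : 0 < α) (hα2 : α < 2) (hκ : 0 < κ) (hR : 0 < R)
    (H : BumpEnergyBound α κ A R ((1 - α) / 2)) :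
    Real.Gamma ((2 - α) / 2) * (Real.Gamma ((1 + α) / 2) / Real.Gamma (1 / 2)) * κ * R ^ α
      ≤ A := by
  have hM0 : 0 < beta (1 / 2) ((3 - α) / 2) := beta_pos (by norm_num) (by linarith)
  have hp : 0 < 1 - α / 2 := by linarith
  have h1 : 0 < R ^ 2 := by positivity
  have hc : ContinuousAt (fun t₀ : ℝ => A * (beta (1 / 2) ((3 - α) / 2) * (1 - α / 2)) *
      t₀ ^ (-(α / 2))) (R ^ 2) :=
    (Real.continuousAt_rpow_const _ _ (Or.inl h1.ne')).const_mul _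
  have hle := ge_of_tendsto (hc.tendsto.mono_left (nhdsWithin_le_nhds (s := Iio (R ^ 2)))) (by
    filter_upwards [self_mem_nhdsWithin, nhdsWithin_le_nhds (Ioi_mem_nhds h1)] with t ht ht'
    exact H.le_of_lt hα hα2 hκ ht' ht)
  have e : (R ^ 2) ^ (-(α / 2)) = (R ^ α)⁻¹ := by
    rw [← Real.rpow_natCast, ← Real.rpow_mul hR.le, ← Real.rpow_neg hR.le]
    congr 1
    push_cast
    ring
  have hRα : 0 < R ^ α := Real.rpow_pos_of_pos hR α
  rw [e, ← div_eq_mul_inv, le_div_iff₀ hRα] at hle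
  rw [← beta_div_mul_beta hα hα2, div_mul_eq_mul_div, div_mul_eq_mul_div,
    div_le_iff₀ (mul_pos hM0 hp)]
  linarith

/-- A kernel `A - ‖x - y‖ ^ α` that is positive semidefinite on the ball of radius `R` has
`A ≥ Γ((2 - α) / 2) Γ((d + α) / 2) / Γ(d / 2) * R ^ α`, where `d = n + 1`. -/
theorem le_of_posSemidef_sub_rpow_norm_sub {n : ℕ} (hα : 0 < α) (hα2 : α < 2) (hR : 0 < R)
    (hpos : ∀ (m : ℕ) (x : Fin m → EuclideanSpace ℝ (Fin (n + 1))),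
      (∀ i, x i ∈ Metric.closedBall (0 : EuclideanSpace ℝ (Fin (n + 1))) R) →
      ∀ c : Fin m → ℝ, 0 ≤ ∑ i, ∑ j, c i * c j * (A - ‖x i - x j‖ ^ α)) :
    Real.Gamma ((2 - α) / 2) * (Real.Gamma ((n + 1 + α) / 2) / Real.Gamma ((n + 1) / 2)) * R ^ α
      ≤ A := by
  set κ := Real.Gamma ((n + 1 + α) / 2) / Real.Gamma ((n + 1) / 2) with hκ
  set ρ := Real.Gamma ((1 + α) / 2) / Real.Gamma (1 / 2) with hρ
  have hκ0 : 0 < κ :=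
    div_pos (Real.Gamma_pos_of_pos (by positivity)) (Real.Gamma_pos_of_pos (by positivity))
  have hρ0 : 0 < ρ :=
    div_pos (Real.Gamma_pos_of_pos (by linarith)) (Real.Gamma_pos_of_pos (by norm_num))
  have H : BumpEnergyBound α κ (A * ρ) R ((1 - α) / 2 + (n + 1 : ℕ)) := by
    intro ι _ w t ht
    have hb : 0 < (1 - α) / 2 + 1 + n / 2 := by
      have : (0 : ℝ) ≤ n := n.cast_nonneg
      linarith
    have e : (1 - α) / 2 + 1 + n / 2 + n / 2 = (1 - α) / 2 + (n + 1 : ℕ) := by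
      push_cast
      ring
    rw [← e]
    exact rieszEnergy_bumpSum_le_of_posSemidef hα hb hR.le hpos ht
  have h := (BumpEnergyBound.of_add_natCast hα (by linarith) hR.le (n + 1) H).mul_rpow_le
    hα hα2 hκ0 hR
  rw [← hρ] at h
  refine le_of_mul_le_mul_right ?_ hρ0
  linarith

end Necessity

end RieszEnergy

theorem stmt_6 (d : ℕ) (hd : 1 ≤ d) (α s R : ℝ)
    (hα : 0 < α ∧ α < 2) (hs : 0 < s) (hR : 0 < R) (a : ℝ)
    (C : EuclideanSpace ℝ (Fin d) → EuclideanSpace ℝ (Fin d) → ℝ)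
    (hC : ∀ x y, C x y = a - (1 / 2) * (‖x - y‖ / s) ^ α) :
    (∀ (n : ℕ) (x : Fin n → EuclideanSpace ℝ (Fin d)),
        (∀ i, x i ∈ Metric.closedBall (0 : EuclideanSpace ℝ (Fin d)) R) →
        ∀ c : Fin n → ℝ, 0 ≤ ∑ i, ∑ j, c i * c j * C (x i) (x j)) ↔
      (Real.Gamma ((2 - α) / 2) * Real.Gamma ((d + α) / 2) / Real.Gamma (d / 2) / 2)
          * (R / s) ^ α ≤ a := by
  obtain ⟨n, rfl⟩ := Nat.exists_eq_add_of_le' hd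
  have hsα : 0 < s ^ α := Real.rpow_pos_of_pos hs α
  set A := 2 * a * s ^ α with hA
  have hCA : ∀ x y, C x y = (2 * s ^ α)⁻¹ * (A - ‖x - y‖ ^ α) := by
    intro x y
    rw [hC, Real.div_rpow (norm_nonneg _) hs.le, hA]
    field_simp
  have hsum : ∀ (m : ℕ) (x : Fin m → EuclideanSpace ℝ (Fin (n + 1))) (c : Fin m → ℝ),
      ∑ i, ∑ j, c i * c j * C (x i) (x j)
        = (2 * s ^ α)⁻¹ * ∑ i, ∑ j, c i * c j * (A - ‖x i - x j‖ ^ α) := by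
    intro m x c
    simp only [hCA, Finset.mul_sum]
    exact Finset.sum_congr rfl fun i _ => Finset.sum_congr rfl fun j _ => by ring
  have hcond : Real.Gamma ((2 - α) / 2) * Real.Gamma (((n + 1 : ℕ) + α) / 2)
        / Real.Gamma ((n + 1 : ℕ) / 2) / 2 * (R / s) ^ α ≤ a ↔
      Real.Gamma ((2 - α) / 2) * (Real.Gamma ((n + 1 + α) / 2) / Real.Gamma ((n + 1) / 2)) * R ^ α
        ≤ A := by
    rw [Real.div_rpow hR.le hs.le, Nat.cast_succ, ← mul_div_assoc, div_le_iff₀ hsα, hA, mul_div_assoc,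
      div_mul_eq_mul_div, div_le_iff₀ two_pos]
    constructor <;> intro h <;> linarith
  have h2s : 0 < (2 * s ^ α)⁻¹ := by positivity
  rw [hcond]
  simp only [hsum, mul_nonneg_iff_of_pos_left h2s]
  refine ⟨RieszEnergy.le_of_posSemidef_sub_rpow_norm_sub hα.1 hα.2 hR, fun h m x hx c => ?_⟩
  have h1 := RieszEnergy.sum_mul_rpow_norm_sub_le hα.1 hα.2 hR.le x (fun i => by simpa using hx i) c
  have h3 := mul_le_mul_of_nonneg_right h (sq_nonneg (∑ i, c i))
  simp only [mul_sub, Finset.sum_sub_distrib]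
  have e : ∑ i, ∑ j, c i * c j * A = A * (∑ i, c i) ^ 2 := by
    rw [sq, mul_comm, Finset.sum_mul_sum, Finset.sum_mul]
    exact Finset.sum_congr rfl fun i _ => (Finset.sum_mul _ _ _).symm
  rw [e]
  linarith
end

section
/- Let α ∈ (0,1], s > 0 and R > 0, and let C : [−R,R] × [−R,R] → ℝ be any symmetric positive semidefinite kernel satisfying C(x,x) − 2 C(x,y) + C(y,y) = |x − y|^α / s^α for all x, y ∈ [−R,R]. Then for every ε > 0 there exists x ∈ [−R,R] with C(x,x) > (A_{α,1}/2)(R/s)^α − ε, where A_{α,1} = Γ((2−α)/2) Γ((1+α)/2) / Γ(1/2). In other words, the maximal variance of any Gaussian representation of the variogram γ(h) = |h/s|^α on [−R,R] is at least (A_{α,1}/2)(R/s)^α, the value attained by the minimal K-stationary representation. -/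
open MeasureTheory Set
open ProbabilityTheory (beta)

theorem lintegral_Ioo_rpow_mul_one_sub_rpow {p q : ℝ} (hp : 0 < p) (hq : 0 < q) :
    ∫⁻ u in Ioo (0 : ℝ) 1, ENNReal.ofReal (u ^ (p - 1) * (1 - u) ^ (q - 1)) =
      ENNReal.ofReal (beta p q) := by
  have hB := ProbabilityTheory.beta_pos hp hq
  have h := ProbabilityTheory.lintegral_betaPDF_eq_one hp hq
  rw [ProbabilityTheory.lintegral_betaPDF] at h
  have h2 : ∫⁻ u in Ioo (0 : ℝ) 1, ENNReal.ofReal (u ^ (p - 1) * (1 - u) ^ (q - 1)) =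
      ∫⁻ u in Ioo (0 : ℝ) 1, ENNReal.ofReal (beta p q) *
        ENNReal.ofReal (1 / beta p q * u ^ (p - 1) * (1 - u) ^ (q - 1)) := by
    congr 1 with u
    rw [← ENNReal.ofReal_mul hB.le]
    congr 1
    field_simp
  rw [h2, lintegral_const_mul _ (by fun_prop), h, mul_one]

theorem lintegral_Ioo_neg_one_one_eq_lintegral_add_comp_neg {f : ℝ → ENNReal}
    (hf : Measurable f) :
    ∫⁻ t in Ioo (-1 : ℝ) 1, f t = ∫⁻ t in Ioo (0 : ℝ) 1, (f t + f (-t)) := by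
  have hneg : ∫⁻ t in Ioo (-1 : ℝ) 0, f t = ∫⁻ t in Ioo (0 : ℝ) 1, f (-t) := by
    have h := lintegral_image_eq_lintegral_abs_deriv_mul (measurableSet_Ioo (a := (0 : ℝ)) (b := 1))
      (fun x _ => hasDerivWithinAt_neg x _) neg_injective.injOn f
    simpa using h
  have hun : Ioo (-1 : ℝ) 1 = Ioc (-1 : ℝ) 0 ∪ Ioo 0 1 :=
    (Ioc_union_Ioo_eq_Ioo (by norm_num) (by norm_num)).symm
  have hd : Disjoint (Ioc (-1 : ℝ) 0) (Ioo 0 1) :=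
    Set.disjoint_left.2 fun x hx hx' => absurd hx.2 (not_le.2 hx'.1)
  rw [hun, lintegral_union measurableSet_Ioo hd, ← setLIntegral_congr Ioo_ae_eq_Ioc, hneg,
    ← lintegral_add_left (by fun_prop)]
  simp only [add_comm]

theorem lintegral_Ioo_zero_one_comp_sq (g : ℝ → ENNReal) :
    ∫⁻ u in Ioo (0 : ℝ) 1, g u =
      ∫⁻ t in Ioo (0 : ℝ) 1, ENNReal.ofReal (2 * t) * g (t ^ 2) := by
  have himg : (fun t : ℝ => t ^ 2) '' Ioo 0 1 = Ioo 0 1 := by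
    ext u
    constructor
    · rintro ⟨t, ⟨h0, h1⟩, rfl⟩
      exact ⟨by positivity, by simpa using pow_lt_one₀ h0.le h1 two_ne_zero⟩
    · rintro ⟨h0, h1⟩
      exact ⟨√u, ⟨Real.sqrt_pos.2 h0, (Real.sqrt_lt' one_pos).2 (by simpa using h1)⟩,
        Real.sq_sqrt h0.le⟩
  have h := lintegral_image_eq_lintegral_abs_deriv_mul (measurableSet_Ioo (a := (0 : ℝ)) (b := 1))
      (f := fun t : ℝ => t ^ 2) (f' := fun t => 2 * t)
      (fun x _ => by simpa using (hasDerivAt_pow 2 x).hasDerivWithinAt)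
      (fun x hx y hy hxy => (pow_left_inj₀ hx.1.le hy.1.le two_ne_zero).1 hxy) g
  rw [himg] at h
  rw [h]
  refine setLIntegral_congr_fun measurableSet_Ioo fun t ht => ?_
  simp only [abs_of_pos (mul_pos two_pos ht.1)]

theorem lintegral_Ioo_rpow_div_one_sub_mul {b z : ℝ} (hb : 0 < b) (hb1 : b < 1)
    (hz : 0 ≤ z) (hz1 : z < 1) :
    ENNReal.ofReal ((1 - z) ^ b) *
      ∫⁻ u in Ioo (0 : ℝ) 1, ENNReal.ofReal (u ^ (b - 1) * (1 - u) ^ (-b) / (1 - z * u)) =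
      ENNReal.ofReal (beta b (1 - b)) := by
  have hden : ∀ u ∈ Ioo (0 : ℝ) 1, 0 < 1 - z * u := fun u hu => by
    nlinarith [hu.1, hu.2]
  have h1z : 0 < 1 - z := by linarith
  have himg : (fun u : ℝ => u * (1 - z) / (1 - z * u)) '' Ioo 0 1 = Ioo 0 1 := by
    ext w
    constructor
    · rintro ⟨u, hu, rfl⟩
      have := hden u hu
      refine ⟨div_pos (mul_pos hu.1 h1z) this, (div_lt_one this).2 ?_⟩
      nlinarith [hu.2]
    · rintro ⟨h0, h1⟩
      have hd : 0 < 1 - z + z * w := by nlinarith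
      refine ⟨w / (1 - z + z * w), ⟨div_pos h0 hd, (div_lt_one hd).2 (by nlinarith)⟩, ?_⟩
      have : 1 - z * (w / (1 - z + z * w)) = (1 - z) / (1 - z + z * w) := by field_simp; ring
      simp only [this]
      field_simp
  have h := lintegral_image_eq_lintegral_abs_deriv_mul (measurableSet_Ioo (a := (0 : ℝ)) (b := 1))
      (f := fun u : ℝ => u * (1 - z) / (1 - z * u)) (f' := fun u => (1 - z) / (1 - z * u) ^ 2)
      (fun u hu => by
        have hd := (hden u hu).ne'
        have := ((hasDerivAt_id u).mul_const (1 - z)).div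
          (((hasDerivAt_id u).const_mul z).const_sub 1) hd
        refine (this.congr_deriv ?_).hasDerivWithinAt
        simp only [id]
        congr 1
        ring)
      (fun u hu v hv huv => by
        have h1 := hden u hu
        have h2 := hden v hv
        simp only at huv
        rw [div_eq_div_iff h1.ne' h2.ne'] at huv
        have : (1 - z) * (u - v) = 0 := by linarith
        rcases mul_eq_zero.1 this with h | h <;> linarith)
      (fun w => ENNReal.ofReal (w ^ (b - 1) * (1 - w) ^ ((1 - b) - 1)))
  rw [himg, lintegral_Ioo_rpow_mul_one_sub_rpow hb (by linarith)] at h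
  rw [h, ← lintegral_const_mul _ (by fun_prop)]
  refine setLIntegral_congr_fun measurableSet_Ioo fun u hu => ?_
  have hd := hden u hu
  have hu1 : 0 < 1 - u := by linarith [hu.2]
  rw [← ENNReal.ofReal_mul (by positivity), ← ENNReal.ofReal_mul (by positivity)]
  congr 1
  have e1 : 1 - u * (1 - z) / (1 - z * u) = (1 - u) / (1 - z * u) := by
    rw [eq_div_iff hd.ne', sub_mul, div_mul_cancel₀ _ hd.ne']; ring
  rw [e1, abs_of_pos (by positivity), Real.div_rpow (by have := hu.1; positivity) hd.le,
    Real.div_rpow hu1.le hd.le, Real.mul_rpow hu.1.le h1z.le,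
    show (1 - b - 1 : ℝ) = -b by ring, Real.rpow_sub_one h1z.ne', Real.rpow_sub_one hd.ne',
    Real.rpow_neg hd.le]
  have := (Real.rpow_pos_of_pos hd b).ne'
  field_simp

theorem lintegral_Ioo_one_sub_sq_rpow {b : ℝ} (hb1 : b < 1) :
    ∫⁻ y in Ioo (-1 : ℝ) 1, ENNReal.ofReal ((1 - y ^ 2) ^ (-b)) =
      ENNReal.ofReal (beta (1 / 2) (1 - b)) := by
  rw [lintegral_Ioo_neg_one_one_eq_lintegral_add_comp_neg (by fun_prop),
    ← lintegral_Ioo_rpow_mul_one_sub_rpow (by norm_num) (by linarith),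
    lintegral_Ioo_zero_one_comp_sq (fun u => ENNReal.ofReal (u ^ (1 / 2 - 1 : ℝ) * (1 - u) ^ _))]
  refine setLIntegral_congr_fun measurableSet_Ioo fun t ht => ?_
  have ht0 := ht.1
  have : 0 ≤ 1 - t ^ 2 := by nlinarith [ht.1, ht.2]
  simp only [neg_sq]
  rw [← ENNReal.ofReal_add (by positivity) (by positivity), ← ENNReal.ofReal_mul (by positivity)]
  congr 1
  rw [← Real.rpow_natCast t 2, ← Real.rpow_mul ht0.le, show (1 - b - 1 : ℝ) = -b by ring]
  norm_num [Real.rpow_neg_one]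
  field_simp
  ring

theorem lintegral_Ioo_abs_sub_rpow_mul_one_sub_sq_rpow {α x : ℝ} (hα : 0 < α) (hα1 : α < 1)
    (hx : x ∈ Ioo (-1 : ℝ) 1) :
    ∫⁻ y in Ioo (-1 : ℝ) 1, ENNReal.ofReal (|x - y| ^ α * (1 - y ^ 2) ^ (-((1 + α) / 2))) =
      ENNReal.ofReal (beta ((1 + α) / 2) (1 - (1 + α) / 2)) := by
  set b := (1 + α) / 2 with hb
  obtain ⟨hx0, hx1⟩ := hx
  have hx2 : 0 < 1 - x ^ 2 := by nlinarith
  have hden : ∀ t ∈ Ioo (-1 : ℝ) 1, 0 < 1 - x * t := fun t ht => by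
    nlinarith [mul_pos (sub_pos.2 hx1) (neg_lt_iff_pos_add.1 ht.1),
      mul_pos (neg_lt_iff_pos_add.1 hx0) (sub_pos.2 ht.2)]
  have hmaps : ∀ t ∈ Ioo (-1 : ℝ) 1, (x - t) / (1 - x * t) ∈ Ioo (-1 : ℝ) 1 := fun t ht => by
    have h := hden t ht
    refine ⟨(lt_div_iff₀ h).2 ?_, (div_lt_iff₀ h).2 ?_⟩ <;> nlinarith [ht.1, ht.2]
  have hinv : ∀ t ∈ Ioo (-1 : ℝ) 1,
      (x - (x - t) / (1 - x * t)) / (1 - x * ((x - t) / (1 - x * t))) = t := fun t ht => by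
    have h := (hden t ht).ne'
    have e1 : x - (x - t) / (1 - x * t) = t * (1 - x ^ 2) / (1 - x * t) := by field_simp; ring
    have e2 : 1 - x * ((x - t) / (1 - x * t)) = (1 - x ^ 2) / (1 - x * t) := by field_simp; ring
    rw [e1, e2, div_div_div_cancel_right₀ h, mul_div_cancel_right₀ _ hx2.ne']
  have himg : (fun t : ℝ => (x - t) / (1 - x * t)) '' Ioo (-1) 1 = Ioo (-1) 1 := by
    ext w
    constructor
    · rintro ⟨t, ht, rfl⟩
      exact hmaps t ht
    · intro hw
      exact ⟨_, hmaps w hw, hinv w hw⟩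
  have h := lintegral_image_eq_lintegral_abs_deriv_mul
      (measurableSet_Ioo (a := (-1 : ℝ)) (b := 1))
      (f := fun t : ℝ => (x - t) / (1 - x * t)) (f' := fun t => -(1 - x ^ 2) / (1 - x * t) ^ 2)
      (fun t ht => by
        have hd := (hden t ht).ne'
        have := ((hasDerivAt_id t).const_sub x).div
          (((hasDerivAt_id t).const_mul x).const_sub 1) hd
        refine (this.congr_deriv ?_).hasDerivWithinAt
        simp only [id]
        congr 1
        ring)
      (fun u hu v hv huv => by
        rw [← hinv u hu, ← hinv v hv]
        simp only at huv
        rw [huv])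
      (fun y => ENNReal.ofReal (|x - y| ^ α * (1 - y ^ 2) ^ (-b)))
  rw [himg] at h
  rw [h, ← lintegral_Ioo_rpow_div_one_sub_mul (z := x ^ 2) (b := b) (by positivity)
    (by linarith) (by positivity) (by linarith), lintegral_Ioo_zero_one_comp_sq,
    ← lintegral_const_mul _ (by fun_prop),
    lintegral_Ioo_neg_one_one_eq_lintegral_add_comp_neg (by fun_prop)]
  have key : ∀ t ∈ Ioo (-1 : ℝ) 1, ENNReal.ofReal |-(1 - x ^ 2) / (1 - x * t) ^ 2| *
      ENNReal.ofReal (|x - (x - t) / (1 - x * t)| ^ α *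
        (1 - ((x - t) / (1 - x * t)) ^ 2) ^ (-b)) =
      ENNReal.ofReal ((1 - x ^ 2) ^ b * (|t| ^ α * (1 - t ^ 2) ^ (-b) / (1 - x * t))) := by
    intro t ht
    have hd := hden t ht
    have ht2 : 0 < 1 - t ^ 2 := by nlinarith [ht.1, ht.2]
    rw [← ENNReal.ofReal_mul (abs_nonneg _)]
    congr 1
    have e1 : x - (x - t) / (1 - x * t) = t * ((1 - x ^ 2) / (1 - x * t)) := by field_simp; ring
    have e2 : 1 - ((x - t) / (1 - x * t)) ^ 2 =
        (1 - t ^ 2) * ((1 - x ^ 2) / (1 - x * t) ^ 2) := by field_simp; ring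
    have e3 : |-(1 - x ^ 2) / (1 - x * t) ^ 2| = (1 - x ^ 2) / (1 - x * t) ^ 2 := by
      rw [neg_div, abs_neg, abs_of_pos (by positivity)]
    rw [e1, e2, e3, abs_mul, abs_of_pos (a := (1 - x ^ 2) / (1 - x * t)) (by positivity),
      Real.mul_rpow (abs_nonneg _) (by positivity), Real.mul_rpow ht2.le (by positivity),
      Real.div_rpow hx2.le hd.le, Real.div_rpow hx2.le (by positivity),
      ← Real.rpow_natCast (1 - x * t) 2, ← Real.rpow_mul hd.le]
    have f1 : (1 - x ^ 2) ^ b = (1 - x ^ 2) * (1 - x ^ 2) ^ α * (1 - x ^ 2) ^ (-b) := by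
      rw [← Real.rpow_one_add' hx2.le (by positivity), ← Real.rpow_add hx2]
      congr 1
      linarith
    have f2 : (1 - x * t) ^ ((2 : ℕ) : ℝ) * (1 - x * t) ^ α * (1 - x * t) ^ (((2 : ℕ) : ℝ) * -b)
        = 1 - x * t := by
      rw [← Real.rpow_add hd, ← Real.rpow_add hd]
      nth_rw 2 [← Real.rpow_one (1 - x * t)]
      congr 1
      push_cast
      linarith
    rw [f1]
    conv_rhs => rw [← f2]
    have := (Real.rpow_pos_of_pos hd α).ne'
    have := (Real.rpow_pos_of_pos hd (((2 : ℕ) : ℝ) * -b)).ne'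
    field_simp
  refine setLIntegral_congr_fun measurableSet_Ioo fun t ht => ?_
  have ht0 := ht.1
  have hm : t ∈ Ioo (-1 : ℝ) 1 := ⟨by linarith, ht.2⟩
  have hm' : -t ∈ Ioo (-1 : ℝ) 1 := ⟨by linarith [ht.2], by linarith⟩
  have hd := hden t hm
  have hd' := hden _ hm'
  have ht2 : 0 < 1 - t ^ 2 := by nlinarith [ht.1, ht.2]
  have ht2' : 0 < 1 - (-t) ^ 2 := by rwa [neg_sq]
  have hxt : 0 < 1 - x ^ 2 * t ^ 2 := by nlinarith
  have hd'' : 0 < 1 + x * t := by linarith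
  rw [key t hm, key (-t) hm', ← ENNReal.ofReal_add (by positivity) (by positivity),
    ← ENNReal.ofReal_mul (by positivity), ← ENNReal.ofReal_mul (by positivity)]
  congr 1
  have e : (t ^ 2) ^ (b - 1) = t ^ α / t := by
    rw [← Real.rpow_natCast t 2, ← Real.rpow_mul ht0.le, ← Real.rpow_sub_one ht0.ne']
    congr 1
    push_cast
    linarith
  have e' : 1 - x ^ 2 * t ^ 2 = (1 - x * t) * (1 + x * t) := by ring
  rw [e, e', abs_neg, abs_of_pos ht0, neg_sq, mul_neg, sub_neg_eq_add]
  field_simp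
  ring

theorem lintegral_lintegral_le_of_forall_sum_le {Ω : Type*} [MeasurableSpace Ω]
    (μ : Measure Ω) [IsProbabilityMeasure μ] {f : Ω → Ω → ENNReal}
    (hf : Measurable (Function.uncurry f)) {S : Set Ω} (hS : ∀ᵐ x ∂μ, x ∈ S) {K : ENNReal}
    (h : ∀ (n : ℕ) (x : Fin n → Ω), (∀ i, x i ∈ S) →
      ∑ i, ∑ j, f (x i) (x j) ≤ (n : ENNReal) ^ 2 * K) (m : ℕ) :
    m * ∫⁻ x, ∫⁻ y, f x y ∂μ ∂μ ≤ (m + 1 : ℕ) * K := by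
  set E := ∫⁻ x, ∫⁻ y, f x y ∂μ ∂μ with hE
  let P := Measure.pi fun _ : Fin (m + 1) => μ
  have hae : ∀ᵐ x ∂P, ∀ i, x i ∈ S := ae_all_iff.2 fun i =>
    (measurePreserving_eval (fun _ : Fin (m + 1) => μ) i).quasiMeasurePreserving.ae hS
  have hle : ∫⁻ x, ∑ i, ∑ j, f (x i) (x j) ∂P ≤ ((m + 1 : ℕ) : ENNReal) ^ 2 * K := by
    refine (lintegral_mono_ae (hae.mono fun x hx => h _ x hx)).trans ?_
    simp
  have hpair : ∀ i j : Fin (m + 1), i ≠ j → ∫⁻ x, f (x i) (x j) ∂P = E := by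
    intro i j hij
    have hind := (ProbabilityTheory.iIndepFun_pi (μ := fun _ : Fin (m + 1) => μ)
      (X := fun _ => id) (fun _ => aemeasurable_id)).indepFun hij
    have hmap := hind.map_prod_eq_prod_map_map (measurable_pi_apply i).aemeasurable
      (measurable_pi_apply j).aemeasurable
    have hev := fun k => (measurePreserving_eval (fun _ : Fin (m + 1) => μ) k).map_eq
    have hi : Measure.map (fun ω : Fin (m + 1) → Ω => ω i) P = μ := hev i
    have hj : Measure.map (fun ω : Fin (m + 1) → Ω => ω j) P = μ := hev j
    change Measure.map (fun ω : Fin (m + 1) → Ω => (ω i, ω j)) P = _ at hmap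
    change _ = (Measure.map (fun ω : Fin (m + 1) → Ω => ω i) P).prod
      (Measure.map (fun ω : Fin (m + 1) → Ω => ω j) P) at hmap
    rw [hi, hj] at hmap
    calc ∫⁻ x, f (x i) (x j) ∂P
        = ∫⁻ z, Function.uncurry f z ∂(Measure.map (fun ω : Fin (m + 1) → Ω => (ω i, ω j)) P) := by
          rw [lintegral_map hf (by fun_prop)]; rfl
      _ = E := by rw [hmap, lintegral_prod _ hf.aemeasurable]; rfl
  have hmeas : ∀ i j : Fin (m + 1), Measurable fun x : Fin (m + 1) → Ω => f (x i) (x j) :=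
    fun i j => hf.comp (by fun_prop : Measurable fun x : Fin (m + 1) → Ω => (x i, x j))
  have hge : ((m + 1 : ℕ) : ENNReal) * (m * E) ≤ ∫⁻ x, ∑ i, ∑ j, f (x i) (x j) ∂P := by
    rw [lintegral_finsetSum _ fun i _ => Finset.measurable_sum _ fun j _ => hmeas i j]
    calc ((m + 1 : ℕ) : ENNReal) * (m * E) = ∑ i : Fin (m + 1), m * E := by simp
      _ ≤ _ := Finset.sum_le_sum fun i _ => by
        rw [lintegral_finsetSum _ fun j _ => hmeas i j]
        calc (m : ENNReal) * E = ∑ j ∈ Finset.univ.erase i, ∫⁻ x, f (x i) (x j) ∂P := by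
              rw [Finset.sum_congr rfl fun j hj => hpair i j (Finset.ne_of_mem_erase hj).symm]
              simp
          _ ≤ _ := Finset.sum_le_sum_of_subset (Finset.erase_subset _ _)
  have := hge.trans hle
  rw [sq, mul_assoc] at this
  exact (ENNReal.mul_le_mul_iff_right (by simp) (by simp)).1 this

theorem exists_isProbabilityMeasure_lintegral_abs_sub_rpow_eq {α : ℝ} (hα : 0 < α)
    (hα1 : α < 1) :
    ∃ μ : Measure ℝ, IsProbabilityMeasure μ ∧ (∀ᵐ x ∂μ, x ∈ Ioo (-1 : ℝ) 1) ∧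
      ∫⁻ x, ∫⁻ y, ENNReal.ofReal (|x - y| ^ α) ∂μ ∂μ =
        ENNReal.ofReal (Real.Gamma ((2 - α) / 2) * Real.Gamma ((1 + α) / 2) /
          Real.Gamma (1 / 2)) := by
  set b := (1 + α) / 2 with hb
  have hb0 : 0 < b := by positivity
  have hb1 : b < 1 := by linarith
  have hZ : 0 < beta (1 / 2) (1 - b) := ProbabilityTheory.beta_pos (by norm_num) (by linarith)
  set Z := ENNReal.ofReal (beta (1 / 2) (1 - b)) with hZdef
  have hZ0 : Z ≠ 0 := by simpa [hZdef] using hZ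
  have hZt : Z ≠ ⊤ := ENNReal.ofReal_ne_top
  let ν := (volume.restrict (Ioo (-1 : ℝ) 1)).withDensity
    fun y => ENNReal.ofReal ((1 - y ^ 2) ^ (-b))
  have hνac : ν ≪ volume.restrict (Ioo (-1 : ℝ) 1) := withDensity_absolutelyContinuous _ _
  have hν1 : ν univ = Z := by
    simp only [ν, withDensity_apply _ MeasurableSet.univ, Measure.restrict_univ]
    exact lintegral_Ioo_one_sub_sq_rpow hb1
  have hμ : IsProbabilityMeasure (Z⁻¹ • ν) :=
    ⟨by simp [hν1, ENNReal.inv_mul_cancel hZ0 hZt]⟩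
  have hmem : ∀ᵐ x ∂(Z⁻¹ • ν), x ∈ Ioo (-1 : ℝ) 1 :=
    Measure.ae_smul_measure (hνac.ae_le (ae_restrict_mem measurableSet_Ioo)) _
  refine ⟨Z⁻¹ • ν, hμ, hmem, ?_⟩
  have hU : ∀ x ∈ Ioo (-1 : ℝ) 1, ∫⁻ y, ENNReal.ofReal (|x - y| ^ α) ∂(Z⁻¹ • ν) =
      ENNReal.ofReal (Real.Gamma ((2 - α) / 2) * Real.Gamma b / Real.Gamma (1 / 2)) := by
    intro x hx
    rw [lintegral_smul_measure, lintegral_withDensity_eq_lintegral_mul _ (by fun_prop)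
      (by fun_prop)]
    have : ∫⁻ y in Ioo (-1 : ℝ) 1, ((fun y => ENNReal.ofReal ((1 - y ^ 2) ^ (-b))) *
        fun y => ENNReal.ofReal (|x - y| ^ α)) y = ENNReal.ofReal (beta b (1 - b)) := by
      rw [← lintegral_Ioo_abs_sub_rpow_mul_one_sub_sq_rpow hα hα1 hx]
      refine lintegral_congr fun y => ?_
      rw [Pi.mul_apply, mul_comm, ← ENNReal.ofReal_mul (by positivity)]
    rw [this, smul_eq_mul, mul_comm, ← div_eq_mul_inv, hZdef, ← ENNReal.ofReal_div_of_pos hZ]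
    congr 1
    have g1 := (Real.Gamma_pos_of_pos (sub_pos.2 hb1)).ne'
    rw [ProbabilityTheory.beta, ProbabilityTheory.beta,
      show b + (1 - b) = 1 by ring, show 1 / 2 + (1 - b) = (2 - α) / 2 by rw [hb]; ring,
      Real.Gamma_one]
    have g2 := (Real.Gamma_pos_of_pos (show (0 : ℝ) < 1 / 2 by norm_num)).ne'
    have g3 := (Real.Gamma_pos_of_pos (show 0 < (2 - α) / 2 by linarith)).ne'
    field_simp
  rw [lintegral_congr_ae (hmem.mono hU)]
  simp

theorem stmt_7 (α s R : ℝ) (hα : 0 < α ∧ α ≤ 1) (hs : 0 < s) (hR : 0 < R)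
    (C : ℝ → ℝ → ℝ)
    (hsym : ∀ x ∈ Set.Icc (-R) R, ∀ y ∈ Set.Icc (-R) R, C x y = C y x)
    (hpsd : ∀ (n : ℕ) (x : Fin n → ℝ), (∀ i, x i ∈ Set.Icc (-R) R) →
      ∀ c : Fin n → ℝ, 0 ≤ ∑ i, ∑ j, c i * c j * C (x i) (x j))
    (hvario : ∀ x ∈ Set.Icc (-R) R, ∀ y ∈ Set.Icc (-R) R,
      C x x - 2 * C x y + C y y = |x - y| ^ α / s ^ α) :
    ∀ ε > 0, ∃ x ∈ Set.Icc (-R) R,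
      (Real.Gamma ((2 - α) / 2) * Real.Gamma ((1 + α) / 2) / Real.Gamma (1 / 2) / 2)
          * (R / s) ^ α - ε < C x x := by
  intro ε hε
  obtain ⟨hα0, hα1⟩ := hα
  by_contra! hcon
  rcases hα1.eq_or_lt with rfl | hα1
  · have hRm : R ∈ Icc (-R) R := ⟨by linarith, le_rfl⟩
    have hRm' : -R ∈ Icc (-R) R := ⟨le_rfl, by linarith⟩
    have h1 := hcon R hRm
    have h2 := hcon (-R) hRm'
    have h3 := hvario R hRm (-R) hRm'
    have h4 := hpsd 2 ![R, -R] (by intro i; fin_cases i <;> simp <;> linarith) ![1, 1]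
    have h5 := hsym R hRm (-R) hRm'
    have g2 := (Real.Gamma_pos_of_pos (show (0 : ℝ) < 1 / 2 by norm_num)).ne'
    have g : Real.Gamma ((2 - 1) / 2) * Real.Gamma ((1 + 1) / 2) / Real.Gamma (1 / 2) = 1 := by
      rw [show ((2 : ℝ) - 1) / 2 = 1 / 2 by norm_num, show ((1 : ℝ) + 1) / 2 = 1 by norm_num,
        Real.Gamma_one, mul_one, div_self g2]
    rw [g, Real.rpow_one] at h1 h2
    rw [sub_neg_eq_add, abs_of_pos (by linarith), Real.rpow_one, Real.rpow_one, add_div] at h3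
    simp [Fin.sum_univ_two] at h4
    linarith
  · set A := Real.Gamma ((2 - α) / 2) * Real.Gamma ((1 + α) / 2) / Real.Gamma (1 / 2) with hA
    set M := A / 2 * (R / s) ^ α - ε with hM
    have hq : 0 < (R / s) ^ α := by positivity
    have hM0 : 0 ≤ M := by
      have h0 : (0 : ℝ) ∈ Icc (-R) R := ⟨by linarith, hR.le⟩
      have := hpsd 1 (fun _ => 0) (fun _ => h0) (fun _ => 1)
      simp only [Finset.univ_unique, Finset.sum_singleton, one_mul] at this
      exact this.trans (hcon 0 h0)
    obtain ⟨μ, _, hmem, hE⟩ := exists_isProbabilityMeasure_lintegral_abs_sub_rpow_eq hα0 hα1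
    have hsum : ∀ (n : ℕ) (x : Fin n → ℝ), (∀ i, x i ∈ Ioo (-1 : ℝ) 1) →
        ∑ i, ∑ j, |x i - x j| ^ α ≤ (n : ℝ) ^ 2 * (2 * M / (R / s) ^ α) := by
      intro n x hx
      have hy : ∀ i, R * x i ∈ Icc (-R) R := fun i =>
        ⟨by nlinarith [(hx i).1], by nlinarith [(hx i).2]⟩
      have hp := hpsd n (fun i => R * x i) hy fun _ => 1
      have hC : ∀ i j, C (R * x i) (R * x j) ≤ M - (R / s) ^ α / 2 * |x i - x j| ^ α := by
        intro i j
        have h1 := hvario _ (hy i) _ (hy j)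
        have h2 := hcon _ (hy i)
        have h3 := hcon _ (hy j)
        rw [← mul_sub, abs_mul, abs_of_pos hR, Real.mul_rpow hR.le (abs_nonneg _),
          mul_div_right_comm, ← Real.div_rpow hR.le hs.le] at h1
        linarith
      have hp' : 0 ≤ ∑ i : Fin n, ∑ j : Fin n, (M - (R / s) ^ α / 2 * |x i - x j| ^ α) :=
        hp.trans (Finset.sum_le_sum fun i _ => Finset.sum_le_sum fun j _ => by
          simpa using hC i j)
      simp only [Finset.sum_sub_distrib, ← Finset.mul_sum, Finset.sum_const, Finset.card_univ,
        Fintype.card_fin, nsmul_eq_mul] at hp'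
      rw [← mul_div_assoc, le_div_iff₀ hq]
      linarith
    have hA0 : 0 ≤ A := div_nonneg (mul_nonneg (Real.Gamma_nonneg_of_nonneg (by linarith))
      (Real.Gamma_nonneg_of_nonneg (by linarith))) (Real.Gamma_nonneg_of_nonneg (by norm_num))
    have hK0 : 0 ≤ 2 * M / (R / s) ^ α := by positivity
    have hlim : ∀ m : ℕ, m * A ≤ (m + 1) * (2 * M / (R / s) ^ α) := by
      intro m
      have h := lintegral_lintegral_le_of_forall_sum_le μ
        (f := fun x y => ENNReal.ofReal (|x - y| ^ α)) (by unfold Function.uncurry; fun_prop) hmem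
        (K := ENNReal.ofReal (2 * M / (R / s) ^ α)) (fun n x hx => by
          rw [← ENNReal.ofReal_natCast, ← ENNReal.ofReal_pow (by positivity),
            ← ENNReal.ofReal_mul (by positivity)]
          refine le_trans (le_of_eq ?_) (ENNReal.ofReal_le_ofReal (hsum n x hx))
          rw [ENNReal.ofReal_sum_of_nonneg fun i _ => Finset.sum_nonneg fun j _ => by positivity]
          refine Finset.sum_congr rfl fun i _ => ?_
          rw [ENNReal.ofReal_sum_of_nonneg fun j _ => by positivity]) m
      rw [hE, ← ENNReal.ofReal_natCast, ← ENNReal.ofReal_natCast,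
        ← ENNReal.ofReal_mul (by positivity), ← ENNReal.ofReal_mul (by positivity),
        ENNReal.ofReal_le_ofReal_iff (by positivity)] at h
      exact_mod_cast h
    have hgap : 0 < A - 2 * M / (R / s) ^ α := by
      rw [sub_pos, div_lt_iff₀ hq]
      linarith
    obtain ⟨m, hm⟩ := exists_nat_gt (2 * M / (R / s) ^ α / (A - 2 * M / (R / s) ^ α))
    rw [div_lt_iff₀ hgap] at hm
    linarith [hlim m]
end
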